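/- arXiv:2207.03875 — 2 statements merged into one kernel-verified Lean document; each statement's English description precedes it below -/
import Mathlib

section
/- Let d ≥ 1 and let P₁,…,Pₙ be points in ℝᵈ whose affine span is all of ℝᵈ. For any integers r, r' with 1 ≤ r ≤ r' and r + r' ≤ d + 1, the number of flats of rank r determined by the points is at most the number of flats of rank r' determined by the points: |𝓕ᵣ| ≤ |𝓕ᵣ'|. -/
/-- `W` is a flat determined by the points `P 0, …, P (n-1)`: a nonempty affine subspace
of `ℝᵈ` that equals the affine span of the set of points `P i` lying in `W`. -/
def IsFlatOf {n d : ℕ} (P : Fin n → (Fin d → ℝ)) (W : AffineSubspace ℝ (Fin d → ℝ)) : Prop :=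
  (W : Set (Fin d → ℝ)).Nonempty ∧ W = affineSpan ℝ (Set.range P ∩ (W : Set (Fin d → ℝ)))

/-- The rank of a flat: its dimension plus one. -/
noncomputable def flatRank {d : ℕ} (W : AffineSubspace ℝ (Fin d → ℝ)) : ℕ :=
  Module.finrank ℝ W.direction + 1

set_option linter.unusedSectionVars false
set_option linter.unusedSimpArgs false
set_option linter.deprecated false

/-- Functions supported on `T`. -/
def supOn {ι : Type} (T : Set ι) : Submodule ℝ (ι → ℝ) where
  carrier := {u | ∀ F, F ∉ T → u F = 0}
  add_mem' := by
    intro a b ha hb F hF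
    simp [ha F hF, hb F hF]
  zero_mem' := by intro F _; rfl
  smul_mem' := by
    intro c x hx F hF
    simp [hx F hF]

section generic
open Classical
variable {ι : Type} [Fintype ι] [DecidableEq ι]

theorem mem_supOn {T : Set ι} {u : ι → ℝ} : u ∈ supOn T ↔ ∀ F, F ∉ T → u F = 0 := Iff.rfl

theorem supOn_mono {T T' : Set ι} (h : T ⊆ T') : supOn T ≤ supOn T' :=
  fun _ hu F hF => hu F (fun h' => hF (h h'))

theorem single_mem_supOn {T : Set ι} {F : ι} (h : F ∈ T) (a : ℝ) : Pi.single F a ∈ supOn T := by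
  intro G hG
  have : G ≠ F := by rintro rfl; exact hG h
  simp [Pi.single_apply, this]

theorem eq_sum_single (u : ι → ℝ) : u = ∑ F, u F • (Pi.single F (1:ℝ) : ι → ℝ) := by
  funext G
  simp [Finset.sum_apply, Pi.single_apply]

theorem lin_ext {M : Type*} [AddCommGroup M] [Module ℝ M] {f g : (ι → ℝ) →ₗ[ℝ] M} {T : Set ι}
    (h : ∀ F ∈ T, f (Pi.single F 1) = g (Pi.single F 1)) {u : ι → ℝ} (hu : u ∈ supOn T) :
    f u = g u := by
  rw [eq_sum_single u, map_sum, map_sum]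
  refine Finset.sum_congr rfl fun F _ => ?_
  by_cases hF : F ∈ T
  · rw [map_smul, map_smul, h F hF]
  · rw [hu F hF]; simp

theorem lin_mem {M : Type*} [AddCommGroup M] [Module ℝ M] {f : (ι → ℝ) →ₗ[ℝ] M} {T : Set ι}
    {S : Submodule ℝ M}
    (h : ∀ F ∈ T, f (Pi.single F 1) ∈ S) {u : ι → ℝ} (hu : u ∈ supOn T) :
    f u ∈ S := by
  rw [eq_sum_single u, map_sum]
  refine Submodule.sum_mem _ fun F _ => ?_
  by_cases hF : F ∈ T
  · rw [map_smul]; exact S.smul_mem _ (h F hF)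
  · rw [hu F hF]; simp

theorem bil_ext {f g : (ι → ℝ) →ₗ[ℝ] (ι → ℝ) →ₗ[ℝ] ℝ} {T T' : Set ι}
    (h : ∀ F ∈ T, ∀ G ∈ T', f (Pi.single F 1) (Pi.single G 1) = g (Pi.single F 1) (Pi.single G 1))
    {u v : ι → ℝ} (hu : u ∈ supOn T) (hv : v ∈ supOn T') : f u v = g u v := by
  have h1 : ∀ F ∈ T, f (Pi.single F 1) v = g (Pi.single F 1) v := fun F hF =>
    lin_ext (h F hF) hv
  exact lin_ext (f := f.flip v) (g := g.flip v) (by simpa using h1) hu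

abbrev BF (ι : Type) := (ι → ℝ) →ₗ[ℝ] (ι → ℝ) →ₗ[ℝ] ℝ

def NDon (B : BF ι) (T : Set ι) : Prop :=
  ∀ u ∈ supOn T, (∀ v ∈ supOn T, B u v = 0) → u = 0

/-- extended Gram matrix -/
noncomputable def gmat (B : BF ι) (T : Set ι) : Matrix ι ι ℝ :=
  fun F G => if F ∈ T ∧ G ∈ T then B (Pi.single G 1) (Pi.single F 1) else if F = G then 1 else 0

noncomputable def rvec (B : BF ι) (T : Set ι) : (ι → ℝ) →ₗ[ℝ] (ι → ℝ) :=
  LinearMap.pi fun F => if F ∈ T then B.flip (Pi.single F 1) else 0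

noncomputable def pr (B : BF ι) (T : Set ι) : (ι → ℝ) →ₗ[ℝ] (ι → ℝ) :=
  (Matrix.mulVecLin (gmat B T)⁻¹) ∘ₗ rvec B T

theorem gmat_mulVec_of_not_mem {B : BF ι} {T : Set ι} {u : ι → ℝ} {F : ι} (hF : F ∉ T) :
    (gmat B T).mulVec u F = u F := by
  simp [gmat, Matrix.mulVec, dotProduct, hF]

theorem gmat_mulVec_of_mem {B : BF ι} {T : Set ι} {u : ι → ℝ} (hu : u ∈ supOn T) {F : ι}
    (hF : F ∈ T) : (gmat B T).mulVec u F = B u (Pi.single F 1) := by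
  conv_rhs => rw [eq_sum_single u]
  rw [map_sum, LinearMap.sum_apply]
  simp only [Matrix.mulVec, dotProduct]
  refine Finset.sum_congr rfl fun G _ => ?_
  by_cases hG : G ∈ T
  · simp [gmat, hF, hG, mul_comm]
  · simp [hu G hG]

theorem gmat_det {B : BF ι} {T : Set ι} (h : NDon B T) : (gmat B T).det ≠ 0 := by
  intro h0
  obtain ⟨u, hu, hu0⟩ := Matrix.exists_mulVec_eq_zero_iff.2 h0
  apply hu
  have hs : u ∈ supOn T := by
    intro F hF
    rw [← gmat_mulVec_of_not_mem (B := B) (u := u) hF, hu0]; rfl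
  refine h u hs fun v hv => ?_
  have := lin_ext (f := B u) (g := 0) (T := T) (fun F hF => ?_) hv
  · simpa using this
  · rw [← gmat_mulVec_of_mem hs hF, hu0]; rfl

theorem gmat_pr {B : BF ι} {T : Set ι} (h : NDon B T) (u : ι → ℝ) :
    (gmat B T).mulVec (pr B T u) = rvec B T u := by
  have : IsUnit (gmat B T).det := isUnit_iff_ne_zero.2 (gmat_det h)
  simp only [pr, LinearMap.comp_apply, Matrix.mulVecLin_apply, Matrix.mulVec_mulVec]
  rw [Matrix.mul_nonsing_inv _ this, Matrix.one_mulVec]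

theorem pr_mem {B : BF ι} {T : Set ι} (h : NDon B T) (u : ι → ℝ) : pr B T u ∈ supOn T := by
  intro F hF
  have := gmat_mulVec_of_not_mem (B := B) (T := T) (u := pr B T u) hF
  rw [gmat_pr h] at this
  rw [← this]
  simp [rvec, hF]

theorem pr_orth {B : BF ι} {T : Set ι} (h : NDon B T) (u : ι → ℝ) {v : ι → ℝ} (hv : v ∈ supOn T) :
    B (pr B T u) v = B u v := by
  refine lin_ext (T := T) (fun F hF => ?_) hv
  rw [← gmat_mulVec_of_mem (pr_mem h u) hF, gmat_pr h]
  simp [rvec, hF]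

theorem pr_unique {B : BF ι} {T : Set ι} (h : NDon B T) {u w : ι → ℝ} (hw : w ∈ supOn T)
    (ho : ∀ v ∈ supOn T, B u v = B w v) : pr B T u = w := by
  rw [← sub_eq_zero]
  refine h _ (Submodule.sub_mem _ (pr_mem h u) hw) fun v hv => ?_
  rw [map_sub, LinearMap.sub_apply, pr_orth h u hv, ho v hv, sub_self]

theorem pr_of_mem {B : BF ι} {T : Set ι} (h : NDon B T) {u : ι → ℝ} (hu : u ∈ supOn T) :
    pr B T u = u := pr_unique h hu fun _ _ => rfl

theorem bil_expand (B : BF ι) (u v : ι → ℝ) :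
    B u v = ∑ F, ∑ G, u F * v G * B (Pi.single F 1) (Pi.single G 1) := by
  conv_lhs => rw [eq_sum_single u, eq_sum_single v]
  simp only [map_sum, LinearMap.sum_apply, map_smul, LinearMap.smul_apply, smul_eq_mul]
  simp only [Finset.mul_sum]
  rw [Finset.sum_comm]
  refine Finset.sum_congr rfl fun F _ => Finset.sum_congr rfl fun G _ => by ring

theorem bil_continuousAt {α : Type*} [TopologicalSpace α] {B : α → BF ι} {a : α}
    (hB : ∀ F G, ContinuousAt (fun s => B s (Pi.single F 1) (Pi.single G 1)) a)
    {u v : α → ι → ℝ} (hu : ContinuousAt u a) (hv : ContinuousAt v a) :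
    ContinuousAt (fun s => B s (u s) (v s)) a := by
  have he : (fun s => B s (u s) (v s)) =
      fun s => ∑ F, ∑ G, u s F * v s G * B s (Pi.single F 1) (Pi.single G 1) :=
    funext fun s => bil_expand (B s) (u s) (v s)
  rw [he]
  refine tendsto_finsetSum _ fun F _ => tendsto_finsetSum _ fun G _ => ?_
  have h1 : ContinuousAt (fun s => u s F) a := (continuous_apply F).continuousAt.comp hu
  have h2 : ContinuousAt (fun s => v s G) a := (continuous_apply G).continuousAt.comp hv
  exact (h1.mul h2).mul (hB F G)

theorem pr_continuousAt {α : Type*} [TopologicalSpace α] {B : α → BF ι} {a : α} {T : Set ι}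
    (hB : ∀ F G, ContinuousAt (fun s => B s (Pi.single F 1) (Pi.single G 1)) a)
    (hN : NDon (B a) T) {u : α → ι → ℝ} (hu : ContinuousAt u a) :
    ContinuousAt (fun s => pr (B s) T (u s)) a := by
  have hM : ContinuousAt (fun s => gmat (B s) T) a := by
    refine tendsto_pi_nhds.2 fun F => tendsto_pi_nhds.2 fun G => ?_
    by_cases h : F ∈ T ∧ G ∈ T
    · simpa [gmat, h, ContinuousAt] using hB G F
    · simp only [gmat, h, if_false]; exact tendsto_const_nhds
  have hr : ContinuousAt (fun s => rvec (B s) T (u s)) a := by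
    refine tendsto_pi_nhds.2 fun F => ?_
    by_cases h : F ∈ T
    · simpa [rvec, h, ContinuousAt] using bil_continuousAt hB hu (continuousAt_const (y := Pi.single F 1))
    · simp only [rvec, h, LinearMap.pi_apply, if_false, LinearMap.zero_apply]
      exact tendsto_const_nhds
  have hdet : ContinuousAt (fun s => (gmat (B s) T).det) a :=
    (Continuous.matrix_det continuous_id).continuousAt.comp hM
  have hadj : ContinuousAt (fun s => (gmat (B s) T).adjugate) a :=
    (Continuous.matrix_adjugate continuous_id).continuousAt.comp hM
  have hinv : ContinuousAt (fun s => (gmat (B s) T)⁻¹) a := by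
    simp_rw [Matrix.inv_def, Ring.inverse_eq_inv']
    exact (hdet.inv₀ (gmat_det hN)).smul hadj
  have h2 : Continuous fun p : Matrix ι ι ℝ × (ι → ℝ) => p.1.mulVec p.2 :=
    Continuous.matrix_mulVec continuous_fst continuous_snd
  exact (h2.continuousAt (x := ((gmat (B a) T)⁻¹, rvec (B a) T (u a)))).comp
    (f := fun s => ((gmat (B s) T)⁻¹, rvec (B s) T (u s))) (hinv.prodMk hr)

/-- positivity on the part of `T2` orthogonal to `T1` -/
def PosOn (B : BF ι) (T1 T2 : Set ι) : Prop :=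
  ∀ u ∈ supOn T2, (∀ v ∈ supOn T1, B u v = 0) → u ≠ 0 → 0 < B u u

noncomputable def restr (T : Set ι) (u : ι → ℝ) : ι → ℝ := fun F => if F ∈ T then u F else 0

theorem restr_mem (T : Set ι) (u : ι → ℝ) : restr T u ∈ supOn T := by
  intro F hF; simp [restr, hF]

theorem sub_restr_mem {T1 T2 : Set ι} {u : ι → ℝ} (hu : u ∈ supOn T2) :
    u - restr (T2 \ T1) u ∈ supOn T1 := by
  intro F hF
  by_cases h : F ∈ T2
  · simp [restr, hF, h]
  · simp [restr, h, hu F h]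

theorem eq_hat {B : BF ι} {T1 T2 : Set ι} (hN : NDon B T1) {u : ι → ℝ} (hu : u ∈ supOn T2)
    (ho : ∀ v ∈ supOn T1, B u v = 0) :
    u = restr (T2 \ T1) u - pr B T1 (restr (T2 \ T1) u) := by
  have h1 := sub_restr_mem (T1 := T1) hu
  have h2 : pr B T1 (restr (T2 \ T1) u) = -(u - restr (T2 \ T1) u) := by
    refine pr_unique hN (Submodule.neg_mem _ h1) fun v hv => ?_
    simp [ho v hv]
  rw [h2]; abel

theorem hat_orth {B : BF ι} {T : Set ι} (h : NDon B T) (u : ι → ℝ) {v : ι → ℝ}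
    (hv : v ∈ supOn T) : B (u - pr B T u) v = 0 := by
  rw [map_sub, LinearMap.sub_apply, pr_orth h u hv, sub_self]

theorem psd_cs {E : Type*} [AddCommGroup E] [Module ℝ E] {Q : E →ₗ[ℝ] E →ₗ[ℝ] ℝ}
    (hs : ∀ x y, Q x y = Q y x) {S : Submodule ℝ E} (hp : ∀ x ∈ S, 0 ≤ Q x x) {x y : E}
    (hx : x ∈ S) (hy : y ∈ S) : (Q x y) ^ 2 ≤ Q x x * Q y y := by
  have key : ∀ t : ℝ, 0 ≤ Q y y * (t * t) + 2 * Q x y * t + Q x x := fun t => by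
    have := hp (x + t • y) (S.add_mem hx (S.smul_mem t hy))
    simp only [map_add, map_smul, LinearMap.add_apply, LinearMap.smul_apply, smul_eq_mul] at this
    rw [hs y x] at this
    linarith
  have := discrim_le_zero key
  rw [discrim] at this
  nlinarith

theorem posOn_of_psd {B : BF ι} (hs : ∀ x y, B x y = B y x) {T1 T2 : Set ι} (h12 : T1 ⊆ T2)
    (h1 : NDon B T1) (h2 : NDon B T2)
    (hp : ∀ u ∈ supOn T2, (∀ v ∈ supOn T1, B u v = 0) → 0 ≤ B u u) : PosOn B T1 T2 := by
  intro u hu ho hne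
  refine lt_of_le_of_ne (hp u hu ho) fun h0 => hne ?_
  refine h2 u hu fun v hv => ?_
  let S : Submodule ℝ (ι → ℝ) :=
    { carrier := {u | u ∈ supOn T2 ∧ ∀ v ∈ supOn T1, B u v = 0}
      add_mem' := fun ha hb => ⟨Submodule.add_mem _ ha.1 hb.1, fun v hv => by
        simp [ha.2 v hv, hb.2 v hv]⟩
      zero_mem' := ⟨Submodule.zero_mem _, by simp⟩
      smul_mem' := fun c x hx => ⟨Submodule.smul_mem _ _ hx.1, fun v hv => by simp [hx.2 v hv]⟩ }
  have hv' : v - pr B T1 v ∈ S :=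
    ⟨Submodule.sub_mem _ hv (supOn_mono h12 (pr_mem h1 v)), fun w hw => hat_orth h1 v hw⟩
  have := psd_cs hs (S := S) (fun x hx => hp x hx.1 hx.2) (x := u) (y := v - pr B T1 v) ⟨hu, ho⟩ hv'
  rw [← h0, zero_mul] at this
  have h3 : B u (v - pr B T1 v) = 0 := by nlinarith
  rw [map_sub, ho _ (pr_mem h1 v), sub_zero] at h3
  exact h3

theorem deform {B : unitInterval → BF ι} (hs : ∀ s x y, B s x y = B s y x)
    (hB : ∀ F G, Continuous (fun s => B s (Pi.single F 1) (Pi.single G 1)))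
    {T1 T2 : Set ι} (h12 : T1 ⊆ T2) (h1 : ∀ s, NDon (B s) T1) (h2 : ∀ s, NDon (B s) T2)
    (h0 : PosOn (B 0) T1 T2) : PosOn (B 1) T1 T2 := by
  let hat : unitInterval → (ι → ℝ) → (ι → ℝ) := fun s x => x - pr (B s) T1 x
  have hhat : ∀ (x : ι → ℝ), Continuous fun s => hat s x := fun x =>
    continuous_iff_continuousAt.2 fun s => continuousAt_const.sub
      (pr_continuousAt (fun F G => (hB F G).continuousAt) (h1 s) continuousAt_const)
  have hhat2 : Continuous fun p : unitInterval × (ι → ℝ) => B p.1 (hat p.1 p.2) (hat p.1 p.2) :=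
    continuous_iff_continuousAt.2 fun p => by
      have hb : ∀ F G, ContinuousAt (fun p : unitInterval × (ι → ℝ) =>
          B p.1 (Pi.single F 1) (Pi.single G 1)) p := fun F G =>
        ((hB F G).comp continuous_fst).continuousAt
      have : ContinuousAt (fun p : unitInterval × (ι → ℝ) => hat p.1 p.2) p :=
        continuousAt_snd.sub (pr_continuousAt hb (h1 p.1) continuousAt_snd)
      exact bil_continuousAt hb this this
  have hatmem : ∀ s, ∀ x ∈ supOn (T2 \ T1), hat s x ∈ supOn T2 := fun s x hx =>
    Submodule.sub_mem _ (supOn_mono Set.sdiff_subset hx) (supOn_mono h12 (pr_mem (h1 s) x))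
  have hatne : ∀ s, ∀ x ∈ supOn (T2 \ T1), x ≠ 0 → hat s x ≠ 0 := fun s x hx hne h => by
    apply hne
    have hh : x = pr (B s) T1 x := sub_eq_zero.1 h
    funext F
    by_cases hF : F ∈ T1
    · exact hx F (fun h => h.2 hF)
    · rw [hh]; exact pr_mem (h1 s) x F hF
  have hclosed : IsClosed {s | PosOn (B s) T1 T2} := by
    have : {s | PosOn (B s) T1 T2} =
        ⋂ x ∈ supOn (T2 \ T1), {s | 0 ≤ B s (hat s x) (hat s x)} := by
      ext s
      simp only [Set.mem_ofPred_eq, Set.mem_iInter]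
      constructor
      · intro h x hx
        by_cases hx0 : hat s x = 0
        · simp [hx0]
        · exact (h _ (hatmem s x hx) (fun v hv => hat_orth (h1 s) x hv) hx0).le
      · intro h
        refine posOn_of_psd (hs s) h12 (h1 s) (h2 s) fun u hu ho => ?_
        have := h _ (restr_mem (T2 \ T1) u)
        have h3 : hat s (restr (T2 \ T1) u) = u := (eq_hat (h1 s) hu ho).symm
        rwa [h3] at this
    rw [this]
    refine isClosed_biInter fun x _ => isClosed_le continuous_const ?_
    exact hhat2.comp (continuous_id.prodMk continuous_const)
  have hopen : IsOpen {s | PosOn (B s) T1 T2} := by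
    rw [← isClosed_compl_iff]
    let Sp : Set (ι → ℝ) := Metric.sphere 0 1 ∩ (supOn (T2 \ T1) : Set (ι → ℝ))
    have hSp : IsCompact Sp := (isCompact_sphere 0 1).inter_right
      (Submodule.closed_of_finiteDimensional _)
    have : {s | PosOn (B s) T1 T2}ᶜ = Prod.fst ''
        ((Set.univ ×ˢ Sp) ∩ {p : unitInterval × (ι → ℝ) | B p.1 (hat p.1 p.2) (hat p.1 p.2) ≤ 0}) := by
      ext s
      simp only [Set.mem_compl_iff, Set.mem_ofPred_eq, Set.mem_image, Set.mem_inter_iff,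
        Set.mem_prod, Set.mem_univ, true_and, Prod.exists, exists_and_right, exists_eq_right]
      constructor
      · intro h
        simp only [PosOn, not_forall, not_lt] at h
        obtain ⟨u, hu, ho, hne, hle⟩ := h
        set x := restr (T2 \ T1) u with hx
        have h3 : hat s x = u := (eq_hat (h1 s) hu ho).symm
        have hxne : x ≠ 0 := by
          intro h; apply hne; rw [← h3, h]; simp [hat]
        have hn : ‖x‖ ≠ 0 := norm_ne_zero_iff.2 hxne
        refine ⟨‖x‖⁻¹ • x, ⟨by simp [norm_smul, hn], Submodule.smul_mem _ _ (restr_mem _ _)⟩, ?_⟩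
        have : hat s (‖x‖⁻¹ • x) = ‖x‖⁻¹ • u := by
          rw [← h3]; simp [hat, smul_sub]
        rw [this]
        simp only [map_smul, LinearMap.smul_apply, smul_eq_mul]
        have : 0 ≤ ‖x‖⁻¹ := inv_nonneg.2 (norm_nonneg _)
        nlinarith [mul_nonneg this this]
      · rintro ⟨x, ⟨hx1, hx2⟩, hle⟩ hp
        have hx0 : x ≠ 0 := by
          rintro rfl; simp at hx1
        exact absurd (hp _ (hatmem s x hx2) (fun v hv => hat_orth (h1 s) x hv) (hatne s x hx2 hx0))
          (not_lt.2 hle)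
    rw [this]
    have hcomp : IsCompact ((Set.univ ×ˢ Sp) ∩
        {p : unitInterval × (ι → ℝ) | B p.1 (hat p.1 p.2) (hat p.1 p.2) ≤ 0}) :=
      (isCompact_univ.prod hSp).inter_right (isClosed_le hhat2 continuous_const)
    exact (hcomp.image continuous_fst).isClosed
  have := IsClopen.eq_univ ⟨hclosed, hopen⟩ ⟨0, h0⟩
  have h3 : (1 : unitInterval) ∈ {s | PosOn (B s) T1 T2} := by rw [this]; trivial
  exact h3

end generic

set_option linter.unusedSectionVars false
set_option linter.unusedSimpArgs false
set_option linter.deprecated false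

section lattice
open Classical
variable {K V : Type} [Field K] [Fintype K] [AddCommGroup V] [Module K V] [Fintype V]

noncomputable instance instFintypeSubm : Fintype (Submodule K V) := Fintype.ofFinite _

noncomputable def rk (F : Submodule K V) : ℕ := Module.finrank K F

abbrev sp (K : Type) {V : Type} [Field K] [AddCommGroup V] [Module K V] (i : V) : Submodule K V :=
  Submodule.span K {i}

theorem rk_mono {F G : Submodule K V} (h : F ≤ G) : rk F ≤ rk G := Submodule.finrank_mono h

theorem eq_of_rk {F G : Submodule K V} (h : F ≤ G) (h' : rk G ≤ rk F) : F = G :=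
  Submodule.eq_of_le_of_finrank_le h h'

theorem rk_le (F : Submodule K V) : rk F ≤ Module.finrank K V := Submodule.finrank_le F

theorem rk_top : rk (⊤ : Submodule K V) = Module.finrank K V := finrank_top K V

theorem rk_bot : rk (⊥ : Submodule K V) = 0 := finrank_bot K V

theorem rk_sup_inf (F G : Submodule K V) : rk (F ⊔ G) + rk (F ⊓ G) = rk F + rk G :=
  Submodule.finrank_sup_add_finrank_inf_eq F G

theorem mem_sp (i : V) : i ∈ sp K i := Submodule.mem_span_singleton_self i

theorem sp_le {i : V} {F : Submodule K V} : sp K i ≤ F ↔ i ∈ F := by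
  simp [sp, Submodule.span_le]

theorem sup_sp_of_mem {i : V} {F : Submodule K V} (h : i ∈ F) : F ⊔ sp K i = F :=
  sup_eq_left.2 (sp_le.2 h)

theorem mem_sup_sp (F : Submodule K V) (i : V) : i ∈ F ⊔ sp K i :=
  (le_sup_right : sp K i ≤ F ⊔ sp K i) (mem_sp i)

theorem rk_sup_sp {F : Submodule K V} {i : V} (h : i ∉ F) : rk (F ⊔ sp K i) = rk F + 1 := by
  have h0 : i ≠ 0 := fun h0 => h (h0 ▸ F.zero_mem)
  have h1 := rk_sup_inf F (sp K i)
  have h2 : rk (sp K i) = 1 := finrank_span_singleton h0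
  have h3 : rk (F ⊓ sp K i) < rk (sp K i) := by
    apply Submodule.finrank_lt_finrank_of_lt
    refine lt_of_le_of_ne inf_le_right fun h => ?_
    exact ‹i ∉ F› (((inf_eq_right.1 h) : sp K i ≤ F) (mem_sp i))
  omega

theorem rk_sup_sp_le (F : Submodule K V) (i : V) : rk (F ⊔ sp K i) ≤ rk F + 1 := by
  by_cases h : i ∈ F
  · rw [sup_sp_of_mem h]; omega
  · rw [rk_sup_sp h]

/-- exchange -/
theorem exch {F : Submodule K V} {i k : V} (hi : i ∉ F) (hk : k ∉ F) :
    i ∉ F ⊔ sp K k ↔ k ∉ F ⊔ sp K i := by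
  have key : ∀ {i k : V}, i ∉ F → k ∉ F → i ∈ F ⊔ sp K k → k ∈ F ⊔ sp K i := by
    intro i k hi hk h
    have h1 : F ⊔ sp K i ≤ F ⊔ sp K k := sup_le le_sup_left (sp_le.2 h)
    have h2 := eq_of_rk h1 (by rw [rk_sup_sp hi, rk_sup_sp hk])
    rw [h2]; exact mem_sup_sp F k
  exact not_congr ⟨key hi hk, key hk hi⟩

theorem not_mem_of_not_mem_sup {F G : Submodule K V} {i : V} (h : i ∉ F ⊔ G) : i ∉ F :=
  fun h' => h ((le_sup_left : F ≤ F ⊔ G) h')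

theorem sup_sp_eq_iff {E H : Submodule K V} {i : V} (hE : E ≤ H) (hi : i ∉ H) :
    H ⊔ sp K i = E ⊔ sp K i ↔ H = E := by
  constructor
  · intro h
    have h1 := rk_sup_sp hi
    have h2 := rk_sup_sp (fun h' => hi (hE h') : i ∉ E)
    rw [h] at h1
    exact (eq_of_rk hE (by omega)).symm
  · rintro rfl; rfl

noncomputable def bw (c : V → ℝ) : ℕ → Submodule K V → ℝ
  | 0, _ => 1
  | (l+1), F => (∑ i, if i ∈ F then 0 else c i * bw c l (F ⊔ sp K i)) / (l + 1)

noncomputable def bb (c : V → ℝ) (F : Submodule K V) : ℝ := bw c (Module.finrank K V - rk F) F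

theorem bb_top (c : V → ℝ) : bb c (⊤ : Submodule K V) = 1 := by
  simp [bb, rk_top, bw]

theorem rk_lt_of_ne_top {F : Submodule K V} (h : F ≠ ⊤) : rk F < Module.finrank K V :=
  Submodule.finrank_lt h

theorem bb_rec (c : V → ℝ) (F : Submodule K V) :
    ((Module.finrank K V : ℝ) - rk F) * bb c F =
      ∑ i, if i ∈ F then 0 else c i * bb c (F ⊔ sp K i) := by
  by_cases hF : F = ⊤
  · subst hF; simp [rk_top]
  have h1 := rk_lt_of_ne_top hF
  obtain ⟨l, hl⟩ : ∃ l, Module.finrank K V - rk F = l + 1 := ⟨Module.finrank K V - rk F - 1, by omega⟩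
  have h2 : (Module.finrank K V : ℝ) - rk F = l + 1 := by
    rw [← Nat.cast_sub h1.le, hl]; push_cast; rfl
  rw [h2, bb, hl, bw]
  have : ((l:ℝ) + 1) ≠ 0 := by positivity
  rw [mul_div_cancel₀ _ this]
  refine Finset.sum_congr rfl fun i _ => ?_
  split_ifs with hi
  · rfl
  · rw [bb, rk_sup_sp hi, show Module.finrank K V - (rk F + 1) = l by omega]

/-- downward induction over corank -/
theorem corank_ind {P : Submodule K V → Prop}
    (h : ∀ F, (∀ i, i ∉ F → P (F ⊔ sp K i)) → P F) (F : Submodule K V) : P F := by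
  have : ∀ l, ∀ F : Submodule K V, Module.finrank K V - rk F = l → P F := by
    intro l
    induction l with
    | zero =>
      intro F hF
      refine h F fun i hi => ?_
      have : F = ⊤ := by
        by_contra h'; have := rk_lt_of_ne_top h'; omega
      exact absurd (this ▸ Submodule.mem_top) hi
    | succ l ih =>
      intro F hF
      refine h F fun i hi => ih _ ?_
      rw [rk_sup_sp hi]; omega
  exact this _ F rfl

theorem bb_update (c : V → ℝ) (i : V) (t : ℝ) (F : Submodule K V) :
    bb (Function.update c i t) F = bb c F + (t - c i) * (if i ∈ F then 0 else bb c (F ⊔ sp K i)) := by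
  induction F using corank_ind with
  | h F ih =>
  by_cases hF : F = ⊤
  · subst hF; simp [bb_top]
  have h1 := rk_lt_of_ne_top hF
  have hne : ((Module.finrank K V : ℝ) - rk F) ≠ 0 := by
    have : (rk F : ℝ) < Module.finrank K V := by exact_mod_cast h1
    linarith
  apply mul_left_cancel₀ hne
  rw [bb_rec, mul_add, bb_rec]
  by_cases hi : i ∈ F
  · simp only [hi, if_true, mul_zero, add_zero]
    refine Finset.sum_congr rfl fun k _ => ?_
    split_ifs with hk
    · rfl
    · rw [ih k hk, if_pos ((le_sup_left : F ≤ F ⊔ sp K k) hi), mul_zero, add_zero,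
        Function.update_of_ne (by rintro rfl; exact hk hi)]
  · simp only [hi, if_false]
    have h2 : (∑ k, if k ∈ F then 0 else Function.update c i t k * bb (Function.update c i t) (F ⊔ sp K k))
      = (∑ k, if k ∈ F then 0 else c k * bb c (F ⊔ sp K k))
        + (∑ k, if k = i then (t - c i) * bb c (F ⊔ sp K i) else 0)
        + (t - c i) * ∑ k, if k ∈ F ⊔ sp K i then 0 else c k * bb c ((F ⊔ sp K i) ⊔ sp K k) := by
      rw [Finset.mul_sum, ← Finset.sum_add_distrib, ← Finset.sum_add_distrib]
      refine Finset.sum_congr rfl fun k _ => ?_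
      by_cases hk : k ∈ F
      · have hki : k ≠ i := by rintro rfl; exact hi hk
        have : k ∈ F ⊔ sp K i := (le_sup_left : F ≤ F ⊔ sp K i) hk
        simp [hk, hki, this]
      · rw [ih k hk]
        by_cases hki : k = i
        · subst hki
          simp [hk, mem_sup_sp]; ring
        · by_cases h3 : i ∈ F ⊔ sp K k
          · have h4 : k ∈ F ⊔ sp K i := by
              by_contra h5; exact ((exch hi hk).2 h5) h3
            simp [hk, hki, h3, h4]
          · have h4 : k ∉ F ⊔ sp K i := (exch hi hk).1 h3
            simp only [hk, hki, h3, h4, if_false, Function.update_of_ne hki]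
            rw [sup_right_comm]; ring
    rw [h2, ← bb_rec, ← bb_rec, rk_sup_sp hi]
    simp only [Finset.sum_ite_eq', Finset.mem_univ, if_true]
    push_cast; ring

theorem bb_continuous (F : Submodule K V) : Continuous fun c : V → ℝ => bb c F := by
  have : ∀ l, ∀ F : Submodule K V, Continuous fun c : V → ℝ => bw c l F := by
    intro l
    induction l with
    | zero => intro F; simp only [bw]; exact continuous_const
    | succ l ih =>
      intro F
      simp only [bw]
      refine (continuous_finsetSum _ fun i _ => ?_).div_const _
      split_ifs
      · exact continuous_const
      · exact (continuous_apply i).mul (ih _)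
  exact this _ F

theorem bw_nonneg {c : V → ℝ} (hc : ∀ i, 0 ≤ c i) : ∀ l, ∀ F : Submodule K V, 0 ≤ bw c l F := by
  intro l
  induction l with
  | zero => intro F; simp [bw]
  | succ l ih =>
    intro F
    simp only [bw]
    refine div_nonneg (Finset.sum_nonneg fun i _ => ?_) (by positivity)
    split_ifs
    · rfl
    · exact mul_nonneg (hc i) (ih _)

theorem bb_nonneg {c : V → ℝ} (hc : ∀ i, 0 ≤ c i) (F : Submodule K V) : 0 ≤ bb c F := bw_nonneg hc _ F

theorem bw_mono {c c' : V → ℝ} (hc : ∀ i, 0 ≤ c i) (hcc : ∀ i, c i ≤ c' i) :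
    ∀ l, ∀ F : Submodule K V, bw c l F ≤ bw c' l F := by
  intro l
  induction l with
  | zero => intro F; simp [bw]
  | succ l ih =>
    intro F
    simp only [bw]
    refine div_le_div_of_nonneg_right (Finset.sum_le_sum fun i _ => ?_) (by positivity)
    split_ifs
    · rfl
    · exact mul_le_mul (hcc i) (ih _) (bw_nonneg hc _ _) ((hc i).trans (hcc i))

theorem bb_mono {c c' : V → ℝ} (hc : ∀ i, 0 ≤ c i) (hcc : ∀ i, c i ≤ c' i) (F : Submodule K V) :
    bb c F ≤ bb c' F := bw_mono hc hcc _ F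

/-- positivity: nonneg weights, positive on a set spanning everything -/
theorem bb_pos {c : V → ℝ} (hc : ∀ i, 0 ≤ c i) {S : Set V} (hS : ∀ i ∈ S, 0 < c i)
    (hspan : Submodule.span K S = ⊤) (F : Submodule K V) : 0 < bb c F := by
  induction F using corank_ind with
  | h F ih =>
  by_cases hF : F = ⊤
  · subst hF; simp [bb_top]
  have h1 := rk_lt_of_ne_top hF
  have hpos : 0 < ((Module.finrank K V : ℝ) - rk F) := by
    have : (rk F : ℝ) < Module.finrank K V := by exact_mod_cast h1
    linarith
  refine pos_of_mul_pos_right (a := ((Module.finrank K V : ℝ) - rk F)) ?_ hpos.le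
  rw [bb_rec]
  obtain ⟨i, hiS, hi⟩ : ∃ i ∈ S, i ∉ F := by
    by_contra h
    push Not at h
    apply hF
    rw [eq_top_iff, ← hspan, Submodule.span_le]
    exact h
  refine Finset.sum_pos' (fun k _ => ?_) ⟨i, Finset.mem_univ _, ?_⟩
  · split_ifs
    · rfl
    · exact mul_nonneg (hc k) (bb_nonneg hc _)
  · rw [if_neg hi]; exact mul_pos (hS i hiS) (ih i hi)

theorem bb_zero (F : Submodule K V) : bb (0 : V → ℝ) F = if F = ⊤ then 1 else 0 := by
  by_cases hF : F = ⊤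
  · subst hF; simp [bb_top]
  rw [if_neg hF]
  have h1 := rk_lt_of_ne_top hF
  have hne : ((Module.finrank K V : ℝ) - rk F) ≠ 0 := by
    have : (rk F : ℝ) < Module.finrank K V := by exact_mod_cast h1
    linarith
  apply mul_left_cancel₀ hne
  rw [bb_rec]; simp

noncomputable def y (i : V) : (Submodule K V → ℝ) →ₗ[ℝ] (Submodule K V → ℝ) :=
  ∑ F : Submodule K V, if i ∈ F then 0 else
    (LinearMap.single ℝ (fun _ : Submodule K V => ℝ) (F ⊔ sp K i)) ∘ₗ LinearMap.proj F

theorem y_single (i : V) (F : Submodule K V) (a : ℝ) :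
    y i (Pi.single F a) = if i ∈ F then 0 else Pi.single (F ⊔ sp K i) a := by
  rw [y, LinearMap.sum_apply, Finset.sum_eq_single F]
  · split_ifs <;> simp
  · intro G _ hG
    split_ifs
    · simp
    · simp [Pi.single_apply, hG]
  · simp

theorem y_comm (i j : V) (u : Submodule K V → ℝ) : y i (y j u) = y j (y i u) := by
  refine lin_ext (f := y i ∘ₗ y j) (g := y j ∘ₗ y i) (T := Set.univ) (fun F _ => ?_)
    (fun F hF => absurd trivial hF)
  simp only [LinearMap.comp_apply, y_single]
  by_cases hi : i ∈ F
  · have : i ∈ F ⊔ sp K j := (le_sup_left : F ≤ _) hi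
    by_cases hj : j ∈ F <;> simp [hi, hj, y_single, this]
  · by_cases hj : j ∈ F
    · have : j ∈ F ⊔ sp K i := (le_sup_left : F ≤ _) hj
      simp [hi, hj, y_single, this]
    · simp only [hi, hj, if_false, y_single]
      by_cases h : i ∈ F ⊔ sp K j
      · have h' : j ∈ F ⊔ sp K i := by
          by_contra h5; exact ((exch hi hj).2 h5) h
        simp [h, h']
      · have h' : j ∉ F ⊔ sp K i := (exch hi hj).1 h
        simp only [h, h', if_false]
        rw [sup_right_comm]

theorem y_sq (i : V) (u : Submodule K V → ℝ) : y i (y i u) = 0 := by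
  refine lin_ext (f := y i ∘ₗ y i) (g := 0) (T := Set.univ) (fun F _ => ?_)
    (fun F hF => absurd trivial hF)
  simp only [LinearMap.comp_apply, y_single]
  by_cases hi : i ∈ F
  · simp [hi]
  · simp [hi, y_single, mem_sup_sp]

noncomputable def Bm (c : V → ℝ) (E : Submodule K V) : BF (Submodule K V) :=
  Matrix.toBilin' (Matrix.of fun F G => if F ⊓ G = E then bb c (F ⊔ G) else 0)

theorem Bm_single (c : V → ℝ) (E F G : Submodule K V) :
    Bm c E (Pi.single F 1) (Pi.single G 1) = if F ⊓ G = E then bb c (F ⊔ G) else 0 := by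
  rw [Bm, Matrix.toBilin'_single]; rfl

theorem mem_univ_supOn {ι : Type} (u : ι → ℝ) : u ∈ supOn (Set.univ : Set ι) :=
  fun _ hF => absurd trivial hF

theorem Bm_symm (c : V → ℝ) (E : Submodule K V) (u v : Submodule K V → ℝ) :
    Bm c E u v = Bm c E v u := by
  refine bil_ext (f := Bm c E) (g := (Bm c E).flip) (fun F _ G _ => ?_)
    (mem_univ_supOn u) (mem_univ_supOn v)
  rw [LinearMap.flip_apply, Bm_single, Bm_single, inf_comm, sup_comm]

def up (E : Submodule K V) : Set (Submodule K V) := {F | E ≤ F}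
def AF (E : Submodule K V) (j : ℕ) : Set (Submodule K V) := {F | E ≤ F ∧ rk F < rk E + j}

theorem AF_sub_up (E : Submodule K V) (j : ℕ) : AF E j ⊆ up E := fun _ h => h.1

theorem AF_mono (E : Submodule K V) {j k : ℕ} (h : j ≤ k) : AF E j ⊆ AF E k :=
  fun _ h' => ⟨h'.1, by have := h'.2; omega⟩

theorem AF_big (E : Submodule K V) {j : ℕ} (h : Module.finrank K V < rk E + j) : AF E j = up E := by
  ext F
  exact ⟨fun h => h.1, fun h' => ⟨h', (rk_le F).trans_lt h⟩⟩

theorem inf_key {E F G : Submodule K V} {i : V} (hF : E ≤ F) (hG : E ≤ G) (hi : i ∉ F) :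
    (F ⊔ sp K i) ⊓ G = E ↔ F ⊓ G = E ∧ i ∉ F ⊔ G := by
  have h1 := rk_sup_inf (F ⊔ sp K i) G
  have h2 := rk_sup_inf F G
  have h3 := rk_sup_sp hi
  have hle : F ⊓ G ≤ (F ⊔ sp K i) ⊓ G := inf_le_inf_right G le_sup_left
  have hE : E ≤ F ⊓ G := le_inf hF hG
  have h5 : F ⊔ sp K i ⊔ G = F ⊔ G ⊔ sp K i := sup_right_comm _ _ _
  rw [h5] at h1
  by_cases h : i ∈ F ⊔ G
  · rw [sup_sp_of_mem h] at h1
    constructor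
    · intro h6
      have := rk_mono hE
      rw [h6] at h1
      omega
    · exact fun h6 => absurd h h6.2
  · rw [rk_sup_sp h] at h1
    have := eq_of_rk hle (by omega)
    rw [← this]
    exact ⟨fun h6 => ⟨h6, h⟩, fun h6 => h6.1⟩

theorem By_single (c : V → ℝ) {E F G : Submodule K V} (i : V) (hF : E ≤ F) (hG : E ≤ G) :
    Bm c E (y i (Pi.single F 1)) (Pi.single G 1) =
      if F ⊓ G = E ∧ i ∉ F ⊔ G then bb c (F ⊔ G ⊔ sp K i) else 0 := by
  rw [y_single]
  by_cases hi : i ∈ F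
  · have : i ∈ F ⊔ G := (le_sup_left : F ≤ _) hi
    simp [hi, this]
  · rw [if_neg hi, Bm_single, sup_right_comm]
    simp only [inf_key hF hG hi]

theorem B_y_selfadj (c : V → ℝ) {E : Submodule K V} (i : V) {u v : Submodule K V → ℝ}
    (hu : u ∈ supOn (up E)) (hv : v ∈ supOn (up E)) : Bm c E (y i u) v = Bm c E u (y i v) := by
  refine bil_ext (f := Bm c E ∘ₗ y i) (g := (Bm c E).compl₂ (y i)) (fun F hF G hG => ?_) hu hv
  rw [LinearMap.comp_apply, LinearMap.compl₂_apply, By_single c i hF hG, Bm_symm,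
    By_single c i hG hF, inf_comm, sup_comm]

theorem y_mem_up {E : Submodule K V} (i : V) {u : Submodule K V → ℝ} (hu : u ∈ supOn (up E)) :
    y i u ∈ supOn (up (E ⊔ sp K i)) := by
  refine lin_mem (fun F hF => ?_) hu
  rw [y_single]
  split_ifs
  · exact Submodule.zero_mem _
  · exact single_mem_supOn (sup_le_sup_right hF _) _

theorem up_sup {E : Submodule K V} (i : V) : up (E ⊔ sp K i) ⊆ up E :=
  fun _ h => (le_sup_left : E ≤ E ⊔ sp K i).trans h

theorem y_mem_up' {E : Submodule K V} (i : V) {u : Submodule K V → ℝ} (hu : u ∈ supOn (up E)) :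
    y i u ∈ supOn (up E) := supOn_mono (up_sup i) (y_mem_up i hu)

theorem y_mem_AF {E : Submodule K V} {i : V} (hi : i ∉ E) {j : ℕ} {u : Submodule K V → ℝ}
    (hu : u ∈ supOn (AF E j)) : y i u ∈ supOn (AF (E ⊔ sp K i) j) := by
  refine lin_mem (fun F hF => ?_) hu
  rw [y_single]
  split_ifs with h
  · exact Submodule.zero_mem _
  · refine single_mem_supOn (T := AF (E ⊔ sp K i) j) ⟨sup_le_sup_right hF.1 _, ?_⟩ _
    rw [rk_sup_sp h, rk_sup_sp hi]; have := hF.2; omega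

theorem AF_sup {E : Submodule K V} {i : V} (hi : i ∉ E) (j : ℕ) :
    AF (E ⊔ sp K i) j ⊆ AF E (j + 1) :=
  fun F h => ⟨le_sup_left.trans h.1, by have := h.2; rw [rk_sup_sp hi] at this; omega⟩

/-- P3 -/
theorem B_gysin (c : V → ℝ) {E : Submodule K V} {i : V} (hi : i ∉ E) {w v : Submodule K V → ℝ}
    (hw : w ∈ supOn (up (E ⊔ sp K i))) (hv : v ∈ supOn (up E)) :
    Bm c E w v = Bm c (E ⊔ sp K i) w (y i v) := by
  refine bil_ext (f := Bm c E) (g := (Bm c (E ⊔ sp K i)).compl₂ (y i)) (fun F hF G hG => ?_) hw hv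
  rw [LinearMap.compl₂_apply, Bm_single, y_single]
  have hiF : i ∈ F := hF (mem_sup_sp E i)
  by_cases hiG : i ∈ G
  · rw [if_neg]
    · simp [hiG]
    · rintro rfl; exact hi ⟨hiF, hiG⟩
  · rw [if_neg hiG, Bm_single]
    have h1 : F ⊓ (G ⊔ sp K i) = (F ⊓ G) ⊔ sp K i := by
      rw [inf_sup_assoc_of_le G (sp_le.2 hiF)]
    have h2 : F ⊔ (G ⊔ sp K i) = F ⊔ G := by
      rw [← sup_assoc, sup_right_comm, sup_sp_of_mem hiF]
    rw [h1, h2]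
    have hE : E ≤ F ⊓ G := le_inf (le_sup_left.trans hF) hG
    simp only [sup_sp_eq_iff hE (fun h => hiG h.2)]

theorem B_y_y (c : V → ℝ) {E : Submodule K V} {i : V} (hi : i ∉ E) {u v : Submodule K V → ℝ}
    (hu : u ∈ supOn (up E)) (hv : v ∈ supOn (up E)) :
    Bm c E (y i u) v = Bm c (E ⊔ sp K i) (y i u) (y i v) :=
  B_gysin c hi (y_mem_up i hu) hv

theorem y_of_mem {E : Submodule K V} {i : V} (hi : i ∈ E) {u : Submodule K V → ℝ}
    (hu : u ∈ supOn (up E)) : y i u = 0 := by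
  refine lin_ext (f := y i) (g := 0) (fun F hF => ?_) hu
  rw [y_single, if_pos (hF hi)]; rfl

noncomputable def ee (K : Type) {V : Type} [Field K] [Fintype K] [AddCommGroup V] [Module K V]
    [Fintype V] (c : V → ℝ) : (Submodule K V → ℝ) →ₗ[ℝ] (Submodule K V → ℝ) :=
  ∑ i, c i • y i

noncomputable def NN (E : Submodule K V) : (Submodule K V → ℝ) →ₗ[ℝ] (Submodule K V → ℝ) :=
  LinearMap.pi fun F => ((rk F : ℝ) - rk E) • LinearMap.proj F

theorem NN_apply (E F : Submodule K V) (u : Submodule K V → ℝ) :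
    NN E u F = ((rk F : ℝ) - rk E) * u F := rfl

theorem NN_single (E F : Submodule K V) :
    NN E (Pi.single F 1) = ((rk F : ℝ) - rk E) • Pi.single F 1 := by
  funext G
  rw [NN_apply]
  by_cases h : G = F
  · subst h; simp
  · simp [h]

theorem ee_apply (c : V → ℝ) (u : Submodule K V → ℝ) : ee K c u = ∑ i, c i • y i u := by
  simp [ee, LinearMap.sum_apply]

/-- P4 Euler -/
theorem euler (c : V → ℝ) {E : Submodule K V} {u v : Submodule K V → ℝ}
    (hu : u ∈ supOn (up E)) (hv : v ∈ supOn (up E)) :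
    Bm c E (ee K c u) v = ((Module.finrank K V : ℝ) - rk E) * Bm c E u v - Bm c E (NN E u) v
      - Bm c E u (NN E v) := by
  have := bil_ext (f := Bm c E ∘ₗ ee K c)
    (g := ((Module.finrank K V : ℝ) - rk E) • Bm c E - Bm c E ∘ₗ NN E - (Bm c E).compl₂ (NN E))
    (fun F hF G hG => ?_) hu hv
  · simpa using this
  · simp only [LinearMap.comp_apply, LinearMap.sub_apply, LinearMap.smul_apply,
      LinearMap.compl₂_apply, NN_single, map_smul, smul_eq_mul, ee_apply, map_sum,
      LinearMap.sum_apply, By_single c _ hF hG, Bm_single]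
    by_cases h : F ⊓ G = E
    · have h2 := rk_sup_inf F G
      rw [h] at h2
      have h3 : (rk (F ⊔ G) : ℝ) + rk E = rk F + rk G := by exact_mod_cast h2
      simp only [h, true_and, if_true]
      have := bb_rec c (F ⊔ G)
      simp only [mul_ite, mul_zero, ite_not]
      rw [← this]
      have h4 : (rk (F ⊔ G) : ℝ) = rk F + rk G - rk E := by linarith
      rw [h4]; ring
    · simp [h]

/-- P5 -/
theorem B_update (c : V → ℝ) (i : V) (t : ℝ) {E : Submodule K V} {u v : Submodule K V → ℝ}
    (hu : u ∈ supOn (up E)) (hv : v ∈ supOn (up E)) :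
    Bm (Function.update c i t) E u v = Bm c E u v + (t - c i) * Bm c E (y i u) v := by
  have := bil_ext (f := Bm (Function.update c i t) E)
    (g := Bm c E + (t - c i) • (Bm c E ∘ₗ y i)) (fun F hF G hG => ?_) hu hv
  · simpa using this
  · simp only [LinearMap.comp_apply, LinearMap.add_apply, LinearMap.smul_apply, smul_eq_mul,
      By_single c _ hF hG, Bm_single]
    by_cases h : F ⊓ G = E
    · simp [h, bb_update]
    · simp [h]

theorem NN_ee (c : V → ℝ) (E : Submodule K V) (u : Submodule K V → ℝ) :
    NN E (ee K c u) = ee K c (NN E u) + ee K c u := by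
  refine lin_ext (f := NN E ∘ₗ ee K c) (g := ee K c ∘ₗ NN E + ee K c) (fun F _ => ?_)
    (mem_univ_supOn u)
  simp only [LinearMap.comp_apply, LinearMap.add_apply, NN_single, map_smul, ee_apply, map_sum,
    Finset.smul_sum, ← Finset.sum_add_distrib]
  refine Finset.sum_congr rfl fun i _ => ?_
  rw [y_single]
  split_ifs with h
  · simp
  · rw [NN_single, rk_sup_sp h]; push_cast; module

theorem Bm_continuous (E F G : Submodule K V) :
    Continuous fun c : V → ℝ => Bm c E (Pi.single F 1) (Pi.single G 1) := by
  simp only [Bm_single]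
  split_ifs
  · exact bb_continuous _
  · exact continuous_const

end lattice

set_option linter.unusedSectionVars false
set_option linter.unusedSimpArgs false
set_option linter.deprecated false

section socle
open Classical
variable {K V : Type} [Field K] [Fintype K] [AddCommGroup V] [Module K V] [Fintype V]

theorem sum_mem_card (F : Submodule K V) :
    ∑ i : V, (if i ∈ F then (1:ℝ) else 0) = (Fintype.card K : ℝ) ^ rk F := by
  rw [Finset.sum_ite, Finset.sum_const_zero, add_zero, Finset.sum_const, nsmul_eq_mul, mul_one]
  have h := Module.card_eq_pow_finrank (K := K) (V := F)
  rw [rk, ← Nat.cast_pow, ← h]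
  congr 1
  rw [Fintype.card_subtype]

theorem one_lt_q (K : Type) [Field K] [Fintype K] : (1:ℝ) < Fintype.card K := by
  exact_mod_cast Fintype.one_lt_card

theorem y_apply (i : V) (u : Submodule K V → ℝ) (G : Submodule K V) :
    y i u G = ∑ F, if i ∉ F ∧ F ⊔ sp K i = G then u F else 0 := by
  rw [y, LinearMap.sum_apply, Finset.sum_apply]
  refine Finset.sum_congr rfl fun F _ => ?_
  by_cases hi : i ∈ F
  · simp [hi]
  · by_cases hG : F ⊔ sp K i = G
    · simp [hi, hG]
    · simp [hi, hG, Pi.single_apply, Ne.symm hG]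

def cov (F G : Submodule K V) : Prop := F ≤ G ∧ rk F + 1 = rk G

theorem cov_iff {F G : Submodule K V} {i : V} (hi : i ∈ G) :
    (i ∉ F ∧ F ⊔ sp K i = G) ↔ cov F G ∧ i ∉ F := by
  constructor
  · rintro ⟨h1, rfl⟩
    exact ⟨⟨le_sup_left, (rk_sup_sp h1).symm⟩, h1⟩
  · rintro ⟨⟨h1, h2⟩, h3⟩
    exact ⟨h3, eq_of_rk (sup_le h1 (sp_le.2 hi)) (by rw [rk_sup_sp h3, h2])⟩

theorem rk_inf_cov {F F' G : Submodule K V} (h : cov F G) (h' : cov F' G) (hne : F ≠ F') :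
    rk (F ⊓ F') + 1 = rk F' := by
  have h1 := rk_sup_inf F F'
  have h2 : F ⊔ F' = G := by
    refine eq_of_rk (sup_le h.1 h'.1) ?_
    by_contra h3
    have h4 : rk F ≤ rk (F ⊔ F') := rk_mono le_sup_left
    have h5 : F = F ⊔ F' := eq_of_rk le_sup_left (by have := h.2; omega)
    have h6 : F' = F ⊔ F' := eq_of_rk le_sup_right (by have := h.2; have := h'.2; omega)
    exact hne (h5.trans h6.symm)
  rw [h2] at h1
  have := h.2; have := h'.2
  omega

theorem socle {E : Submodule K V} {u : Submodule K V → ℝ} (hu : u ∈ supOn (up E))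
    (h : ∀ i, i ∉ E → y i u = 0) {F₀ : Submodule K V} (hF : F₀ ≠ ⊤) : u F₀ = 0 := by
  obtain ⟨k, hk⟩ : ∃ k, k ∉ F₀ := by
    by_contra h; push Not at h; exact hF (eq_top_iff.2 fun x _ => h x)
  set G := F₀ ⊔ sp K k with hG
  have hc0 : cov F₀ G := ⟨le_sup_left, (rk_sup_sp hk).symm⟩
  have hy : ∀ i, y i u = 0 := fun i => by
    by_cases hi : i ∈ E
    · exact y_of_mem hi hu
    · exact h i hi
  have h1 : ∀ i ∈ G, ∑ F, (if cov F G ∧ i ∈ F then u F else 0) = ∑ F, if cov F G then u F else 0 := by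
    intro i hi
    have h2 := congrFun (hy i) G
    rw [y_apply] at h2
    simp only [cov_iff hi, Pi.zero_apply] at h2
    suffices h2' : ∑ F, (if cov F G ∧ i ∈ F then u F else 0) = (∑ F, if cov F G then u F else 0)
        - ∑ F, (if cov F G ∧ i ∉ F then u F else 0) by
      rw [h2', h2, sub_zero]
    rw [← Finset.sum_sub_distrib]
    refine Finset.sum_congr rfl fun F _ => ?_
    by_cases h3 : cov F G <;> by_cases h4 : i ∈ F <;> simp [h3, h4]
  set s := ∑ F, if cov F G then u F else 0 with hs
  set q := (Fintype.card K : ℝ) with hq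
  have hq1 : 1 < q := one_lt_q K
  have h2 : ∀ H ≤ G, ∑ F, (if cov F G then q ^ rk (F ⊓ H) * u F else 0) = q ^ rk H * s := by
    intro H hH
    have h3 : ∑ i, ∑ F, (if i ∈ H then (if cov F G ∧ i ∈ F then u F else 0) else 0) = q ^ rk H * s := by
      rw [hq, ← sum_mem_card, Finset.sum_mul]
      refine Finset.sum_congr rfl fun i _ => ?_
      by_cases hi : i ∈ H
      · simp only [hi, if_true, one_mul]; exact h1 i (hH hi)
      · simp [hi]
    rw [← h3, Finset.sum_comm]
    refine Finset.sum_congr rfl fun F _ => ?_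
    rw [hq, ← sum_mem_card]
    by_cases h4 : cov F G
    · rw [if_pos h4, Finset.sum_mul]
      refine Finset.sum_congr rfl fun i _ => ?_
      by_cases h5 : i ∈ F <;> by_cases h6 : i ∈ H <;> simp [h4, h5, h6]
    · simp [h4]
  have hs0 : s = 0 := by
    have h3 := h2 G le_rfl
    have h4 : ∑ F, (if cov F G then q ^ rk (F ⊓ G) * u F else 0) = q ^ rk F₀ * s := by
      rw [hs, Finset.mul_sum]
      refine Finset.sum_congr rfl fun F _ => ?_
      by_cases h5 : cov F G
      · rw [if_pos h5, if_pos h5, inf_eq_left.2 h5.1]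
        have : rk F = rk F₀ := by have := h5.2; have := hc0.2; omega
        rw [this]
      · simp [h5]
    rw [h4, ← hc0.2, pow_succ] at h3
    have h5 : 0 < q ^ rk F₀ := by positivity
    have h6 : q ^ rk F₀ * ((q - 1) * s) = 0 := by linarith
    rcases mul_eq_zero.1 h6 with h7 | h7
    · exact absurd h7 h5.ne'
    · rcases mul_eq_zero.1 h7 with h8 | h8
      · linarith
      · exact h8
  have h3 := h2 F₀ le_sup_left
  rw [hs0, mul_zero] at h3
  have h4 : q * ∑ F, (if cov F G then q ^ rk (F ⊓ F₀) * u F else 0) =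
      q ^ rk F₀ * s + ∑ F, if F = F₀ then (q - 1) * q ^ rk F₀ * u F₀ else 0 := by
    rw [hs, Finset.mul_sum, Finset.mul_sum, ← Finset.sum_add_distrib]
    refine Finset.sum_congr rfl fun F _ => ?_
    by_cases h6 : F = F₀
    · subst h6; simp only [hc0, if_true, inf_idem]; ring
    · by_cases h5 : cov F G
      · simp only [h5, h6, if_true, if_false, add_zero]
        rw [← rk_inf_cov h5 hc0 h6, pow_succ]; ring
      · simp [h5, h6]
  rw [h3, hs0] at h4
  simp only [mul_zero, zero_add, Finset.sum_ite_eq', Finset.mem_univ, if_true] at h4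
  have h5 : 0 < (q - 1) * q ^ rk F₀ := mul_pos (by linarith) (by positivity)
  rcases mul_eq_zero.1 h4.symm with h6 | h6
  · exact absurd h6 h5.ne'
  · exact h6

/-- the graded piece `V_j` -/
def Vp (c : V → ℝ) (E : Submodule K V) (j : ℕ) : Submodule ℝ (Submodule K V → ℝ) where
  carrier := {u | u ∈ supOn (AF E (j+1)) ∧ ∀ v ∈ supOn (AF E j), Bm c E u v = 0}
  add_mem' := fun ha hb => ⟨Submodule.add_mem _ ha.1 hb.1, fun v hv => by
        simp [ha.2 v hv, hb.2 v hv]⟩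
  zero_mem' := ⟨Submodule.zero_mem _, by simp⟩
  smul_mem' := fun c x hx => ⟨Submodule.smul_mem _ _ hx.1, fun v hv => by simp [hx.2 v hv]⟩

theorem mem_Vp {c : V → ℝ} {E : Submodule K V} {j : ℕ} {u : Submodule K V → ℝ} :
    u ∈ Vp c E j ↔ u ∈ supOn (AF E (j+1)) ∧ ∀ v ∈ supOn (AF E j), Bm c E u v = 0 := Iff.rfl

def HR (c : V → ℝ) (E : Submodule K V) : Prop :=
  ∀ j, ∀ u ∈ Vp c E j, u ≠ 0 → 0 < (-1) ^ j * Bm c E u u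

theorem HR.nonneg {c : V → ℝ} {E : Submodule K V} (h : HR c E) {j : ℕ} {u : Submodule K V → ℝ}
    (hu : u ∈ Vp c E j) : 0 ≤ (-1) ^ j * Bm c E u u := by
  by_cases h0 : u = 0
  · simp [h0]
  · exact (h j u hu h0).le

theorem NN_mem {T : Set (Submodule K V)} (E : Submodule K V) {u : Submodule K V → ℝ}
    (hu : u ∈ supOn T) : NN E u ∈ supOn T := fun F hF => by
  rw [NN_apply, hu F hF, mul_zero]

theorem up_of_AF {E : Submodule K V} {j : ℕ} {u : Submodule K V → ℝ} (hu : u ∈ supOn (AF E j)) :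
    u ∈ supOn (up E) := supOn_mono (AF_sub_up E j) hu

/-- `y_i u` lies in the next graded piece when `u` is orthogonal to the same level -/
theorem B_ee_self (c : V → ℝ) {E : Submodule K V} {u v : Submodule K V → ℝ}
    (hu : u ∈ supOn (up E)) (hv : v ∈ supOn (up E)) :
    Bm c E (ee K c u) v = ∑ i, if i ∈ E then 0 else c i * Bm c (E ⊔ sp K i) (y i u) (y i v) := by
  rw [ee_apply, map_sum, LinearMap.sum_apply]
  refine Finset.sum_congr rfl fun i _ => ?_
  rw [map_smul, LinearMap.smul_apply, smul_eq_mul]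
  by_cases hi : i ∈ E
  · simp [hi, y_of_mem hi hu]
  · rw [if_neg hi, B_y_y c hi hu hv]

theorem nd_of_HR {c : V → ℝ} (hc : ∀ i, 0 < c i) {E : Submodule K V}
    (h : ∀ i, i ∉ E → HR c (E ⊔ sp K i)) (j : ℕ) : NDon (Bm c E) (AF E j) := by
  intro u hu ho
  cases j with
  | zero =>
    funext F
    exact hu F (fun h => by have := rk_mono h.1; have := h.2; omega)
  | succ j =>
    have huU := up_of_AF hu
    have hmem : ∀ i, i ∉ E → y i u ∈ Vp c (E ⊔ sp K i) j := fun i hi =>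
      ⟨y_mem_AF hi hu, fun v hv => by
        rw [Bm_symm, ← B_gysin c hi (up_of_AF hv) huU, Bm_symm]
        exact ho v (supOn_mono (AF_sup hi j) hv)⟩
    have h1 := euler c huU huU
    rw [ho u hu, Bm_symm c E (NN E u) u, ho _ (NN_mem E hu), B_ee_self c huU huU] at h1
    have h2 : ∑ i, (if i ∈ E then 0 else
        c i * ((-1) ^ j * Bm c (E ⊔ sp K i) (y i u) (y i u))) = 0 := by
      have : ∑ i, (if i ∈ E then 0 else
        c i * ((-1) ^ j * Bm c (E ⊔ sp K i) (y i u) (y i u))) =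
        (-1) ^ j * ∑ i, (if i ∈ E then 0 else c i * (Bm c (E ⊔ sp K i) (y i u) (y i u))) := by
        rw [Finset.mul_sum]
        refine Finset.sum_congr rfl fun i _ => ?_
        split_ifs
        · simp
        · ring
      rw [this, h1]; ring
    have h3 := (Finset.sum_eq_zero_iff_of_nonneg (fun i _ => by
      split_ifs with hi
      · rfl
      · exact mul_nonneg (hc i).le ((h i hi).nonneg (hmem i hi)))).1 h2
    have h4 : ∀ i, i ∉ E → y i u = 0 := fun i hi => by
      by_contra hne
      have h5 := h3 i (Finset.mem_univ _)
      rw [if_neg hi] at h5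
      exact absurd h5 (mul_pos (hc i) (h i hi j _ (hmem i hi) hne)).ne'
    have h5 : u = u ⊤ • Pi.single (⊤ : Submodule K V) (1:ℝ) := by
      funext F
      by_cases hF : F = ⊤
      · subst hF; simp
      · simp [hF, socle huU h4 hF]
    have h6 := ho (Pi.single E 1) (single_mem_supOn (T := AF E (j+1)) ⟨le_rfl, by omega⟩ 1)
    rw [h5, map_smul, LinearMap.smul_apply, Bm_single] at h6
    simp [bb_top] at h6
    rw [h5, h6, zero_smul]

end socle

set_option linter.unusedSectionVars false
set_option linter.unusedSimpArgs false
set_option linter.deprecated false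

section harmonic
open Classical
variable {K V : Type} [Field K] [Fintype K] [AddCommGroup V] [Module K V] [Fintype V]

abbrev c1 (V : Type) : V → ℝ := fun _ => 1

theorem sum_not_mem_card (F G : Submodule K V) (h : F ≤ G) :
    ∑ i : V, (if i ∈ G ∧ i ∉ F then (1:ℝ) else 0) =
      (Fintype.card K : ℝ) ^ rk G - (Fintype.card K : ℝ) ^ rk F := by
  rw [← sum_mem_card, ← sum_mem_card, ← Finset.sum_sub_distrib]
  refine Finset.sum_congr rfl fun i _ => ?_
  by_cases h1 : i ∈ F
  · simp [h1, h h1]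
  · by_cases h2 : i ∈ G <;> simp [h1, h2]

theorem bw_c1 (l : ℕ) : ∃ β : ℝ, ∀ F : Submodule K V, rk F + l = Module.finrank K V →
    bw (c1 V) l F = β := by
  induction l with
  | zero => exact ⟨1, fun F _ => rfl⟩
  | succ l ih =>
    obtain ⟨β, hβ⟩ := ih
    refine ⟨(((Fintype.card K : ℝ) ^ Module.finrank K V - (Fintype.card K : ℝ) ^ (Module.finrank K V - (l+1))) * β) / (l+1),
      fun F hF => ?_⟩
    rw [bw]
    congr 1
    have h1 := sum_not_mem_card F ⊤ le_top
    rw [rk_top, show rk F = Module.finrank K V - (l+1) by omega] at h1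
    rw [← h1, Finset.sum_mul]
    refine Finset.sum_congr rfl fun i _ => ?_
    by_cases hi : i ∈ F
    · simp [hi]
    · simp only [hi, if_false, Submodule.mem_top, true_and, not_false_eq_true, if_true]
      rw [hβ _ (by rw [rk_sup_sp hi]; omega)]

theorem bb_c1 (ρ : ℕ) : ∃ β : ℝ, 0 < β ∧ ∀ F : Submodule K V, rk F = ρ → bb (c1 V) F = β := by
  by_cases h : ∃ F : Submodule K V, rk F = ρ
  · obtain ⟨F₀, h0⟩ := h
    obtain ⟨β, hβ⟩ := bw_c1 (K := K) (V := V) (Module.finrank K V - ρ)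
    have h1 : ∀ F : Submodule K V, rk F = ρ → bb (c1 V) F = β := fun F hF => by
      rw [bb, hF]; exact hβ F (by have := rk_le F; omega)
    refine ⟨β, ?_, h1⟩
    rw [← h1 F₀ h0]
    exact bb_pos (S := Set.univ) (by simp) (by simp) (by simp) F₀
  · exact ⟨1, one_pos, fun F hF => absurd ⟨F, hF⟩ h⟩

def Hm (E : Submodule K V) (j : ℕ) : Set (Submodule K V) := {F | E ≤ F ∧ rk F = rk E + j}

theorem Hm_sub (E : Submodule K V) (j : ℕ) : Hm E j ⊆ AF E (j+1) :=
  fun _ h => ⟨h.1, by have := h.2; omega⟩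

theorem Hm_eq (E : Submodule K V) (j : ℕ) : Hm E j = AF E (j+1) \ AF E j := by
  ext F
  constructor
  · intro h; exact ⟨Hm_sub E j h, fun h' => by have := h.2; have := h'.2; omega⟩
  · rintro ⟨h1, h2⟩
    refine ⟨h1.1, ?_⟩
    have h3 := h1.2
    by_contra h4
    exact h2 ⟨h1.1, by omega⟩

/-- harmonic functions of level `j` -/
def Harm (E : Submodule K V) (j : ℕ) (h : Submodule K V → ℝ) : Prop :=
  h ∈ supOn (Hm E j) ∧ ∀ L : Submodule K V, E ≤ L → rk L + 1 = rk E + j →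
    ∑ i, (if i ∈ L then 0 else h (L ⊔ sp K i)) = 0

theorem harm_Z {E : Submodule K V} {j : ℕ} {h : Submodule K V → ℝ} (hh : Harm E j h)
    (L : Submodule K V) : E ≤ L → rk L < rk E + j → ∑ F, (if L ≤ F then h F else 0) = 0 := by
  induction L using corank_ind with
  | h L ih =>
  intro hE hL
  have h1 : ∑ i, (if i ∈ L then 0 else ∑ F, (if L ⊔ sp K i ≤ F then h F else 0)) = 0 := by
    by_cases h2 : rk L + 1 = rk E + j
    · refine Eq.trans ?_ (hh.2 L hE h2)
      refine Finset.sum_congr rfl fun i _ => ?_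
      by_cases hi : i ∈ L
      · simp [hi]
      · simp only [hi, if_false]
        rw [Finset.sum_eq_single (L ⊔ sp K i)]
        · simp
        · intro F _ hF
          by_cases h3 : L ⊔ sp K i ≤ F
          · rw [if_pos h3]
            refine hh.1 F fun h4 => hF ?_
            exact (eq_of_rk h3 (by rw [rk_sup_sp hi, h4.2, h2])).symm
          · rw [if_neg h3]
        · simp
    · refine Finset.sum_eq_zero fun i _ => ?_
      by_cases hi : i ∈ L
      · simp [hi]
      · rw [if_neg hi]
        exact ih i hi (hE.trans le_sup_left) (by rw [rk_sup_sp hi]; omega)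
  have h2 : ∑ i, (if i ∈ L then 0 else ∑ F, (if L ⊔ sp K i ≤ F then h F else 0)) =
      ((Fintype.card K : ℝ) ^ (rk E + j) - (Fintype.card K : ℝ) ^ rk L) *
        ∑ F, (if L ≤ F then h F else 0) := by
    rw [Finset.mul_sum]
    have : ∀ i, (if i ∈ L then (0:ℝ) else ∑ F, (if L ⊔ sp K i ≤ F then h F else 0)) =
      ∑ F, (if L ≤ F then (if i ∈ F ∧ i ∉ L then 1 else 0) * h F else 0) := by
      intro i
      by_cases hi : i ∈ L
      · simp [hi]
      · simp only [hi, if_false]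
        refine Finset.sum_congr rfl fun F _ => ?_
        by_cases h3 : L ≤ F <;> by_cases h4 : i ∈ F <;> simp [h3, h4, hi]
    simp only [this]
    rw [Finset.sum_comm]
    refine Finset.sum_congr rfl fun F _ => ?_
    by_cases h3 : L ≤ F
    · simp only [h3, if_true]
      rw [← Finset.sum_mul, sum_not_mem_card L F h3]
      by_cases h4 : F ∈ Hm E j
      · rw [h4.2]
      · rw [hh.1 F h4]; ring
    · simp [h3]
  rw [h2] at h1
  have h3 : (Fintype.card K : ℝ) ^ rk L < (Fintype.card K : ℝ) ^ (rk E + j) :=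
    pow_lt_pow_right₀ (one_lt_q K) hL
  rcases mul_eq_zero.1 h1 with h4 | h4
  · linarith
  · exact h4

noncomputable def ff (h : Submodule K V → ℝ) (E' G : Submodule K V) : ℝ :=
  ∑ F, if F ⊓ G = E' then h F else 0

theorem harm_f {E : Submodule K V} {j : ℕ} {h : Submodule K V → ℝ} (hh : Harm E j h)
    {G : Submodule K V} (hG : rk G < rk E + j) (E' : Submodule K V) :
    E ≤ E' → ∀ L, E' ≤ L → ff h L G = 0 := by
  induction E' using corank_ind with
  | h E' ih =>
  intro hE
  have h1 : ∀ L, E' ≤ L → L ≠ E' → ff h L G = 0 := by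
    intro L hL hne
    obtain ⟨i, hi, hi'⟩ : ∃ i ∈ L, i ∉ E' := by
      by_contra h; push Not at h; exact hne (le_antisymm h hL)
    exact ih i hi' (hE.trans le_sup_left) L (sup_le hL (sp_le.2 hi))
  have h2 : ff h E' G = 0 := by
    by_cases hEG : E' ≤ G
    · have h3 := harm_Z hh E' hE ((rk_mono hEG).trans_lt hG)
      have h4 : ∑ F, (if E' ≤ F then h F else 0) = ∑ L, if E' ≤ L then ff h L G else 0 := by
        have : ∀ L, (if E' ≤ L then ff h L G else 0) = ∑ F, if E' ≤ L ∧ F ⊓ G = L then h F else 0 := by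
          intro L
          by_cases hL : E' ≤ L <;> simp [hL, ff]
        simp only [this]
        rw [Finset.sum_comm]
        refine Finset.sum_congr rfl fun F _ => ?_
        rw [Finset.sum_eq_single (F ⊓ G)]
        · by_cases hF : E' ≤ F <;> simp [hF, hEG]
        · intro L _ hL
          rw [if_neg]; exact fun h => hL h.2.symm
        · simp
      rw [h4, Finset.sum_eq_single E'] at h3
      · simpa using h3
      · intro L _ hL
        by_cases h5 : E' ≤ L
        · rw [if_pos h5]; exact h1 L h5 hL
        · rw [if_neg h5]
      · simp
    · refine Finset.sum_eq_zero fun F _ => ?_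
      rw [if_neg]
      rintro rfl
      exact hEG inf_le_right
  intro L hL
  by_cases h3 : L = E'
  · rw [h3, h2]
  · exact h1 L hL h3

theorem count_key {E' H G F : Submodule K V} (hEH : E' ≤ H) (hHG : cov H G) :
    ∑ i : V, (if (i ∈ G ∧ i ∉ H) ∧ F ⊓ G = E' ⊔ sp K i then (1:ℝ) else 0) =
      ((Fintype.card K : ℝ) ^ (rk E' + 1) - (Fintype.card K : ℝ) ^ rk E') *
        ((if F ⊓ H = E' then 1 else 0) - (if F ⊓ G = E' then 1 else 0)) := by
  by_cases h1 : F ⊓ G = E'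
  · have h2 : F ⊓ H = E' := by
      apply le_antisymm
      · rw [← h1]; exact inf_le_inf_left _ hHG.1
      · rw [← h1] at hEH ⊢; exact le_inf inf_le_left hEH
    simp only [h1, h2, if_true, sub_self, mul_zero]
    refine Finset.sum_eq_zero fun i _ => ?_
    rw [if_neg]
    rintro ⟨⟨h3, h4⟩, h5⟩
    exact h4 (hEH (h5 ▸ mem_sup_sp E' i))
  · by_cases h2 : F ⊓ H = E'
    · have hEA : E' ≤ F ⊓ G := by rw [← h2]; exact inf_le_inf_left _ hHG.1
      have h3 := rk_sup_inf (F ⊓ G) H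
      have h4 : F ⊓ G ⊓ H = E' := by rw [inf_assoc, inf_eq_right.2 hHG.1, h2]
      have h5 : rk (F ⊓ G ⊔ H) ≤ rk G := rk_mono (sup_le inf_le_right hHG.1)
      have h6 : rk E' < rk (F ⊓ G) := by
        by_contra h; exact h1 (eq_of_rk hEA (not_lt.1 h)).symm
      have h7 : rk (F ⊓ G) = rk E' + 1 := by rw [h4] at h3; have := hHG.2; omega
      simp only [h1, h2, if_true, if_false, sub_zero, mul_one]
      rw [← h7, ← sum_not_mem_card E' (F ⊓ G) hEA]
      refine Finset.sum_congr rfl fun i _ => if_congr ?_ rfl rfl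
      constructor
      · rintro ⟨⟨h8, h9⟩, h10⟩
        exact ⟨h10 ▸ mem_sup_sp E' i, fun h => h9 (hEH h)⟩
      · rintro ⟨h8, h9⟩
        refine ⟨⟨h8.2, fun h => h9 (h2 ▸ ⟨h8.1, h⟩)⟩, ?_⟩
        exact (eq_of_rk (sup_le hEA (sp_le.2 h8)) (by rw [rk_sup_sp h9, h7])).symm
    · simp only [h1, h2, if_false, sub_self, mul_zero]
      refine Finset.sum_eq_zero fun i _ => ?_
      rw [if_neg]
      rintro ⟨⟨h3, h4⟩, h5⟩
      apply h2
      have hEA : E' ≤ F ⊓ G := by rw [h5]; exact le_sup_left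
      have h6 : E' ≤ F ⊓ H := le_inf (hEA.trans inf_le_left) hEH
      refine (eq_of_rk h6 ?_).symm
      have h7 : F ⊓ H ≤ F ⊓ G := inf_le_inf_left _ hHG.1
      have h8 := rk_sup_sp (fun h => h4 (hEH h) : i ∉ E')
      by_contra h9
      have h10 : F ⊓ H = F ⊓ G := eq_of_rk h7 (by rw [h5, h8]; omega)
      have h11 : i ∈ F ⊓ H := by rw [h10, h5]; exact mem_sup_sp E' i
      exact h4 h11.2

theorem exists_hyper {E' G : Submodule K V} (h : E' ≤ G) (hne : rk E' < rk G) :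
    ∃ H, E' ≤ H ∧ cov H G := by
  obtain ⟨H, hH, hmax⟩ := Set.Finite.exists_maximalFor (fun H : Submodule K V => rk H)
    {H : Submodule K V | E' ≤ H ∧ H ≤ G ∧ rk H < rk G} (Set.toFinite _) ⟨E', le_rfl, h, hne⟩
  refine ⟨H, hH.1, hH.2.1, ?_⟩
  by_contra h1
  have h2 := hH.2.2
  obtain ⟨i, hi, hi'⟩ : ∃ i ∈ G, i ∉ H := by
    by_contra h3; push Not at h3
    have := rk_mono (F := G) (G := H) h3
    omega
  have h3 := rk_sup_sp hi'
  have := hmax (j := H ⊔ sp K i) ⟨hH.1.trans le_sup_left, sup_le hH.2.1 (sp_le.2 hi), by omega⟩ (by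
    show rk H ≤ rk (H ⊔ sp K i); omega)
  have h4 : rk (H ⊔ sp K i) ≤ rk H := this
  omega

theorem harm_sign (E : Submodule K V) (j d : ℕ) : ∃ κ : ℝ, 0 < κ ∧
    ∀ h : Submodule K V → ℝ, Harm E j h → ∀ E' G : Submodule K V, E ≤ E' → E' ≤ G →
      rk G = rk E + j → rk E' + d = rk G → ff h E' G = (-1) ^ d * κ * h G := by
  induction d with
  | zero =>
    refine ⟨1, one_pos, fun h hh E' G hE hG hr hd => ?_⟩
    have : E' = G := eq_of_rk hG (by omega)
    subst this
    rw [ff, Finset.sum_eq_single E']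
    · simp
    · intro F _ hF
      by_cases h1 : F ⊓ E' = E'
      · rw [if_pos h1]
        refine hh.1 F fun h2 => hF ?_
        exact (eq_of_rk (inf_eq_right.1 h1) (by rw [h2.2, hr])).symm
      · rw [if_neg h1]
    · simp
  | succ d ih =>
    obtain ⟨κ, hκ, ih⟩ := ih
    by_cases hjd : d + 1 ≤ rk E + j
    swap
    · exact ⟨1, one_pos, fun h hh E' G hE hG hr hd => by omega⟩
    set q := (Fintype.card K : ℝ) with hq
    have hq1 : 1 < q := one_lt_q K
    set e := rk E + j - (d+1) with he
    have hp1 : q ^ e < q ^ (e + 1) := pow_lt_pow_right₀ hq1 (by omega)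
    have hp2 : q ^ (e + d) < q ^ (e + d + 1) := pow_lt_pow_right₀ hq1 (by omega)
    refine ⟨(q ^ (e + d + 1) - q ^ (e + d)) * κ / (q ^ (e + 1) - q ^ e), ?_, ?_⟩
    · exact div_pos (mul_pos (by linarith) hκ) (by linarith)
    intro h hh E' G hE hG hr hd
    obtain ⟨H, hEH, hHG⟩ := exists_hyper hG (by omega)
    have h1 : ∑ i : V, (if i ∈ G ∧ i ∉ H then ff h (E' ⊔ sp K i) G else 0) =
        (q ^ (e + 1) - q ^ e) * (ff h E' H - ff h E' G) := by
      have h2 : ∀ i : V, (if i ∈ G ∧ i ∉ H then ff h (E' ⊔ sp K i) G else 0) =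
          ∑ F, (if (i ∈ G ∧ i ∉ H) ∧ F ⊓ G = E' ⊔ sp K i then (1:ℝ) else 0) * h F := by
        intro i
        by_cases h3 : i ∈ G ∧ i ∉ H
        · rw [if_pos h3, ff]
          refine Finset.sum_congr rfl fun F _ => ?_
          by_cases h4 : F ⊓ G = E' ⊔ sp K i <;> simp [h3, h4]
        · simp only [h3, false_and, if_false, zero_mul, Finset.sum_const_zero]
      simp only [h2]
      rw [Finset.sum_comm, ff, ff, ← Finset.sum_sub_distrib, Finset.mul_sum]
      refine Finset.sum_congr rfl fun F _ => ?_
      rw [← Finset.sum_mul, count_key hEH hHG, ← hq, show rk E' = e by omega]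
      by_cases h4 : F ⊓ H = E' <;> by_cases h5 : F ⊓ G = E' <;> simp [h4, h5]
      ring
    have h2 : ∑ i : V, (if i ∈ G ∧ i ∉ H then ff h (E' ⊔ sp K i) G else 0) =
        (q ^ (e + d + 1) - q ^ (e + d)) * ((-1) ^ d * κ * h G) := by
      have h3 := sum_not_mem_card H G hHG.1
      rw [show rk G = e + d + 1 by omega, show rk H = e + d by have := hHG.2; omega] at h3
      rw [← h3, Finset.sum_mul]
      refine Finset.sum_congr rfl fun i _ => ?_
      by_cases h4 : i ∈ G ∧ i ∉ H
      · rw [if_pos h4, if_pos h4, one_mul]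
        refine ih h hh _ G (hE.trans le_sup_left) (sup_le hG (sp_le.2 h4.1)) hr ?_
        rw [rk_sup_sp (fun h => h4.2 (hEH h))]; omega
      · rw [if_neg h4, if_neg h4, zero_mul]
    have h3 : ff h E' H = 0 := harm_f hh (by have := hHG.2; omega) E' hE E' le_rfl
    rw [h2, h3] at h1
    have hne : q ^ (e + 1) - q ^ e ≠ 0 := by linarith
    field_simp
    rw [pow_succ (-1 : ℝ) d]
    linarith

theorem B_harm {E : Submodule K V} {j : ℕ} {h : Submodule K V → ℝ} (hh : Harm E j h)
    (c : V → ℝ) (G : Submodule K V) (β : ℝ)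
    (hβ : ∀ F : Submodule K V, rk F + rk E = rk E + j + rk G → bb c F = β) :
    Bm c E h (Pi.single G 1) = β * ff h E G := by
  conv_lhs => rw [eq_sum_single h]
  rw [map_sum, LinearMap.sum_apply, ff, Finset.mul_sum]
  refine Finset.sum_congr rfl fun F _ => ?_
  rw [map_smul, LinearMap.smul_apply, Bm_single, smul_eq_mul]
  by_cases h1 : F ⊓ G = E
  · by_cases h2 : F ∈ Hm E j
    · have h3 := rk_sup_inf F G
      rw [h1, h2.2] at h3
      simp only [h1, if_true]
      rw [hβ _ h3]; ring
    · simp [hh.1 F h2]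
  · simp [h1]

theorem harm_main {E : Submodule K V} {j : ℕ} {h : Submodule K V → ℝ} (hh : Harm E j h) :
    h ∈ Vp (c1 V) E j ∧ (h ≠ 0 → 0 < (-1) ^ j * Bm (c1 V) E h h) := by
  constructor
  · refine ⟨supOn_mono (Hm_sub E j) hh.1, fun v hv => ?_⟩
    have := lin_ext (f := Bm (c1 V) E h) (g := 0) (fun G hG => ?_) hv
    · simpa using this
    · obtain ⟨β, _, hβ⟩ := bb_c1 (K := K) (V := V) (j + rk G)
      rw [B_harm hh (c1 V) G β (fun F hF => hβ F (by omega)), harm_f hh hG.2 E le_rfl E le_rfl]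
      simp
  · intro hne
    obtain ⟨κ, hκ, hf⟩ := harm_sign E j j
    obtain ⟨β, hβ0, hβ⟩ := bb_c1 (K := K) (V := V) (j + (rk E + j))
    have h1 : Bm (c1 V) E h h = β * ((-1) ^ j * κ) * ∑ G, h G ^ 2 := by
      have h0 : Bm (c1 V) E h h = ∑ G, h G * Bm (c1 V) E h (Pi.single G 1) := by
        conv_lhs => rw [eq_sum_single h, map_sum, ← eq_sum_single h]
        refine Finset.sum_congr rfl fun G _ => ?_
        rw [map_smul, smul_eq_mul]
      rw [h0, Finset.mul_sum]
      refine Finset.sum_congr rfl fun G _ => ?_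
      by_cases hG : G ∈ Hm E j
      · rw [B_harm hh (c1 V) G β (fun F hF => hβ F (by rw [hG.2] at hF; omega)),
          hf h hh E G le_rfl hG.1 hG.2 hG.2.symm]
        ring
      · rw [hh.1 G hG]; ring
    rw [h1]
    obtain ⟨G, hG⟩ : ∃ G, h G ≠ 0 := by
      by_contra h2; push Not at h2; exact hne (funext h2)
    have h2 : 0 < ∑ G, h G ^ 2 :=
      Finset.sum_pos' (fun _ _ => sq_nonneg _) ⟨G, Finset.mem_univ _, by positivity⟩
    have h3 : ((-1:ℝ) ^ j) * (-1) ^ j = 1 := by rw [← mul_pow]; simp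
    calc (0:ℝ) < β * κ * ∑ G, h G ^ 2 := by positivity
      _ = (((-1:ℝ) ^ j) * (-1) ^ j) * (β * κ * ∑ G, h G ^ 2) := by rw [h3, one_mul]
      _ = _ := by ring

end harmonic

set_option linter.unusedSectionVars false
set_option linter.unusedSimpArgs false
set_option linter.deprecated false

section base
open Classical
variable {K V : Type} [Field K] [Fintype K] [AddCommGroup V] [Module K V] [Fintype V]

theorem y_mem_AF' {E : Submodule K V} (i : V) {j : ℕ} {u : Submodule K V → ℝ}
    (hu : u ∈ supOn (AF E j)) : y i u ∈ supOn (AF E (j+1)) := by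
  by_cases hi : i ∈ E
  · rw [y_of_mem hi (up_of_AF hu)]; exact Submodule.zero_mem _
  · exact supOn_mono (AF_sup hi j) (y_mem_AF hi hu)

theorem ee_mem_AF {E : Submodule K V} (c : V → ℝ) {j : ℕ} {u : Submodule K V → ℝ}
    (hu : u ∈ supOn (AF E j)) : ee K c u ∈ supOn (AF E (j+1)) := by
  rw [ee_apply]
  exact Submodule.sum_mem _ fun i _ => Submodule.smul_mem _ _ (y_mem_AF' i hu)

theorem ee_mem_Hm {E : Submodule K V} (c : V → ℝ) {j : ℕ} {u : Submodule K V → ℝ}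
    (hu : u ∈ supOn (Hm E j)) : ee K c u ∈ supOn (Hm E (j+1)) := by
  rw [ee_apply]
  refine Submodule.sum_mem _ fun i _ => Submodule.smul_mem _ _ ?_
  refine lin_mem (fun F hF => ?_) hu
  rw [y_single]
  split_ifs with h
  · exact Submodule.zero_mem _
  · refine single_mem_supOn (T := Hm E (j+1)) ⟨hF.1.trans le_sup_left, ?_⟩ _
    rw [rk_sup_sp h, hF.2]; rfl

theorem B_ee_selfadj (c c' : V → ℝ) {E : Submodule K V} {u v : Submodule K V → ℝ}
    (hu : u ∈ supOn (up E)) (hv : v ∈ supOn (up E)) :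
    Bm c E (ee K c' u) v = Bm c E u (ee K c' v) := by
  rw [ee_apply, ee_apply, map_sum, map_sum, LinearMap.sum_apply]
  refine Finset.sum_congr rfl fun i _ => ?_
  rw [map_smul, map_smul, LinearMap.smul_apply, B_y_selfadj c i hu hv]

theorem NN_Hm {E : Submodule K V} {j : ℕ} {u : Submodule K V → ℝ}
    (hu : u ∈ supOn (Hm E j)) : NN E u = (j:ℝ) • u := by
  funext F
  rw [NN_apply, Pi.smul_apply, smul_eq_mul]
  by_cases h : F ∈ Hm E j
  · rw [h.2]; push_cast; ring
  · rw [hu F h]; ring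

theorem NN_AF {E : Submodule K V} {j : ℕ} {u : Submodule K V → ℝ}
    (hu : u ∈ supOn (AF E (j+1))) : NN E u - (j:ℝ) • u ∈ supOn (AF E j) := by
  intro F hF
  simp only [Pi.sub_apply, NN_apply, Pi.smul_apply, smul_eq_mul]
  by_cases h : F ∈ AF E (j+1)
  · have : rk F = rk E + j := by
      by_contra h2; exact hF ⟨h.1, by have := h.2; omega⟩
    rw [this]; push_cast; ring
  · rw [hu F h]; ring

/-- Euclidean decomposition -/
theorem eucl_decomp {ι : Type} [Fintype ι] (W : Submodule ℝ (ι → ℝ)) (x : ι → ℝ) :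
    ∃ z ∈ W, ∃ h : ι → ℝ, x = h + z ∧ ∀ w ∈ W, ∑ F, h F * w F = 0 := by
  let φ := WithLp.linearEquiv 2 ℝ (ι → ℝ)
  let W' : Submodule ℝ (EuclideanSpace ℝ ι) := W.comap (φ : EuclideanSpace ℝ ι →ₗ[ℝ] (ι → ℝ))
  obtain ⟨z, hz, h, hh, e⟩ := W'.exists_add_mem_mem_orthogonal (φ.symm x)
  refine ⟨φ z, hz, φ h, ?_, fun w hw => ?_⟩
  · have := congrArg φ e
    rw [map_add, LinearEquiv.apply_symm_apply] at this
    rw [this, add_comm]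
  · have h1 : φ.symm w ∈ W' := by
      show φ (φ.symm w) ∈ W
      rw [LinearEquiv.apply_symm_apply]; exact hw
    have := hh _ h1
    rw [PiLp.inner_apply] at this
    rw [← this]
    refine Finset.sum_congr rfl fun F _ => ?_
    simp [φ, mul_comm]

theorem hat_mem_Vp {c : V → ℝ} {E : Submodule K V} {j : ℕ} (hN : NDon (Bm c E) (AF E j))
    {x : Submodule K V → ℝ} (hx : x ∈ supOn (AF E (j+1))) : x - pr (Bm c E) (AF E j) x ∈ Vp c E j :=
  ⟨Submodule.sub_mem _ hx (supOn_mono (AF_mono E (by omega)) (pr_mem hN x)),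
    fun _ hv => hat_orth hN x hv⟩

theorem Vp_inter {c : V → ℝ} {E : Submodule K V} {j : ℕ} (hN : NDon (Bm c E) (AF E j))
    {x : Submodule K V → ℝ} (hx : x ∈ Vp c E j) (h : x ∈ supOn (AF E j)) : x = 0 :=
  hN x h hx.2

theorem theta_formula {c : V → ℝ} {E : Submodule K V} (s : ℕ) (hN : NDon (Bm c E) (AF E (s+1)))
    {a : Submodule K V → ℝ} (ha : a ∈ Vp c E s) :
    ∃ ν ∈ supOn (AF E s), (∀ v, ∀ k, k < s → v ∈ supOn (AF E k) → Bm c E ν v = 0) ∧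
      Bm c E (ee K c a - pr (Bm c E) (AF E (s+1)) (ee K c a))
        (ee K c a - pr (Bm c E) (AF E (s+1)) (ee K c a)) =
      Bm c E ν ν - ((Module.finrank K V : ℝ) - rk E - 2 * s) * Bm c E a a := by
  set n := (Module.finrank K V : ℝ) - rk E with hn
  set δ := n - 2 * s with hδ
  set ν := NN E a - (s:ℝ) • a with hν
  have hνm : ν ∈ supOn (AF E s) := NN_AF ha.1
  have haU := up_of_AF ha.1
  have hNa : NN E a = (s:ℝ) • a + ν := by rw [hν]; abel
  have hea : ∀ v ∈ supOn (AF E (s+1)), Bm c E (ee K c a) v = Bm c E (δ • a - ν) v := by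
    intro v hv
    rw [euler c haU (up_of_AF hv), hNa]
    have h1 : NN E v = (s:ℝ) • v + (NN E v - (s:ℝ) • v) := by abel
    have h2 := ha.2 _ (NN_AF hv)
    rw [h1, map_add (Bm c E a), h2]
    simp only [map_add, map_sub, map_smul, LinearMap.add_apply, LinearMap.sub_apply,
      LinearMap.smul_apply, smul_eq_mul]
    rw [hδ]; ring
  have hmem : δ • a - ν ∈ supOn (AF E (s+1)) :=
    Submodule.sub_mem _ (Submodule.smul_mem _ _ ha.1) (supOn_mono (AF_mono E (by omega)) hνm)
  have hpr : pr (Bm c E) (AF E (s+1)) (ee K c a) = δ • a - ν := pr_unique hN hmem hea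
  have haν : Bm c E a ν = 0 := ha.2 _ hνm
  have hνa : Bm c E ν a = 0 := by rw [Bm_symm, haν]
  refine ⟨ν, hνm, fun v k hk hv => ?_, ?_⟩
  · have hv' : v ∈ supOn (AF E (s+1)) := supOn_mono (AF_mono E (by omega)) hv
    have h1 := hea v hv'
    rw [B_ee_selfadj c c haU (up_of_AF hv),
      ha.2 _ (supOn_mono (AF_mono E (by omega)) (ee_mem_AF c hv)), map_sub, LinearMap.sub_apply,
      map_smul, LinearMap.smul_apply, ha.2 v (supOn_mono (AF_mono E (by omega)) hv)] at h1
    simp at h1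
    exact h1
  · set θ := ee K c a - pr (Bm c E) (AF E (s+1)) (ee K c a) with hθ
    have hθo : ∀ v ∈ supOn (AF E (s+1)), Bm c E θ v = 0 := fun v hv => hat_orth hN _ hv
    have hθU : θ ∈ supOn (up E) := Submodule.sub_mem _ (up_of_AF (ee_mem_AF c ha.1))
      (up_of_AF (pr_mem hN _))
    have h1 : Bm c E θ θ = Bm c E θ (ee K c a) := by
      conv_lhs => rw [hθ, map_sub (Bm c E _), ← hθ, hθo _ (pr_mem hN _), sub_zero]
    have h2 : Bm c E θ (ee K c a) = - Bm c E a (NN E θ) := by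
      rw [Bm_symm, euler c haU hθU, Bm_symm c E a θ, hθo a ha.1, Bm_symm c E _ θ,
        hθo _ (NN_mem E ha.1)]
      ring
    have h3 : NN E θ = ee K c (NN E a) + ee K c a - δ • NN E a + NN E ν := by
      rw [hθ, hpr, map_sub, map_sub, NN_ee, map_smul]; abel
    have h4 : Bm c E a (NN E ν) = 0 := ha.2 _ (NN_mem E hνm)
    have h5 : Bm c E a (NN E a) = s * Bm c E a a := by
      rw [hNa, map_add, haν, map_smul, smul_eq_mul, add_zero]
    have h6 : Bm c E a (ee K c a) = δ * Bm c E a a := by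
      rw [Bm_symm, hea a ha.1, map_sub, LinearMap.sub_apply, hνa, map_smul, LinearMap.smul_apply,
        smul_eq_mul, sub_zero]
    have h7 : Bm c E a (ee K c (NN E a)) = δ * s * Bm c E a a - Bm c E ν ν := by
      rw [← B_ee_selfadj c c haU (NN_mem E haU), hea _ (NN_mem E ha.1), hNa]
      simp only [map_add, map_sub, map_smul, LinearMap.add_apply, LinearMap.sub_apply,
        LinearMap.smul_apply, smul_eq_mul, haν, hνa]
      ring
    rw [h1, h2, h3, map_add, map_sub, map_add, h4, h7, h6, map_smul, h5, smul_eq_mul]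
    ring

theorem neg_one_pow_mul_self (j : ℕ) : ((-1:ℝ) ^ j) * (-1) ^ j = 1 := by rw [← mul_pow]; simp

theorem base_low {E : Submodule K V} (hN : ∀ j, NDon (Bm (c1 V) E) (AF E j)) (j : ℕ) :
    2 * j + rk E ≤ Module.finrank K V → ∀ u ∈ Vp (c1 V) E j, u ≠ 0 →
      0 < (-1) ^ j * Bm (c1 V) E u u := by
  induction j using Nat.strong_induction_on with
  | _ j ih =>
  intro hj u hu hne
  have IH : ∀ k < j, ∀ u ∈ Vp (c1 V) E k, 0 ≤ (-1) ^ k * Bm (c1 V) E u u := fun k hk u hu => by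
    by_cases h0 : u = 0
    · simp [h0]
    · exact (ih k hk (by omega) u hu h0).le
  set x := restr (Hm E j) u with hx
  have hux : u - x ∈ supOn (AF E j) := by
    rw [hx, Hm_eq]; exact sub_restr_mem hu.1
  have hxm : x ∈ supOn (Hm E j) := restr_mem _ _
  cases j with
  | zero =>
    have hh : Harm E 0 x := ⟨hxm, fun L hL h => by have := rk_mono hL; omega⟩
    have : u = x := by
      funext F
      have := hux F (fun h => by have := rk_mono h.1; have := h.2; omega)
      simpa [sub_eq_zero] using this
    rw [this] at hne ⊢
    exact (harm_main hh).2 hne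
  | succ s =>
    obtain ⟨z, hz, h, hxh, ho⟩ := eucl_decomp ((supOn (Hm E s)).map (ee K (c1 V))) x
    obtain ⟨w, hw, rfl⟩ := hz
    have hewm : ee K (c1 V) w ∈ supOn (Hm E (s+1)) := ee_mem_Hm _ hw
    have hhm : h ∈ supOn (Hm E (s+1)) := by
      have : h = x - ee K (c1 V) w := by rw [hxh]; abel
      rw [this]; exact Submodule.sub_mem _ hxm hewm
    have hh : Harm E (s+1) h := by
      refine ⟨hhm, fun L hL hr => ?_⟩
      have h1 := ho _ (Submodule.mem_map_of_mem (f := ee K (c1 V))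
        (single_mem_supOn (T := Hm E s) (F := L) ⟨hL, by omega⟩ 1))
      refine Eq.trans ?_ h1
      rw [ee_apply]
      simp only [Finset.sum_apply, Finset.mul_sum]
      rw [Finset.sum_comm]
      refine Finset.sum_congr rfl fun i _ => ?_
      rw [y_single]
      by_cases hi : i ∈ L
      · simp [hi]
      · simp [hi, Pi.single_apply]
    obtain ⟨hhV, hhpos⟩ := harm_main hh
    set a := w - pr (Bm (c1 V) E) (AF E s) w with ha
    have haV : a ∈ Vp (c1 V) E s := hat_mem_Vp (hN s) (supOn_mono (Hm_sub E s) hw)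
    set θ := ee K (c1 V) a - pr (Bm (c1 V) E) (AF E (s+1)) (ee K (c1 V) a) with hθ
    have hθV : θ ∈ Vp (c1 V) E (s+1) := hat_mem_Vp (hN (s+1)) (ee_mem_AF _ haV.1)
    have hea : ee K (c1 V) w - ee K (c1 V) a ∈ supOn (AF E (s+1)) := by
      rw [← map_sub]; apply ee_mem_AF
      have : w - a = pr (Bm (c1 V) E) (AF E s) w := by rw [ha]; abel
      rw [this]; exact pr_mem (hN s) _
    have hu_eq : u = h + θ := by
      rw [← sub_eq_zero]
      refine Vp_inter (hN (s+1)) (Submodule.sub_mem _ hu (Submodule.add_mem _ hhV hθV)) ?_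
      have : u - (h + θ) = (u - x) + (ee K (c1 V) w - ee K (c1 V) a) +
          pr (Bm (c1 V) E) (AF E (s+1)) (ee K (c1 V) a) := by rw [hθ, hxh]; abel
      rw [this]
      exact Submodule.add_mem _ (Submodule.add_mem _ hux hea) (pr_mem (hN (s+1)) _)
    have hwA : w ∈ supOn (AF E (s+1)) := supOn_mono (Hm_sub E s) hw
    have hhw : Bm (c1 V) E h (ee K (c1 V) w) = 0 := by
      rw [Bm_symm, euler _ (up_of_AF hwA) (up_of_AF hhV.1), NN_Hm hhm, map_smul,
        Bm_symm _ _ w h, hhV.2 w hwA, Bm_symm _ _ _ h, hhV.2 _ (NN_mem E hwA)]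
      simp
    have hhθ : Bm (c1 V) E h θ = 0 := by
      have h1 : θ = ee K (c1 V) w - (ee K (c1 V) w - ee K (c1 V) a)
        - pr (Bm (c1 V) E) (AF E (s+1)) (ee K (c1 V) a) := by rw [hθ]; abel
      rw [h1, map_sub, map_sub, hhw, hhV.2 _ hea, hhV.2 _ (pr_mem (hN (s+1)) _)]; ring
    obtain ⟨ν, hν, hνo, hform⟩ := theta_formula s (hN (s+1)) haV
    rw [← hθ] at hform
    have huu : Bm (c1 V) E u u = Bm (c1 V) E h h + Bm (c1 V) E θ θ := by
      rw [hu_eq]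
      simp only [map_add, LinearMap.add_apply]
      rw [Bm_symm _ _ θ h, hhθ]; ring
    have hνs : 0 ≤ (-1) ^ (s+1) * Bm (c1 V) E ν ν := by
      cases s with
      | zero =>
        have : ν = 0 := by
          funext F
          exact hν F (fun h => by have := rk_mono h.1; have := h.2; omega)
        simp [this]
      | succ r =>
        have := IH r (by omega) ν ⟨hν, fun v hv => hνo v r (by omega) hv⟩
        rw [pow_succ, pow_succ]; linarith
    have hδ : 0 < (Module.finrank K V : ℝ) - rk E - 2 * s := by
      have : ((2 * (s+1) + rk E : ℕ) : ℝ) ≤ (Module.finrank K V : ℝ) := by exact_mod_cast hj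
      push_cast at this; linarith
    have has := IH s (by omega) a haV
    have hθs : 0 ≤ (-1) ^ (s+1) * Bm (c1 V) E θ θ := by
      rw [hform, mul_sub]
      have := mul_nonneg hδ.le has
      rw [pow_succ] at hνs ⊢; linarith
    rw [huu, mul_add]
    by_cases hh0 : h = 0
    · have ha0 : a ≠ 0 := by
        intro h0
        apply hne
        rw [hu_eq, hh0, hθ, h0]; simp
      have h1 := mul_pos hδ (ih s (by omega) (by omega) a haV ha0)
      rw [hh0, hform]
      simp only [map_zero, mul_zero, zero_add, mul_sub]
      rw [pow_succ] at hνs ⊢; linarith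
    · have := hhpos hh0
      linarith

/-- product of `1 - c_i y_i` over a list -/
noncomputable def Xop (c : V → ℝ) : List V → ((Submodule K V → ℝ) →ₗ[ℝ] (Submodule K V → ℝ))
  | [] => LinearMap.id
  | i :: l => (Xop c l) ∘ₗ (LinearMap.id - c i • y i)

theorem Xop_cons (c : V → ℝ) (i : V) (l : List V) (u : Submodule K V → ℝ) :
    Xop c (i :: l) u = Xop c l (u - c i • y i u) := rfl

theorem Xop_y (c : V → ℝ) (l : List V) (i : V) (u : Submodule K V → ℝ) :
    Xop c l (y i u) = y i (Xop c l u) := by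
  induction l generalizing u with
  | nil => rfl
  | cons k l ih =>
    rw [Xop_cons, Xop_cons, y_comm, ← map_smul, ← map_sub, ih]

theorem Xop_inv (c : V → ℝ) (l : List V) (u : Submodule K V → ℝ) :
    Xop c l (Xop (-c) l u) = u := by
  induction l generalizing u with
  | nil => rfl
  | cons k l ih =>
    rw [Xop_cons, Xop_cons, map_sub (Xop c l), map_smul, Xop_y, ih]
    simp only [map_sub, map_smul, y_sq, Pi.neg_apply]
    module

theorem Xop_mem (c : V → ℝ) (l : List V) {E : Submodule K V} {u : Submodule K V → ℝ}
    (hu : u ∈ supOn (up E)) : Xop c l u ∈ supOn (up E) := by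
  induction l generalizing u with
  | nil => exact hu
  | cons k l ih =>
    rw [Xop_cons]
    exact ih (Submodule.sub_mem _ hu (Submodule.smul_mem _ _ (y_mem_up' k hu)))

/-- weights with the entries of the list set to zero -/
noncomputable def zeroed (c : V → ℝ) (l : List V) : V → ℝ := fun k => if k ∈ l then 0 else c k

theorem Xop_B (c : V → ℝ) (l : List V) (hl : l.Nodup) {E : Submodule K V}
    {u v : Submodule K V → ℝ} (hu : u ∈ supOn (up E)) (hv : v ∈ supOn (up E)) :
    Bm c E (Xop c l u) v = Bm (zeroed c l) E u v := by
  induction l generalizing u with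
  | nil =>
    have : zeroed c [] = c := by funext k; simp [zeroed]
    rw [this]; rfl
  | cons i l ih =>
    have hi := (List.nodup_cons.1 hl).1
    rw [Xop_cons, ih (List.nodup_cons.1 hl).2
      (Submodule.sub_mem _ hu (Submodule.smul_mem _ _ (y_mem_up' i hu)))]
    have h1 : zeroed c (i :: l) = Function.update (zeroed c l) i 0 := by
      funext k
      by_cases hk : k = i
      · subst hk; simp [zeroed]
      · simp [zeroed, hk]
    rw [h1, B_update _ _ _ hu hv]
    simp only [map_sub, map_smul, LinearMap.sub_apply, LinearMap.smul_apply, smul_eq_mul]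
    simp [zeroed, hi]
    ring

noncomputable def sg : (Submodule K V → ℝ) →ₗ[ℝ] (Submodule K V → ℝ) :=
  LinearMap.pi fun F => ((-1:ℝ) ^ rk F) • LinearMap.proj F

theorem sg_apply (u : Submodule K V → ℝ) (F : Submodule K V) : sg u F = (-1) ^ rk F * u F := rfl

theorem sg_sg (u : Submodule K V → ℝ) : sg (sg u) = u := by
  funext F
  rw [sg_apply, sg_apply, ← mul_assoc, neg_one_pow_mul_self, one_mul]

theorem sg_mem {T : Set (Submodule K V)} {u : Submodule K V → ℝ} (hu : u ∈ supOn T) :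
    sg u ∈ supOn T := fun F hF => by rw [sg_apply, hu F hF, mul_zero]

theorem sg_single (F : Submodule K V) :
    sg (Pi.single F (1:ℝ)) = ((-1:ℝ) ^ rk F) • (Pi.single F (1:ℝ) : Submodule K V → ℝ) := by
  funext G
  rw [sg_apply]
  by_cases h : G = F
  · subst h; simp
  · simp [h]

theorem sg_y (i : V) (u : Submodule K V → ℝ) : sg (y i u) = - y i (sg u) := by
  refine lin_ext (f := sg ∘ₗ y i) (g := -(y i ∘ₗ sg)) (fun F _ => ?_) (mem_univ_supOn u)
  simp only [LinearMap.comp_apply, LinearMap.neg_apply, sg_single, map_smul, y_single]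
  split_ifs with h
  · simp
  · rw [sg_single, rk_sup_sp h, pow_succ]; simp

theorem sg_Xop (c : V → ℝ) (l : List V) (u : Submodule K V → ℝ) :
    sg (Xop (-c) l u) = Xop c l (sg u) := by
  induction l generalizing u with
  | nil => rfl
  | cons i l ih =>
    rw [Xop_cons, Xop_cons, ih, map_sub, map_smul, sg_y]
    simp

theorem B0_single (E F G : Submodule K V) :
    Bm (0 : V → ℝ) E (Pi.single F 1) (Pi.single G 1) = if F ⊓ G = E ∧ F ⊔ G = ⊤ then 1 else 0 := by
  rw [Bm_single, bb_zero]
  by_cases h1 : F ⊓ G = E <;> by_cases h2 : F ⊔ G = ⊤ <;> simp [h1, h2]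

theorem B0_sg (E : Submodule K V) (u v : Submodule K V → ℝ) :
    Bm (0 : V → ℝ) E (sg u) (sg v) = (-1) ^ (Module.finrank K V + rk E) * Bm (0 : V → ℝ) E u v := by
  have := bil_ext (f := (Bm (0 : V → ℝ) E ∘ₗ sg).compl₂ sg)
    (g := ((-1:ℝ) ^ (Module.finrank K V + rk E)) • Bm (0 : V → ℝ) E) (fun F _ G _ => ?_)
    (mem_univ_supOn u) (mem_univ_supOn v)
  · simpa using this
  · simp only [LinearMap.comp_apply, LinearMap.compl₂_apply, LinearMap.smul_apply, sg_single,
      map_smul, B0_single, smul_eq_mul]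
    by_cases h : F ⊓ G = E ∧ F ⊔ G = ⊤
    · rw [if_pos h]
      have h1 := rk_sup_inf F G
      rw [h.1, h.2, rk_top] at h1
      rw [h1, pow_add]; ring
    · rw [if_neg h]; ring

theorem dual {c : V → ℝ} {E : Submodule K V} (hN : NDon (Bm c E) (up E)) {j : ℕ}
    (hj : j + rk E ≤ Module.finrank K V) {u : Submodule K V → ℝ} (hu : u ∈ Vp c E j) :
    ∃ u' ∈ Vp c E (Module.finrank K V - rk E - j), (u ≠ 0 → u' ≠ 0) ∧
      Bm c E u' u' = (-1) ^ (Module.finrank K V + rk E) * Bm c E u u := by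
  set l := (Finset.univ : Finset V).toList with hl
  have hnd : l.Nodup := Finset.nodup_toList _
  have hz : zeroed c l = 0 := by funext k; simp [zeroed, hl]
  have huU := up_of_AF hu.1
  have hX : ∀ {u v : Submodule K V → ℝ}, u ∈ supOn (up E) → v ∈ supOn (up E) →
      Bm c E (Xop c l u) v = Bm 0 E u v := fun hu hv => by rw [Xop_B c l hnd hu hv, hz]
  have hX' : ∀ {u v : Submodule K V → ℝ}, u ∈ supOn (up E) → v ∈ supOn (up E) →
      Bm c E u (Xop c l v) = Bm 0 E u v := fun hu hv => by rw [Bm_symm, hX hv hu, Bm_symm]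
  set m := Module.finrank K V with hm
  set u' := Xop c l (sg u) with hu'
  have hu'U : u' ∈ supOn (up E) := Xop_mem c l (sg_mem huU)
  have hu's : u' = sg (Xop (-c) l u) := (sg_Xop c l u).symm
  have hXm : Xop (-c) l u ∈ supOn (up E) := Xop_mem (-c) l huU
  refine ⟨u', ⟨?_, ?_⟩, ?_, ?_⟩
  · -- support
    have h0 : ∀ G : Submodule K V, E ≤ G → rk G < rk E + j → Bm 0 E u' (Pi.single G 1) = 0 := by
      intro G hG hr
      have hGm := single_mem_supOn (T := up E) (F := G) hG 1
      rw [hu's, ← sg_sg (Pi.single G (1:ℝ)), B0_sg, sg_single, map_smul, ← hX hXm hGm, Xop_inv,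
        hu.2 _ (single_mem_supOn (T := AF E j) (F := G) ⟨hG, hr⟩ 1)]
      simp
    set T : Set (Submodule K V) := {F | m < rk F + j} with hT
    set w := restr T u' with hw
    have hwU : w ∈ supOn (up E) := fun F hF => by
      simp only [hw, restr]; split_ifs
      · exact hu'U F hF
      · rfl
    have h1 : ∀ G : Submodule K V, E ≤ G → Bm 0 E w (Pi.single G 1) = 0 := by
      intro G hG
      by_cases hr : rk G < rk E + j
      · rw [← h0 G hG hr]
        conv_lhs => rw [eq_sum_single w]
        conv_rhs => rw [eq_sum_single u']
        rw [map_sum, map_sum, LinearMap.sum_apply, LinearMap.sum_apply]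
        refine Finset.sum_congr rfl fun F _ => ?_
        rw [map_smul, map_smul, LinearMap.smul_apply, LinearMap.smul_apply, B0_single]
        by_cases h : F ⊓ G = E ∧ F ⊔ G = ⊤
        · have h1 := rk_sup_inf F G
          rw [h.1, h.2, rk_top] at h1
          have : F ∈ T := by show m < rk F + j; omega
          simp [hw, restr, this]
        · simp [h]
      · conv_lhs => rw [eq_sum_single w]
        rw [map_sum, LinearMap.sum_apply]
        refine Finset.sum_eq_zero fun F _ => ?_
        rw [map_smul, LinearMap.smul_apply, B0_single]
        by_cases h : F ⊓ G = E ∧ F ⊔ G = ⊤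
        · have h1 := rk_sup_inf F G
          rw [h.1, h.2, rk_top] at h1
          have : F ∉ T := by
            intro h2
            have h3 : m < rk F + j := h2
            omega
          simp [hw, restr, this]
        · simp [h]
    have h2 : Xop c l w = 0 := by
      refine hN _ (Xop_mem c l hwU) fun v hv => ?_
      rw [hX hwU hv]
      have := lin_ext (f := Bm 0 E w) (g := 0) (T := up E) (fun G hG => by simpa using h1 G hG) hv
      simpa using this
    have h3 : w = 0 := by
      have h4 := Xop_inv (-c) l w
      rw [neg_neg, h2, map_zero] at h4
      exact h4.symm
    intro F hF
    by_cases hEF : E ≤ F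
    · have hFT : F ∈ T := by
        by_contra h5
        have h6 : ¬ (m < rk F + j) := h5
        exact hF ⟨hEF, by omega⟩
      have := congrFun h3 F
      simpa [hw, restr, hFT] using this
    · exact hu'U F hEF
  · intro v hv
    rw [hX (sg_mem huU) (up_of_AF hv)]
    have := bil_ext (f := Bm (0 : V → ℝ) E) (g := 0) (fun F hF G hG => ?_) (sg_mem hu.1) hv
    · simpa using this
    · rw [B0_single, if_neg]
      · rfl
      · rintro ⟨h1, h2⟩
        have h3 := rk_sup_inf F G
        rw [h1, h2, rk_top] at h3
        have := hF.2; have := hG.2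
        omega
  · intro hne h0
    apply hne
    have h1 := Xop_inv (-c) l (sg u)
    rw [neg_neg, ← hu', h0, map_zero] at h1
    rw [← sg_sg u, ← h1, map_zero]
  · rw [hu', hX (sg_mem huU) hu'U, hu's, B0_sg, ← hX' huU hXm, Xop_inv]

theorem Vp_big {c : V → ℝ} {E : Submodule K V} (hN : ∀ j, NDon (Bm c E) (AF E j)) {j : ℕ}
    (hj : Module.finrank K V < j + rk E) {u : Submodule K V → ℝ} (hu : u ∈ Vp c E j) : u = 0 := by
  refine Vp_inter (hN j) hu ?_
  have := hu.1
  rw [AF_big E (by omega)] at this ⊢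
  exact this

theorem base_HR {E : Submodule K V} (hN : ∀ j, NDon (Bm (c1 V) E) (AF E j)) : HR (c1 V) E := by
  intro j u hu hne
  by_cases h1 : Module.finrank K V < j + rk E
  · exact absurd (Vp_big hN h1 hu) hne
  by_cases h2 : 2 * j + rk E ≤ Module.finrank K V
  · exact base_low hN j h2 u hu hne
  have hNup : NDon (Bm (c1 V) E) (up E) := by
    have := hN (Module.finrank K V + 1)
    rwa [AF_big E (by omega)] at this
  obtain ⟨u', hu', hne', he⟩ := dual hNup (by omega) hu
  have h3 := base_low hN _ (by omega) u' hu' (hne' hne)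
  rw [he, ← mul_assoc, ← pow_add] at h3
  have h4 : (-1:ℝ) ^ (Module.finrank K V - rk E - j + (Module.finrank K V + rk E)) = (-1) ^ j := by
    rw [show Module.finrank K V - rk E - j + (Module.finrank K V + rk E) =
      j + 2 * (Module.finrank K V - j) by omega, pow_add, pow_mul]
    simp
  rwa [h4] at h3

theorem HR_all (E : Submodule K V) : ∀ c : V → ℝ, (∀ i, 0 < c i) → HR c E := by
  induction E using corank_ind with
  | h E ih =>
  have hN : ∀ c : V → ℝ, (∀ i, 0 < c i) → ∀ j, NDon (Bm c E) (AF E j) := fun c hc j =>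
    nd_of_HR hc (fun i hi => ih i hi c hc) j
  have h1 : HR (c1 V) E := base_HR (hN _ (fun _ => one_pos))
  intro c hc j
  let path : unitInterval → V → ℝ := fun s i => (1 - (s:ℝ)) + s * c i
  have hpos : ∀ s i, 0 < path s i := by
    intro s i
    have h0 := s.2.1
    have h1 := s.2.2
    rcases eq_or_lt_of_le h0 with h2 | h2
    · simp [path, ← h2]
    · have := mul_pos h2 (hc i)
      simp only [path]; linarith
  have hε := neg_one_pow_mul_self j
  have hε0 : ((-1:ℝ) ^ j) ≠ 0 := by positivity
  have hND : ∀ s k, NDon (((-1:ℝ) ^ j) • Bm (path s) E) (AF E k) := fun s k u hu ho =>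
    hN (path s) (hpos s) k u hu fun v hv => by
      have := ho v hv
      simp only [LinearMap.smul_apply, smul_eq_mul, mul_eq_zero] at this
      exact this.resolve_left hε0
  have hd := deform (B := fun s => ((-1:ℝ) ^ j) • Bm (path s) E) (T1 := AF E j) (T2 := AF E (j+1))
    (fun s x y => by simp [Bm_symm _ _ x y])
    (fun F G => by
      simp only [LinearMap.smul_apply]
      have hpc : Continuous path := continuous_pi fun i => by
        simp only [path]; fun_prop
      exact ((Bm_continuous E F G).comp hpc).const_smul ((-1:ℝ) ^ j))
    (AF_mono E (by omega)) (fun s => hND s j) (fun s => hND s (j+1))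
    (by
      intro u hu ho hne
      have hp0 : path 0 = c1 V := by funext i; simp [path]
      rw [hp0] at ho ⊢
      simp only [LinearMap.smul_apply, smul_eq_mul]
      refine h1 j u ⟨hu, fun v hv => ?_⟩ hne
      have := ho v hv
      simp only [LinearMap.smul_apply, smul_eq_mul, mul_eq_zero] at this
      exact this.resolve_left hε0)
  intro u hu hne
  have hp1 : path 1 = c := by funext i; simp [path]
  have := hd u hu.1 (fun v hv => by rw [hp1]; simp [hu.2 v hv]) hne
  rw [hp1] at this
  simpa using this

theorem ND_all {c : V → ℝ} (hc : ∀ i, 0 < c i) (E : Submodule K V) (j : ℕ) :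
    NDon (Bm c E) (AF E j) := nd_of_HR hc (fun i _ => HR_all _ c hc) j

end base

set_option linter.unusedSectionVars false
set_option linter.unusedSimpArgs false
set_option linter.deprecated false

section tone
open Classical
variable {K V : Type} [Field K] [Fintype K] [AddCommGroup V] [Module K V] [Fintype V]

/-- orthogonal projection to `Vp c E j` -/
noncomputable def PP (c : V → ℝ) (E : Submodule K V) (j : ℕ) :
    (Submodule K V → ℝ) →ₗ[ℝ] (Submodule K V → ℝ) :=
  pr (Bm c E) (AF E (j+1)) - pr (Bm c E) (AF E j)

theorem PP_apply (c : V → ℝ) (E : Submodule K V) (j : ℕ) (u : Submodule K V → ℝ) :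
    PP c E j u = pr (Bm c E) (AF E (j+1)) u - pr (Bm c E) (AF E j) u := rfl

theorem PP_mem {c : V → ℝ} (hc : ∀ i, 0 < c i) (E : Submodule K V) (j : ℕ)
    (u : Submodule K V → ℝ) : PP c E j u ∈ Vp c E j := by
  refine ⟨?_, fun v hv => ?_⟩
  · exact Submodule.sub_mem _ (pr_mem (ND_all hc E (j+1)) u)
      (supOn_mono (AF_mono E (by omega)) (pr_mem (ND_all hc E j) u))
  · rw [PP_apply, map_sub, LinearMap.sub_apply, pr_orth (ND_all hc E j) u hv,
      pr_orth (ND_all hc E (j+1)) u (supOn_mono (AF_mono E (by omega)) hv), sub_self]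

theorem B_PP {c : V → ℝ} (hc : ∀ i, 0 < c i) {E : Submodule K V} {j : ℕ}
    (u : Submodule K V → ℝ) {v : Submodule K V → ℝ} (hv : v ∈ Vp c E j) :
    Bm c E (PP c E j u) v = Bm c E u v := by
  rw [PP_apply, map_sub, LinearMap.sub_apply, pr_orth (ND_all hc E (j+1)) u hv.1,
    Bm_symm _ _ (pr _ _ u) v, hv.2 _ (pr_mem (ND_all hc E j) u), sub_zero]

theorem PP_self {c : V → ℝ} (hc : ∀ i, 0 < c i) {E : Submodule K V} {j : ℕ}
    {v : Submodule K V → ℝ} (hv : v ∈ Vp c E j) : PP c E j v = v := by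
  rw [PP_apply, pr_of_mem (ND_all hc E (j+1)) hv.1,
    pr_unique (ND_all hc E j) (Submodule.zero_mem _) (fun w hw => by rw [hv.2 w hw]; simp), sub_zero]

theorem Vp_orth {c : V → ℝ} {E : Submodule K V} {j k : ℕ} (h : j ≠ k)
    {u v : Submodule K V → ℝ} (hu : u ∈ Vp c E j) (hv : v ∈ Vp c E k) : Bm c E u v = 0 := by
  rcases lt_or_gt_of_ne h with h | h
  · rw [Bm_symm]; exact hv.2 u (supOn_mono (AF_mono E (by omega)) hu.1)
  · exact hu.2 v (supOn_mono (AF_mono E (by omega)) hv.1)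

theorem pr_zero {c : V → ℝ} (hc : ∀ i, 0 < c i) (E : Submodule K V)
    (u : Submodule K V → ℝ) : pr (Bm c E) (AF E 0) u = 0 := by
  funext F
  exact pr_mem (ND_all hc E 0) u F (fun h => by have := rk_mono h.1; have := h.2; omega)

theorem sum_PP {c : V → ℝ} (hc : ∀ i, 0 < c i) (E : Submodule K V) (k : ℕ)
    (u : Submodule K V → ℝ) : ∑ j ∈ Finset.range k, PP c E j u = pr (Bm c E) (AF E k) u := by
  simp only [PP_apply]
  rw [Finset.sum_range_sub (fun j => pr (Bm c E) (AF E j) u), pr_zero hc, sub_zero]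

theorem sum_PP_eq {c : V → ℝ} (hc : ∀ i, 0 < c i) {E : Submodule K V}
    {u : Submodule K V → ℝ} (hu : u ∈ supOn (up E)) :
    ∑ j ∈ Finset.range (Module.finrank K V + 1), PP c E j u = u := by
  rw [sum_PP hc, pr_of_mem (ND_all hc E _)]
  rwa [AF_big E (by omega)]

/-- two-term decomposition -/
theorem two_term {c : V → ℝ} (hc : ∀ i, 0 < c i) {E : Submodule K V} {j : ℕ}
    {u : Submodule K V → ℝ} (hu : u ∈ supOn (AF E (j+2)))
    (ho : ∀ v ∈ supOn (AF E j), Bm c E u v = 0) : u = PP c E j u + PP c E (j+1) u := by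
  rw [PP_apply, PP_apply, pr_of_mem (ND_all hc E (j+1+1)) hu,
    pr_unique (ND_all hc E j) (Submodule.zero_mem _) (fun w hw => by rw [ho w hw]; simp)]
  abel

/-- squared length of the level `j` component -/
noncomputable def Qn (c : V → ℝ) (E : Submodule K V) (j : ℕ) (u : Submodule K V → ℝ) : ℝ :=
  (-1) ^ j * Bm c E (PP c E j u) (PP c E j u)

theorem Qn_nonneg {c : V → ℝ} (hc : ∀ i, 0 < c i) (E : Submodule K V) (j : ℕ)
    (u : Submodule K V → ℝ) : 0 ≤ Qn c E j u := (HR_all E c hc).nonneg (PP_mem hc E j u)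

theorem Qn_of_mem {c : V → ℝ} (hc : ∀ i, 0 < c i) {E : Submodule K V} {j : ℕ}
    {u : Submodule K V → ℝ} (hu : u ∈ Vp c E j) : Qn c E j u = (-1) ^ j * Bm c E u u := by
  rw [Qn, PP_self hc hu]

theorem Qn_PP {c : V → ℝ} (hc : ∀ i, 0 < c i) (E : Submodule K V) (j : ℕ)
    (u : Submodule K V → ℝ) : Qn c E j (PP c E j u) = Qn c E j u := by
  rw [Qn_of_mem hc (PP_mem hc E j u), Qn]

theorem Qn_ne {c : V → ℝ} (hc : ∀ i, 0 < c i) {E : Submodule K V} {j k : ℕ} (h : j ≠ k)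
    {u : Submodule K V → ℝ} (hu : u ∈ Vp c E j) : Qn c E k u = 0 := by
  rw [Qn, B_PP hc u (PP_mem hc E k u), Vp_orth h hu (PP_mem hc E k u), mul_zero]

/-- Cauchy-Schwarz at level `j` -/
theorem cs_lev {c : V → ℝ} (hc : ∀ i, 0 < c i) {E : Submodule K V} {j : ℕ}
    (u : Submodule K V → ℝ) {v : Submodule K V → ℝ} (hv : v ∈ Vp c E j) :
    (Bm c E u v) ^ 2 ≤ Qn c E j u * Qn c E j v := by
  rw [← B_PP hc u hv]
  have := psd_cs (Q := ((-1:ℝ) ^ j) • Bm c E) (fun x y => by simp [Bm_symm c E x y])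
    (S := Vp c E j) (fun x hx => by simpa using (HR_all E c hc).nonneg hx)
    (PP_mem hc E j u) hv
  simp only [LinearMap.smul_apply, smul_eq_mul] at this
  rw [Qn_of_mem hc hv, Qn]
  rwa [mul_pow, ← pow_mul, mul_comm j 2, pow_mul, neg_one_sq, one_pow, one_mul] at this

/-- The positive form. -/
noncomputable def Hf (c : V → ℝ) (E : Submodule K V) : BF (Submodule K V) :=
  ∑ j ∈ Finset.range (Module.finrank K V + 1),
    ((-1:ℝ) ^ j) • (Bm c E).compl₁₂ (PP c E j) (PP c E j)

noncomputable def Nn (c : V → ℝ) (E : Submodule K V) (u : Submodule K V → ℝ) : ℝ := Hf c E u u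

theorem Nn_eq (c : V → ℝ) (E : Submodule K V) (u : Submodule K V → ℝ) :
    Nn c E u = ∑ j ∈ Finset.range (Module.finrank K V + 1), Qn c E j u := by
  simp [Nn, Hf, Qn, LinearMap.sum_apply]

theorem Nn_nonneg {c : V → ℝ} (hc : ∀ i, 0 < c i) (E : Submodule K V)
    (u : Submodule K V → ℝ) : 0 ≤ Nn c E u := by
  rw [Nn_eq]; exact Finset.sum_nonneg fun j _ => Qn_nonneg hc E j u

theorem Nn_smul (c : V → ℝ) (E : Submodule K V) (a : ℝ) (u : Submodule K V → ℝ) :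
    Nn c E (a • u) = a ^ 2 * Nn c E u := by
  simp [Nn]; ring

theorem Nn_add {c : V → ℝ} (hc : ∀ i, 0 < c i) (E : Submodule K V)
    (u v : Submodule K V → ℝ) : Nn c E (u + v) ≤ 2 * Nn c E u + 2 * Nn c E v := by
  have h := Nn_nonneg hc E (u - v)
  have : Nn c E (u + v) + Nn c E (u - v) = 2 * Nn c E u + 2 * Nn c E v := by
    simp only [Nn, map_add, map_sub, LinearMap.add_apply, LinearMap.sub_apply]; ring
  linarith

theorem Nn_sum {c : V → ℝ} (hc : ∀ i, 0 < c i) (E : Submodule K V) {α : Type*} (s : Finset α)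
    (f : α → Submodule K V → ℝ) : Nn c E (∑ a ∈ s, f a) ≤ 2 ^ s.card * ∑ a ∈ s, Nn c E (f a) := by
  induction s using Finset.induction_on with
  | empty => simp [Nn]
  | insert a s ha ih =>
    rw [Finset.sum_insert ha, Finset.sum_insert ha, Finset.card_insert_of_notMem ha, pow_succ]
    have h1 := Nn_add hc E (f a) (∑ a ∈ s, f a)
    have h2 := Nn_nonneg hc E (f a)
    have h3 : (1:ℝ) ≤ 2 ^ s.card := one_le_pow₀ (by norm_num)
    nlinarith

theorem Qn_le_Nn {c : V → ℝ} (hc : ∀ i, 0 < c i) (E : Submodule K V) (j : ℕ)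
    (u : Submodule K V → ℝ) : Qn c E j u ≤ Nn c E u := by
  by_cases h : j < Module.finrank K V + 1
  · rw [Nn_eq]
    exact Finset.single_le_sum (f := fun j => Qn c E j u) (fun j _ => Qn_nonneg hc E j u)
      (Finset.mem_range.2 h)
  · have : PP c E j u = 0 := Vp_big (fun j => ND_all hc E j) (by omega) (PP_mem hc E j u)
    rw [Qn, this]; simpa using Nn_nonneg hc E u

theorem Nn_of_mem {c : V → ℝ} (hc : ∀ i, 0 < c i) {E : Submodule K V} {j : ℕ}
    {u : Submodule K V → ℝ} (hu : u ∈ Vp c E j) : Nn c E u ≤ Qn c E j u := by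
  rw [Nn_eq, Finset.sum_congr rfl (fun k _ => show Qn c E k u = if k = j then Qn c E j u else 0 by
    split_ifs with h
    · rw [h]
    · exact Qn_ne hc (Ne.symm h) hu)]
  rw [Finset.sum_ite_eq']
  split_ifs
  · exact le_rfl
  · exact Qn_nonneg hc E j u

theorem cs_N {c : V → ℝ} (hc : ∀ i, 0 < c i) {E : Submodule K V} {j : ℕ}
    (u : Submodule K V → ℝ) {v : Submodule K V → ℝ} (hv : v ∈ Vp c E j) :
    (Bm c E u v) ^ 2 ≤ Nn c E u * Qn c E j v :=
  (cs_lev hc u hv).trans (mul_le_mul_of_nonneg_right (Qn_le_Nn hc E j u) (Qn_nonneg hc E j v))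

-- contraction

theorem y_Vp_succ {c : V → ℝ} (hc : ∀ i, 0 < c i) {E : Submodule K V} {i : V} (hi : i ∉ E) {j : ℕ}
    {u : Submodule K V → ℝ} (hu : u ∈ Vp c E (j+1)) :
    y i u = PP c (E ⊔ sp K i) j (y i u) + PP c (E ⊔ sp K i) (j+1) (y i u) := by
  refine two_term hc (y_mem_AF hi hu.1) fun w hw => ?_
  rw [Bm_symm, ← B_gysin c hi (up_of_AF hw) (up_of_AF hu.1), Bm_symm]
  exact hu.2 w (supOn_mono (AF_sup hi j) hw)

theorem y_Vp_zero {c : V → ℝ} (hc : ∀ i, 0 < c i) {E : Submodule K V} {i : V} (hi : i ∉ E)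
    {u : Submodule K V → ℝ} (hu : u ∈ Vp c E 0) : y i u ∈ Vp c (E ⊔ sp K i) 0 := by
  refine ⟨y_mem_AF hi hu.1, fun w hw => ?_⟩
  have : w = 0 := by
    funext F
    exact hw F (fun h => by have := rk_mono h.1; have := h.2; omega)
  rw [this, map_zero]

theorem Vp_down {c : V → ℝ} (hc : ∀ i, 0 < c i) {E : Submodule K V} {i : V} (hi : i ∉ E) {j : ℕ}
    {v : Submodule K V → ℝ} (hv : v ∈ Vp c (E ⊔ sp K i) j) :
    v = PP c E j v + PP c E (j+1) v := by
  refine two_term hc (supOn_mono (AF_sup hi _) hv.1) fun w hw => ?_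
  rw [B_gysin c hi (up_of_AF hv.1) (up_of_AF hw)]
  exact hv.2 _ (y_mem_AF hi hw)

theorem Qn_down {c : V → ℝ} (hc : ∀ i, 0 < c i) {E : Submodule K V} {i : V} (hi : i ∉ E) {j : ℕ}
    {v : Submodule K V → ℝ} (hv : v ∈ Vp c (E ⊔ sp K i) j) :
    Qn c E (j+1) v = Qn c E j v := by
  have h0 : Bm c E v v = 0 := by
    rw [B_gysin c hi (up_of_AF hv.1) (supOn_mono (up_sup i) (up_of_AF hv.1)),
      y_of_mem (mem_sup_sp E i) (up_of_AF hv.1), map_zero]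
  have h1 := Vp_down hc hi hv
  have h2 : Bm c E (PP c E j v) (PP c E (j+1) v) = 0 :=
    Vp_orth (by omega) (PP_mem hc E j v) (PP_mem hc E (j+1) v)
  have h3 : Bm c E v v = Bm c E (PP c E j v) (PP c E j v) +
      Bm c E (PP c E (j+1) v) (PP c E (j+1) v) := by
    conv_lhs => rw [h1]
    simp only [map_add, LinearMap.add_apply]
    rw [Bm_symm _ _ (PP c E (j+1) v), h2]; ring
  rw [h0] at h3
  rw [Qn, Qn, pow_succ]
  linear_combination (-1)^j * h3

theorem le_of_sq_le {C a Q q r : ℝ} (hQ : 0 ≤ Q) (hq : 0 ≤ q) (ha : 0 ≤ a)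
    (h1 : Q ^ 2 ≤ q * r) (hC : 0 < C) (h2 : C * r ≤ a * Q) : C * Q ≤ a * q := by
  rcases eq_or_lt_of_le hQ with h | h
  · rw [← h, mul_zero]; positivity
  · have : C * Q * Q ≤ a * q * Q := by nlinarith
    exact le_of_mul_le_mul_right this h

theorem step1 {c : V → ℝ} (hc : ∀ i, 0 < c i) {E : Submodule K V} {i : V} (hi : i ∉ E) {j : ℕ}
    {a : ℝ} (ha : 0 ≤ a)
    (h : ∀ u ∈ Vp c E j, c i * Qn c (E ⊔ sp K i) j (y i u) ≤ a * Qn c E j u)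
    {v : Submodule K V → ℝ} (hv : v ∈ Vp c (E ⊔ sp K i) j) :
    c i * Qn c E j v ≤ a * Qn c (E ⊔ sp K i) j v := by
  have hp := PP_mem hc E j v
  have h1 : Qn c E j v = (-1) ^ j * Bm c (E ⊔ sp K i) (y i (PP c E j v)) v := by
    rw [Qn, B_PP hc v hp, B_gysin c hi (up_of_AF hv.1) (up_of_AF hp.1), Bm_symm]
  have h2 := cs_lev hc (y i (PP c E j v)) hv
  refine le_of_sq_le (r := Qn c (E ⊔ sp K i) j (y i (PP c E j v))) (Qn_nonneg hc _ _ _)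
    (Qn_nonneg hc _ _ _) ha ?_ (hc i) ?_
  · rw [h1, mul_pow, ← pow_mul, mul_comm j 2, pow_mul, neg_one_sq, one_pow, one_mul]
    linarith
  · have := h _ hp
    rwa [Qn_PP hc] at this

theorem step2 {c : V → ℝ} (hc : ∀ i, 0 < c i) {E : Submodule K V} {i : V} (hi : i ∉ E) {j : ℕ}
    {a : ℝ} (ha : 0 ≤ a)
    (h : ∀ v ∈ Vp c (E ⊔ sp K i) j, c i * Qn c E j v ≤ a * Qn c (E ⊔ sp K i) j v)
    {u : Submodule K V → ℝ} (hu : u ∈ Vp c E (j+1)) :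
    c i * Qn c (E ⊔ sp K i) j (y i u) ≤ a * Qn c E (j+1) u := by
  have hb := PP_mem hc (E ⊔ sp K i) j (y i u)
  set b := PP c (E ⊔ sp K i) j (y i u) with hbd
  have h1 : Qn c (E ⊔ sp K i) j (y i u) = (-1) ^ j * Bm c E b u := by
    rw [Qn, B_PP hc _ hb, Bm_symm, ← B_gysin c hi (up_of_AF hb.1) (up_of_AF hu.1)]
  have h2 := cs_lev hc b hu
  rw [Qn_down hc hi hb] at h2
  refine le_of_sq_le (r := Qn c E j b) (Qn_nonneg hc _ _ _) (Qn_nonneg hc _ _ _) ha ?_ (hc i) ?_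
  · rw [h1, mul_pow, ← pow_mul, mul_comm j 2, pow_mul, neg_one_sq, one_pow, one_mul]
    linarith
  · have := h _ hb
    rwa [hbd, Qn_PP hc] at this

theorem euler_Vp {c : V → ℝ} (hc : ∀ i, 0 < c i) {E : Submodule K V} {j : ℕ}
    {u : Submodule K V → ℝ} (hu : u ∈ Vp c E j) :
    (-1) ^ j * Bm c E (ee K c u) u = ((Module.finrank K V : ℝ) - rk E - 2 * j) * Qn c E j u := by
  have hN : Bm c E (NN E u) u = j * Bm c E u u := by
    have := hu.2 _ (NN_AF hu.1)
    rw [map_sub, map_smul, smul_eq_mul, sub_eq_zero] at this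
    rw [Bm_symm, this]
  rw [Qn_of_mem hc hu, euler c (up_of_AF hu.1) (up_of_AF hu.1), Bm_symm _ _ u (NN E u), hN]
  ring

theorem B_y_y_succ {c : V → ℝ} (hc : ∀ i, 0 < c i) {E : Submodule K V} {i : V} (hi : i ∉ E) {j : ℕ}
    {u : Submodule K V → ℝ} (hu : u ∈ Vp c E (j+1)) :
    (-1) ^ (j+1) * Bm c (E ⊔ sp K i) (y i u) (y i u) =
      Qn c (E ⊔ sp K i) (j+1) (y i u) - Qn c (E ⊔ sp K i) j (y i u) := by
  have h2 : Bm c (E ⊔ sp K i) (PP c (E ⊔ sp K i) j (y i u)) (PP c (E ⊔ sp K i) (j+1) (y i u)) = 0 :=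
    Vp_orth (by omega) (PP_mem hc _ j _) (PP_mem hc _ (j+1) _)
  have h1 := y_Vp_succ hc hi hu
  have h3 : Bm c (E ⊔ sp K i) (y i u) (y i u) =
    Bm c (E ⊔ sp K i) (PP c (E ⊔ sp K i) j (y i u)) (PP c (E ⊔ sp K i) j (y i u)) +
    Bm c (E ⊔ sp K i) (PP c (E ⊔ sp K i) (j+1) (y i u)) (PP c (E ⊔ sp K i) (j+1) (y i u)) := by
    conv_lhs => rw [h1]
    simp only [map_add, LinearMap.add_apply]
    rw [Bm_symm _ _ (PP c (E ⊔ sp K i) (j+1) (y i u)), h2]; ring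
  rw [h3, Qn, Qn, pow_succ]; ring

/-- constants -/
noncomputable def aa (K V : Type) [Field K] [AddCommGroup V] [Module K V] [Fintype V] : ℕ → ℝ
  | 0 => Module.finrank K V
  | (j+1) => Module.finrank K V + Fintype.card V * aa K V j

theorem aa_nonneg (j : ℕ) : 0 ≤ aa K V j := by
  induction j with
  | zero => simp [aa]
  | succ j ih => rw [aa]; positivity

theorem T1_U {c : V → ℝ} (hc : ∀ i, 0 < c i) {E : Submodule K V} (j : ℕ) : ∀ i, i ∉ E →
    ∀ u ∈ Vp c E j, c i * Qn c (E ⊔ sp K i) j (y i u) ≤ aa K V j * Qn c E j u := by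
  induction j with
  | zero =>
    intro i hi u hu
    have h1 := euler_Vp hc hu
    rw [B_ee_self c (up_of_AF hu.1) (up_of_AF hu.1), pow_zero, one_mul] at h1
    have h2 : c i * Qn c (E ⊔ sp K i) 0 (y i u) ≤ ∑ k, if k ∈ E then 0 else
        c k * Bm c (E ⊔ sp K k) (y k u) (y k u) := by
      have h3 : ∀ k, k ∉ E → Bm c (E ⊔ sp K k) (y k u) (y k u) = Qn c (E ⊔ sp K k) 0 (y k u) := by
        intro k hk
        rw [Qn_of_mem hc (y_Vp_zero hc hk hu)]; simp
      have := Finset.single_le_sum (s := Finset.univ) (f := fun k => if k ∈ E then 0 else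
        c k * Bm c (E ⊔ sp K k) (y k u) (y k u)) (fun k _ => by
          split_ifs with hk
          · exact le_rfl
          · rw [h3 k hk]; exact mul_nonneg (hc k).le (Qn_nonneg hc _ _ _)) (Finset.mem_univ i)
      simp only [if_neg hi, h3 i hi] at this
      exact this
    rw [h1] at h2
    refine h2.trans (mul_le_mul_of_nonneg_right ?_ (Qn_nonneg hc _ _ _))
    rw [aa]; have : (0:ℝ) ≤ rk E := Nat.cast_nonneg _
    simp
  | succ j ih =>
    intro i hi u hu
    have h1 := euler_Vp hc hu
    rw [B_ee_self c (up_of_AF hu.1) (up_of_AF hu.1), Finset.mul_sum] at h1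
    have hD : ∀ k, k ∉ E → c k * Qn c (E ⊔ sp K k) j (y k u) ≤ aa K V j * Qn c E (j+1) u :=
      fun k hk => step2 hc hk (aa_nonneg j) (fun v hv => step1 hc hk (aa_nonneg j) (ih k hk) hv) hu
    have hq := Qn_nonneg hc E (j+1) u
    have h3 : ∀ k, (-1) ^ (j+1) * (if k ∈ E then 0 else c k * Bm c (E ⊔ sp K k) (y k u) (y k u)) ≥
        (if k = i then c i * Qn c (E ⊔ sp K i) (j+1) (y i u) else 0)
          - aa K V j * Qn c E (j+1) u := by
      intro k
      by_cases hk : k ∈ E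
      · have hki : k ≠ i := fun h => hi (h ▸ hk)
        rw [if_pos hk, if_neg hki, mul_zero]
        have := mul_nonneg (aa_nonneg (K := K) (V := V) j) hq
        linarith
      · rw [if_neg hk, mul_left_comm, B_y_y_succ hc hk hu]
        have := hD k hk
        split_ifs with hki
        · subst hki; linarith
        · have := mul_nonneg (hc k).le (Qn_nonneg hc (E ⊔ sp K k) (j+1) (y k u))
          linarith
    have h4 := Finset.sum_le_sum (s := Finset.univ) fun k _ => h3 k
    rw [h1, Finset.sum_sub_distrib, Finset.sum_ite_eq'] at h4
    simp only [Finset.mem_univ, if_true, Finset.sum_const, Finset.card_univ, nsmul_eq_mul] at h4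
    rw [aa]
    have h5 : ((Module.finrank K V : ℝ) - rk E - 2 * (j+1:ℕ)) * Qn c E (j+1) u ≤
        Module.finrank K V * Qn c E (j+1) u := by
      refine mul_le_mul_of_nonneg_right ?_ hq
      have : (0:ℝ) ≤ rk E := Nat.cast_nonneg _
      have : (0:ℝ) ≤ (j+1:ℕ) := Nat.cast_nonneg _
      linarith
    linarith

theorem T1_W {c : V → ℝ} (hc : ∀ i, 0 < c i) {E : Submodule K V} {i : V} (hi : i ∉ E) {j : ℕ}
    {v : Submodule K V → ℝ} (hv : v ∈ Vp c (E ⊔ sp K i) j) :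
    c i * Qn c E j v ≤ aa K V j * Qn c (E ⊔ sp K i) j v :=
  step1 hc hi (aa_nonneg j) (T1_U hc j i hi) hv

theorem T1_D {c : V → ℝ} (hc : ∀ i, 0 < c i) {E : Submodule K V} {i : V} (hi : i ∉ E) {j : ℕ}
    {u : Submodule K V → ℝ} (hu : u ∈ Vp c E (j+1)) :
    c i * Qn c (E ⊔ sp K i) j (y i u) ≤ aa K V j * Qn c E (j+1) u :=
  step2 hc hi (aa_nonneg j) (fun v hv => T1_W hc hi hv) hu

theorem Nn_down {c : V → ℝ} (hc : ∀ i, 0 < c i) {E : Submodule K V} {i : V} (hi : i ∉ E) {j : ℕ}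
    {v : Submodule K V → ℝ} (hv : v ∈ Vp c (E ⊔ sp K i) j) :
    c i * Nn c E v ≤ 4 * aa K V j * Qn c (E ⊔ sp K i) j v := by
  have h1 := Nn_add hc E (PP c E j v) (PP c E (j+1) v)
  rw [← Vp_down hc hi hv] at h1
  have h2 := Nn_of_mem hc (PP_mem hc E j v)
  have h3 := Nn_of_mem hc (PP_mem hc E (j+1) v)
  rw [Qn_PP hc] at h2 h3
  rw [Qn_down hc hi hv] at h3
  have h4 := T1_W hc hi hv
  have := mul_le_mul_of_nonneg_left (show Nn c E v ≤ 4 * Qn c E j v by linarith) (hc i).le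
  linarith

theorem T1_lev {c : V → ℝ} (hc : ∀ i, 0 < c i) {E : Submodule K V} {i : V} (hi : i ∉ E) {j : ℕ}
    {u : Submodule K V → ℝ} (hu : u ∈ Vp c E j) :
    c i ^ 2 * Nn c E (y i u) ≤ (8 * aa K V j ^ 2 + 8 * aa K V (j-1) ^ 2) * Qn c E j u := by
  have hci := hc i
  have hq := Qn_nonneg hc E j u
  cases j with
  | zero =>
    have h1 := Nn_down hc hi (y_Vp_zero hc hi hu)
    have h2 := T1_U hc 0 i hi u hu
    have ha := aa_nonneg (K := K) (V := V) 0
    have h3 : c i * (c i * Nn c E (y i u)) ≤ c i * (4 * aa K V 0 * Qn c (E ⊔ sp K i) 0 (y i u)) :=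
      mul_le_mul_of_nonneg_left h1 hci.le
    have h4 := mul_le_mul_of_nonneg_left h2 ha
    have h5 : 0 ≤ aa K V 0 * aa K V 0 * Qn c E 0 u := by positivity
    simp only [zero_tsub]
    nlinarith
  | succ j =>
    have h0 := Nn_add hc E (PP c (E ⊔ sp K i) j (y i u)) (PP c (E ⊔ sp K i) (j+1) (y i u))
    rw [← y_Vp_succ hc hi hu] at h0
    have h1 := Nn_down hc hi (PP_mem hc (E ⊔ sp K i) j (y i u))
    have h1' := Nn_down hc hi (PP_mem hc (E ⊔ sp K i) (j+1) (y i u))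
    rw [Qn_PP hc] at h1 h1'
    have h2 := T1_U hc (j+1) i hi u hu
    have h2' := T1_D hc hi hu
    have ha := aa_nonneg (K := K) (V := V) j
    have ha' := aa_nonneg (K := K) (V := V) (j+1)
    have h3 := mul_le_mul_of_nonneg_left h1 hci.le
    have h3' := mul_le_mul_of_nonneg_left h1' hci.le
    have h4 := mul_le_mul_of_nonneg_left h2 ha'
    have h4' := mul_le_mul_of_nonneg_left h2' ha
    have h5 := mul_le_mul_of_nonneg_left h0 (sq_nonneg (c i))
    simp only [Nat.add_sub_cancel]
    nlinarith

theorem T1 (K V : Type) [Field K] [Fintype K] [AddCommGroup V] [Module K V] [Fintype V] :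
    ∃ C : ℝ, 0 ≤ C ∧ ∀ (c : V → ℝ), (∀ i, 0 < c i) → ∀ (E : Submodule K V) (i : V)
      (u : Submodule K V → ℝ), u ∈ supOn (up E) → c i ^ 2 * Nn c E (y i u) ≤ C * Nn c E u := by
  set M := Module.finrank K V + 1 with hM
  set D : ℝ := ∑ j ∈ Finset.range M, (8 * aa K V j ^ 2 + 8 * aa K V (j-1) ^ 2) with hD
  have hD0 : 0 ≤ D := Finset.sum_nonneg fun j _ => by positivity
  refine ⟨2 ^ M * D, by positivity, fun c hc E i u hu => ?_⟩
  by_cases hi : i ∈ E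
  · rw [y_of_mem hi hu]
    have : Nn c E 0 = 0 := by simp [Nn]
    rw [this, mul_zero]
    have := Nn_nonneg hc E u
    positivity
  have h1 := Nn_sum hc E (Finset.range M) (fun j => y i (PP c E j u))
  rw [← map_sum, sum_PP_eq hc hu, Finset.card_range] at h1
  have h2 : ∀ j ∈ Finset.range M, c i ^ 2 * Nn c E (y i (PP c E j u)) ≤ D * Qn c E j u := by
    intro j hj
    refine (T1_lev hc hi (PP_mem hc E j u)).trans ?_
    rw [Qn_PP hc]
    refine mul_le_mul_of_nonneg_right ?_ (Qn_nonneg hc E j u)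
    exact Finset.single_le_sum (f := fun j => 8 * aa K V j ^ 2 + 8 * aa K V (j-1) ^ 2)
      (fun j _ => by positivity) hj
  have h3 := Finset.sum_le_sum h2
  rw [← Finset.mul_sum, ← Finset.mul_sum, ← Nn_eq] at h3
  have h4 := mul_le_mul_of_nonneg_left h1 (sq_nonneg (c i))
  have h5 := mul_le_mul_of_nonneg_left h3 (show (0:ℝ) ≤ 2 ^ M by positivity)
  linarith

end tone

set_option linter.unusedSectionVars false
set_option linter.unusedSimpArgs false
set_option linter.deprecated false

section monosec
open Classical
variable {K V : Type} [Field K] [Fintype K] [AddCommGroup V] [Module K V] [Fintype V]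

theorem upd_pos {c : V → ℝ} (hc : ∀ i, 0 < c i) (i : V) {t : ℝ} (ht : 0 < t) :
    ∀ k, 0 < Function.update c i t k := by
  intro k
  by_cases h : k = i
  · subst h; simpa using ht
  · simpa [h] using hc k

theorem sub_PP_mem {c : V → ℝ} (hc : ∀ i, 0 < c i) {E : Submodule K V} {k : ℕ}
    {x : Submodule K V → ℝ} (hx : x ∈ supOn (AF E (k+1))) : x - PP c E k x ∈ supOn (AF E k) := by
  rw [PP_apply, pr_of_mem (ND_all hc E (k+1)) hx, sub_sub_cancel]
  exact pr_mem (ND_all hc E k) x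

theorem PP_low {c : V → ℝ} (hc : ∀ i, 0 < c i) {E : Submodule K V} {k : ℕ}
    {x : Submodule K V → ℝ} (hx : x ∈ supOn (AF E k)) : PP c E k x = 0 := by
  rw [PP_apply, pr_of_mem (ND_all hc E (k+1)) (supOn_mono (AF_mono E (by omega)) hx),
    pr_of_mem (ND_all hc E k) hx, sub_self]

theorem f_diff {c : V → ℝ} (hc : ∀ i, 0 < c i) {E : Submodule K V} (i : V) {k : ℕ}
    {x : Submodule K V → ℝ} (hx : x ∈ supOn (AF E (k+1))) {t : ℝ} (ht : 0 < t) :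
    Qn (Function.update c i t) E k x = Qn c E k x + (t - c i) *
      ((-1) ^ k * Bm c E (y i (PP (Function.update c i t) E k x)) (PP c E k x)) := by
  have hc' := upd_pos hc i ht
  set c' := Function.update c i t
  have h1 : Qn c' E k x = (-1) ^ k * Bm c' E (PP c' E k x) (PP c E k x) := by
    have := (PP_mem hc' E k x).2 _ (Submodule.sub_mem _ (sub_PP_mem hc' hx) (sub_PP_mem hc hx))
    rw [sub_sub_sub_cancel_left, map_sub, sub_eq_zero] at this
    rw [Qn, this]
  have h2 : Qn c E k x = (-1) ^ k * Bm c E (PP c' E k x) (PP c E k x) := by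
    have := (PP_mem hc E k x).2 _ (Submodule.sub_mem _ (sub_PP_mem hc' hx) (sub_PP_mem hc hx))
    rw [sub_sub_sub_cancel_left, map_sub, sub_eq_zero] at this
    rw [Qn, this, Bm_symm]
  rw [h1, h2, B_update c i t (up_of_AF (PP_mem hc' E k x).1) (up_of_AF (PP_mem hc E k x).1)]
  ring

theorem f_deriv {c : V → ℝ} (hc : ∀ i, 0 < c i) {E : Submodule K V} (i : V) {k : ℕ}
    {x : Submodule K V → ℝ} (hx : x ∈ supOn (AF E (k+1))) :
    HasDerivAt (fun t => Qn (Function.update c i t) E k x)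
      ((-1) ^ k * Bm c E (y i (PP c E k x)) (PP c E k x)) (c i) := by
  have hcc : Function.update c i (c i) = c := Function.update_eq_self i c
  have hB : ∀ F G, ContinuousAt (fun t => Bm (Function.update c i t) E
      (Pi.single F 1) (Pi.single G 1)) (c i) := fun F G =>
    ((Bm_continuous E F G).comp (continuous_const.update i continuous_id)).continuousAt
  have hP : ContinuousAt (fun t => PP (Function.update c i t) E k x) (c i) := by
    simp only [PP_apply]
    exact (pr_continuousAt hB (by rw [hcc]; exact ND_all hc E (k+1)) continuousAt_const).sub
      (pr_continuousAt hB (by rw [hcc]; exact ND_all hc E k) continuousAt_const)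
  have hg : ContinuousAt (fun t => (-1) ^ k *
      Bm c E (y i (PP (Function.update c i t) E k x)) (PP c E k x)) (c i) := by
    refine continuousAt_const.mul (bil_continuousAt (B := fun _ => Bm c E)
      (fun _ _ => continuousAt_const) ?_ continuousAt_const)
    exact (LinearMap.continuous_of_finiteDimensional (y i)).continuousAt.comp hP
  rw [hasDerivAt_iff_tendsto_slope]
  have h2 := hg.tendsto
  simp only [hcc] at h2
  refine (h2.mono_left nhdsWithin_le_nhds).congr' ?_
  have h3 : ∀ᶠ t in nhds (c i), 0 < t := lt_mem_nhds (hc i)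
  filter_upwards [h3.filter_mono nhdsWithin_le_nhds, self_mem_nhdsWithin] with t ht hne
  have hne' : t - c i ≠ 0 := sub_ne_zero.2 hne
  rw [slope_def_field, hcc, f_diff hc i hx ht]
  field_simp
  ring

theorem Qn_congr {c : V → ℝ} {E : Submodule K V} {k : ℕ} {u v : Submodule K V → ℝ}
    (h : PP c E k u = PP c E k v) : Qn c E k u = Qn c E k v := by rw [Qn, Qn, h]

theorem mono_key {c : V → ℝ} (hc : ∀ i, 0 < c i) {E : Submodule K V} {i : V} (hi : i ∉ E) {k : ℕ}
    {x : Submodule K V → ℝ} (hx : x ∈ supOn (AF E (k+1))) :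
    ∃ p d : ℝ, 0 ≤ p ∧ 0 ≤ d ∧
      (-1) ^ k * Bm c E (y i (PP c E k x)) (PP c E k x) ≤ p ∧
      (-1) ^ (k+1) * Bm c E (y i (PP c E (k+1) (y i x))) (PP c E (k+1) (y i x)) = - d ∧
      p ^ 2 ≤ Qn c E (k+1) (y i x) * Qn c E k x ∧ Qn c E (k+1) (y i x) ^ 2 ≤ p * d := by
  set E' := E ⊔ sp K i with hE'
  have hu := PP_mem hc E k x
  set u := PP c E k x with hud
  have hb := PP_mem hc E' k (y i u)
  set b := PP c E' k (y i u) with hbd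
  have hyub : y i u - b ∈ supOn (AF E (k+1)) ∧
      (-1) ^ k * Bm c E' (y i u) (y i u) ≤ Qn c E' k (y i u) := by
    cases k with
    | zero =>
      have h1 := y_Vp_zero hc hi hu
      rw [hbd, PP_self hc h1, sub_self]
      exact ⟨Submodule.zero_mem _, by rw [Qn_of_mem hc h1]⟩
    | succ k =>
      have h1 := y_Vp_succ hc hi hu
      have h2 : y i u - b = PP c E' k (y i u) := by
        rw [hbd, sub_eq_iff_eq_add]; exact h1
      refine ⟨?_, ?_⟩
      · rw [h2]; exact supOn_mono (AF_sup hi _) (PP_mem hc E' k _).1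
      · rw [B_y_y_succ hc hi hu]
        have := Qn_nonneg hc E' k (y i u)
        linarith
  have hzb : PP c E (k+1) (y i x) = PP c E (k+1) b := by
    have h1 : y i x - b ∈ supOn (AF E (k+1)) := by
      have : y i x - b = y i (x - u) + (y i u - b) := by rw [map_sub]; abel
      rw [this]
      exact Submodule.add_mem _ (y_mem_AF' i (sub_PP_mem hc hx)) hyub.1
    have := PP_low hc h1
    rwa [map_sub, sub_eq_zero] at this
  have hκ : Qn c E (k+1) (y i x) = Qn c E k b := by
    rw [Qn_congr hzb, Qn_down hc hi hb]
  have hz := PP_mem hc E (k+1) b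
  have hPk := PP_mem hc E k b
  have hdmem : y i (PP c E (k+1) b) ∈ Vp c E' k := by
    refine ⟨?_, fun w hw => ?_⟩
    · have h1 : y i b = 0 := y_of_mem (mem_sup_sp E i) (up_of_AF hb.1)
      rw [Vp_down hc hi hb, map_add] at h1
      rw [eq_neg_of_add_eq_zero_right h1]
      exact Submodule.neg_mem _ (y_mem_AF hi hPk.1)
    · rw [Bm_symm, ← B_gysin c hi (up_of_AF hw) (up_of_AF hz.1), Bm_symm]
      exact hz.2 w (supOn_mono (AF_sup hi k) hw)
  refine ⟨Qn c E' k (y i u), Qn c E' k (y i (PP c E (k+1) b)), Qn_nonneg hc _ _ _,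
    Qn_nonneg hc _ _ _, ?_, ?_, ?_, ?_⟩
  · rw [B_y_y c hi (up_of_AF hu.1) (up_of_AF hu.1)]; exact hyub.2
  · rw [hzb, B_y_y c hi (up_of_AF hz.1) (up_of_AF hz.1), Qn_of_mem hc hdmem, pow_succ]; ring
  · have h1 : Qn c E' k (y i u) = (-1) ^ k * Bm c E b u := by
      rw [Qn, B_PP hc _ hb, Bm_symm, ← B_gysin c hi (up_of_AF hb.1) (up_of_AF hu.1)]
    have h2 := cs_lev hc b hu
    rw [hud, Qn_PP hc, ← hud] at h2
    rw [h1, hκ, mul_pow, ← pow_mul, mul_comm k 2, pow_mul, neg_one_sq, one_pow, one_mul]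
    exact h2
  · have h1 : Qn c E (k+1) (y i x) = (-1) ^ (k+1) * Bm c E' b (y i (PP c E (k+1) b)) := by
      rw [Qn_congr hzb, Qn, B_PP hc _ hz, B_gysin c hi (up_of_AF hb.1) (up_of_AF hz.1)]
    have h2 := cs_lev hc b hdmem
    rw [h1, mul_pow, ← pow_mul, mul_comm (k+1) 2, pow_mul, neg_one_sq, one_pow, one_mul]
    rw [hbd, Qn_PP hc, ← hbd] at h2
    exact h2

theorem f_deriv_at {c : V → ℝ} (hc : ∀ i, 0 < c i) {E : Submodule K V} (i : V) {k : ℕ}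
    {x : Submodule K V → ℝ} (hx : x ∈ supOn (AF E (k+1))) {t : ℝ} (ht : 0 < t) :
    HasDerivAt (fun t => Qn (Function.update c i t) E k x)
      ((-1) ^ k * Bm (Function.update c i t) E (y i (PP (Function.update c i t) E k x))
        (PP (Function.update c i t) E k x)) t := by
  have := f_deriv (upd_pos hc i ht) (E := E) i hx
  simpa using this

theorem mono_prod {c : V → ℝ} (hc : ∀ i, 0 < c i) {E : Submodule K V} {i : V} (hi : i ∉ E) {k : ℕ}
    {x : Submodule K V → ℝ} (hx : x ∈ supOn (AF E (k+1))) :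
    AntitoneOn (fun t => Qn (Function.update c i t) E k x *
      Qn (Function.update c i t) E (k+1) (y i x)) (Set.Ioi 0) := by
  have hz : y i x ∈ supOn (AF E (k+1+1)) := y_mem_AF' i hx
  have hd := fun t (ht : 0 < t) => (f_deriv_at hc (E := E) i hx ht).mul (f_deriv_at hc i hz ht)
  refine antitoneOn_of_hasDerivWithinAt_nonpos (convex_Ioi 0)
    (fun t ht => (hd t ht).continuousAt.continuousWithinAt)
    (fun t ht => (hd t (by simpa using ht)).hasDerivWithinAt) (fun t ht => ?_)
  have ht' : 0 < t := by simpa using ht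
  have hc' := upd_pos hc i ht'
  obtain ⟨p, d, hp, hd', h1, h2, h3, h4⟩ := mono_key hc' hi hx
  rw [h2]
  have hf := Qn_nonneg hc' E k x
  have hκ := Qn_nonneg hc' E (k+1) (y i x)
  set f := Qn (Function.update c i t) E k x
  set κ := Qn (Function.update c i t) E (k+1) (y i x)
  have h5 := mul_le_mul_of_nonneg_right h1 hκ
  suffices p * κ ≤ f * d by linarith
  rcases eq_or_lt_of_le hp with h | h
  · rw [← h, zero_mul]; positivity
  · refine le_of_mul_le_mul_right ?_ h
    have h6 := mul_le_mul_of_nonneg_right h3 hκ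
    have h7 := mul_le_mul_of_nonneg_right h4 hf
    nlinarith

theorem mono_zero {c : V → ℝ} (hc : ∀ i, 0 < c i) {E : Submodule K V} {i : V} (hi : i ∉ E) {k : ℕ}
    {x : Submodule K V → ℝ} (hx : x ∈ supOn (AF E (k+1))) (hz0 : y i x = 0) :
    AntitoneOn (fun t => Qn (Function.update c i t) E k x) (Set.Ioi 0) := by
  have hd := fun t (ht : 0 < t) => (f_deriv_at hc (E := E) i hx ht)
  refine antitoneOn_of_hasDerivWithinAt_nonpos (convex_Ioi 0)
    (fun t ht => (hd t ht).continuousAt.continuousWithinAt)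
    (fun t ht => (hd t (by simpa using ht)).hasDerivWithinAt) (fun t ht => ?_)
  have ht' : 0 < t := by simpa using ht
  have hc' := upd_pos hc i ht'
  obtain ⟨p, d, hp, hd', h1, h2, h3, h4⟩ := mono_key hc' hi hx
  have : Qn (Function.update c i t) E (k+1) (y i x) = 0 := by rw [hz0]; simp [Qn]
  rw [this, zero_mul] at h3
  have : p = 0 := by nlinarith
  linarith

end monosec

set_option linter.unusedSectionVars false
set_option linter.unusedSimpArgs false
set_option linter.deprecated false

section pursec
open Classical
variable {K V : Type} [Field K] [Fintype K] [AddCommGroup V] [Module K V] [Fintype V]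

/-- `F` is spanned by elements of `S` -/
def SFl (K : Type) {V : Type} [Field K] [AddCommGroup V] [Module K V] (S : Set V)
    (F : Submodule K V) : Prop := Submodule.span K (S ∩ (F : Set V)) = F

/-- rank `k` flats of `S` -/
def SF (K : Type) {V : Type} [Field K] [AddCommGroup V] [Module K V] (S : Set V) (k : ℕ) :
    Set (Submodule K V) := {F | rk F = k ∧ SFl K S F}

theorem SFl_mono {S S' : Set V} (h : S ⊆ S') {F : Submodule K V} (hF : SFl K S F) : SFl K S' F := by
  refine le_antisymm (Submodule.span_le.2 Set.inter_subset_right) ?_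
  conv_lhs => rw [← hF]
  exact Submodule.span_mono (Set.inter_subset_inter_left _ h)

theorem SFl_sup {S : Set V} {F : Submodule K V} (hF : SFl K S F) {s : V} (hs : s ∈ S) :
    SFl K S (F ⊔ sp K s) := by
  refine le_antisymm (Submodule.span_le.2 Set.inter_subset_right) (sup_le ?_ ?_)
  · conv_lhs => rw [← hF]
    refine Submodule.span_mono (Set.inter_subset_inter_right _ ?_)
    exact SetLike.coe_subset_coe.2 le_sup_left
  · rw [sp_le]; exact Submodule.subset_span ⟨hs, mem_sup_sp F s⟩

theorem SF_sub_Hm (S : Set V) (k : ℕ) : SF K S k ⊆ Hm (⊥ : Submodule K V) k :=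
  fun F hF => ⟨bot_le, by rw [hF.1, rk_bot, zero_add]⟩

theorem SFl_ind {S : Set V} {P : Submodule K V → Prop} (h0 : P ⊥)
    (h : ∀ F, P F → ∀ s ∈ S, s ∉ F → P (F ⊔ sp K s)) {F : Submodule K V} (hF : SFl K S F) : P F := by
  have key : ∀ T : Finset V, (T : Set V) ⊆ S → P (Submodule.span K (T : Set V)) := by
    intro T
    induction T using Finset.induction_on with
    | empty => intro _; simpa using h0
    | insert s T hs ih =>
      intro hT
      rw [Finset.coe_insert] at hT ⊢
      have h1 := ih ((Set.subset_insert _ _).trans hT)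
      rw [Submodule.span_insert, sup_comm]
      by_cases hm : s ∈ Submodule.span K (T : Set V)
      · rw [show Submodule.span K {s} = sp K s from rfl, sup_sp_of_mem hm]; exact h1
      · exact h _ h1 s (hT (Set.mem_insert _ _)) hm
  have := key (S ∩ (F : Set V)).toFinset (by simp)
  rw [Set.coe_toFinset] at this
  rwa [hF] at this

theorem mem_up_bot (u : Submodule K V → ℝ) : u ∈ supOn (up (⊥ : Submodule K V)) :=
  fun F hF => absurd (show F ∈ up (⊥ : Submodule K V) from (bot_le : ⊥ ≤ F)) hF

def Adm (S : Set V) (c : V → ℝ) : Prop := (∀ i ∈ S, c i = 1) ∧ ∀ i, 0 < c i ∧ c i ≤ 1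

noncomputable abbrev one1 (K V : Type) [Field K] [AddCommGroup V] [Module K V] : Submodule K V → ℝ :=
  Pi.single (⊥ : Submodule K V) 1

/-- bound for commuting operators -/
theorem N_comm (S : Set V) (x : Submodule K V → ℝ) {k : ℕ} (hx : x ∈ supOn (SF K S k)) :
    ∃ C : ℝ, 0 ≤ C ∧ ∀ c, Adm S c → ∀ A : (Submodule K V → ℝ) →ₗ[ℝ] (Submodule K V → ℝ),
      (∀ s u, A (y s u) = y s (A u)) → Nn c ⊥ (A x) ≤ C * Nn c ⊥ (A (one1 K V)) := by
  obtain ⟨C, hC0, hC⟩ := T1 K V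
  set D := C + 1 with hD
  have hD1 : 1 ≤ D := by linarith
  refine ⟨2 ^ (Finset.univ : Finset (Submodule K V)).card * ∑ F, x F ^ 2 * D ^ (rk F),
    mul_nonneg (by positivity) (Finset.sum_nonneg fun F _ => by positivity), fun c hc A hA => ?_⟩
  have hc0 : ∀ i, 0 < c i := fun i => (hc.2 i).1
  have key : ∀ F, SFl K S F → Nn c ⊥ (A (Pi.single F 1)) ≤ D ^ (rk F) * Nn c ⊥ (A (one1 K V)) := by
    intro F hF
    refine SFl_ind (P := fun F => Nn c ⊥ (A (Pi.single F 1)) ≤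
      D ^ (rk F) * Nn c ⊥ (A (one1 K V))) ?_ ?_ hF
    · rw [rk_bot]; simp
    · intro F ih s hs hsF
      have h1 : (Pi.single (F ⊔ sp K s) 1 : Submodule K V → ℝ) = y s (Pi.single F 1) := by
        rw [y_single, if_neg hsF]
      rw [h1, hA, rk_sup_sp hsF, pow_succ]
      have h2 := hC c hc0 ⊥ s (A (Pi.single F 1)) (mem_up_bot _)
      rw [hc.1 s hs, one_pow, one_mul] at h2
      have h3 := Nn_nonneg hc0 ⊥ (A (Pi.single F 1))
      calc _ ≤ C * _ := h2
        _ ≤ D * Nn c ⊥ (A (Pi.single F 1)) := by nlinarith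
        _ ≤ D * (D ^ rk F * Nn c ⊥ (A (one1 K V))) := by gcongr
        _ = _ := by ring
  have h1 : A x = ∑ F, x F • A (Pi.single F 1) := by
    conv_lhs => rw [eq_sum_single x]
    simp
  rw [h1]
  refine (Nn_sum hc0 ⊥ Finset.univ _).trans ?_
  rw [mul_assoc, Finset.sum_mul]
  refine mul_le_mul_of_nonneg_left (Finset.sum_le_sum fun F _ => ?_) (by positivity)
  rw [Nn_smul]
  by_cases hF : F ∈ SF K S k
  · have := mul_le_mul_of_nonneg_left (key F hF.2) (sq_nonneg (x F))
    linarith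
  · rw [hx F hF]; simp

theorem one1_mem (c : V → ℝ) : one1 K V ∈ Vp c ⊥ 0 := by
  refine ⟨single_mem_supOn (T := AF ⊥ 1) ⟨le_rfl, by omega⟩ 1, fun v hv => ?_⟩
  have : v = 0 := by
    funext F
    exact hv F (fun h => by have := rk_mono h.1; have := h.2; omega)
  rw [this, map_zero]

theorem N_y_one {c : V → ℝ} (hc : ∀ i, 0 < c i) {i : V} (hi : i ≠ 0) :
    Nn c ⊥ (y i (one1 K V)) ≤ 4 * ((bb c (sp K i)) ^ 2 / bb c (⊥ : Submodule K V)) := by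
  have hi' : i ∉ (⊥ : Submodule K V) := by simpa using hi
  have hv := y_Vp_zero hc hi' (one1_mem (K := K) c)
  set v := y i (one1 K V) with hvd
  have hvs : v = Pi.single (sp K i) 1 := by
    rw [hvd, one1, y_single, if_neg hi', bot_sup_eq]
  have h1 := Nn_add hc ⊥ (PP c ⊥ 0 v) (PP c ⊥ 1 v)
  rw [← Vp_down hc hi' hv] at h1
  have h2 := Nn_of_mem hc (PP_mem hc ⊥ 0 v)
  have h3 := Nn_of_mem hc (PP_mem hc ⊥ 1 v)
  rw [Qn_PP hc] at h2 h3
  rw [Qn_down hc hi' hv] at h3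
  have hp := PP_mem hc ⊥ 0 v
  have h4 : PP c ⊥ 0 v = (PP c ⊥ 0 v ⊥) • one1 K V := by
    funext F
    by_cases hF : F = ⊥
    · subst hF; simp
    · have : F ∉ AF (⊥ : Submodule K V) 1 := fun h => hF (by
        refine (eq_of_rk bot_le ?_).symm
        have := h.2; omega)
      rw [hp.1 F this]; simp [hF]
  have hB1 : Bm c ⊥ v (one1 K V) = bb c (sp K i) := by
    rw [hvs, Bm_single]; simp
  have hB2 : Bm c ⊥ (one1 K V) (one1 K V) = bb c (⊥ : Submodule K V) := by
    rw [Bm_single]; simp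
  have h5 : (PP c ⊥ 0 v ⊥) * bb c (⊥ : Submodule K V) = bb c (sp K i) := by
    have := B_PP hc v (one1_mem (K := K) c)
    rw [h4, hB1, map_smul, LinearMap.smul_apply, hB2, smul_eq_mul] at this
    exact this
  have hb : 0 < bb c (⊥ : Submodule K V) := bb_pos (fun i => (hc i).le) (S := Set.univ)
    (fun i _ => hc i) (by simp) _
  have h6 : Qn c ⊥ 0 v = (bb c (sp K i)) ^ 2 / bb c (⊥ : Submodule K V) := by
    rw [Qn, B_PP hc v hp, h4, map_smul, hB1, smul_eq_mul, pow_zero, one_mul, ← h5]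
    field_simp
  rw [← h6]
  linarith

noncomputable def ind (S : Set V) : V → ℝ := fun i => if i ∈ S then 1 else 0

theorem N_y_one_bdd (K : Type) {V : Type} [Field K] [Fintype K] [AddCommGroup V] [Module K V]
    [Fintype V] (S : Set V) (hS : Submodule.span K S = ⊤) : ∃ C : ℝ, 0 ≤ C ∧ ∀ c, Adm S c → ∀ i : V,
    Nn c ⊥ (y i (one1 K V)) ≤ C := by
  have hb0 : 0 < bb (ind S) (⊥ : Submodule K V) := by
    refine bb_pos (fun i => ?_) (S := S) (fun i hi => ?_) hS _
    · unfold ind; split_ifs <;> norm_num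
    · simp [ind, hi]
  set f : V → ℝ := fun i => 4 * ((bb (c1 V) (sp K i)) ^ 2 / bb (ind S) (⊥ : Submodule K V)) with hf
  have hf0 : ∀ i, 0 ≤ f i := fun i => by rw [hf]; positivity
  refine ⟨∑ i, f i, Finset.sum_nonneg fun i _ => hf0 i, fun c hc i => ?_⟩
  have hc0 : ∀ i, 0 < c i := fun i => (hc.2 i).1
  refine le_trans ?_ (Finset.single_le_sum (fun i _ => hf0 i) (Finset.mem_univ i))
  by_cases hi : i = 0
  · have : y i (one1 K V) = 0 := y_of_mem (E := ⊥) (by simp [hi]) (mem_up_bot _)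
    rw [this]
    have : Nn c ⊥ (0 : Submodule K V → ℝ) = 0 := by simp [Nn]
    rw [this]; exact hf0 i
  · refine (N_y_one hc0 hi).trans ?_
    rw [hf]
    have h1 : bb c (sp K i) ≤ bb (c1 V) (sp K i) :=
      bb_mono (fun i => (hc0 i).le) (fun i => (hc.2 i).2) _
    have h2 : bb (ind S) (⊥ : Submodule K V) ≤ bb c (⊥ : Submodule K V) := by
      refine bb_mono (fun i => ?_) (fun i => ?_) _
      · unfold ind; split_ifs <;> norm_num
      · unfold ind; split_ifs with h
        · rw [hc.1 i h]
        · exact (hc0 i).le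
    have h3 := bb_nonneg (fun i => (hc0 i).le) (sp K i)
    show 4 * _ ≤ 4 * _
    gcongr

theorem Qn_pos {c : V → ℝ} (hc : ∀ i, 0 < c i) {E : Submodule K V} {k : ℕ}
    {x : Submodule K V → ℝ} (hx : x ∈ supOn (Hm E k)) (hne : x ≠ 0) : 0 < Qn c E k x := by
  refine HR_all E c hc k _ (PP_mem hc E k x) fun h0 => hne ?_
  have h1 := sub_PP_mem hc (supOn_mono (Hm_sub E k) hx)
  rw [h0, sub_zero] at h1
  funext F
  by_cases hF : F ∈ Hm E k
  · exact h1 F (fun h => by have := h.2; have := hF.2; omega)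
  · exact hx F hF

theorem y_SF {S : Set V} {k : ℕ} {x : Submodule K V → ℝ} (hx : x ∈ supOn (SF K S k)) {s : V}
    (hs : s ∈ S) : y s x ∈ supOn (SF K S (k+1)) := by
  refine lin_mem (fun F hF => ?_) hx
  rw [y_single]
  split_ifs with h
  · exact Submodule.zero_mem _
  · exact single_mem_supOn (T := SF K S (k+1)) ⟨by rw [rk_sup_sp h, hF.1], SFl_sup hF.2 hs⟩ 1

theorem Pur (n : ℕ) : ∀ S : Finset V, (Sᶜ).card = n → (0:V) ∈ S →
    Submodule.span K (S : Set V) = ⊤ → ∀ (k : ℕ) (x : Submodule K V → ℝ),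
    x ∈ supOn (SF K (S : Set V) k) → x ≠ 0 →
    ∃ δ : ℝ, 0 < δ ∧ ∀ c, Adm (S : Set V) c → δ ≤ Qn c (⊥ : Submodule K V) k x := by
  induction n with
  | zero =>
    intro S hS _ _ k x hx hne
    have hS' : S = Finset.univ := by
      rwa [Finset.card_eq_zero, Finset.compl_eq_empty_iff] at hS
    refine ⟨Qn (c1 V) ⊥ k x, Qn_pos (fun _ => one_pos) (supOn_mono (SF_sub_Hm _ k) hx) hne,
      fun c hc => ?_⟩
    have : c = c1 V := by
      funext i; exact hc.1 i (by simp [hS'])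
    rw [this]
  | succ n ih =>
    intro S hS h0 hspan k x hx hne
    obtain ⟨j, hj⟩ : ∃ j, j ∈ Sᶜ := by
      rw [← Finset.Nonempty, ← Finset.card_pos]; omega
    have hjS : j ∉ S := by simpa using hj
    have hj0 : j ∉ (⊥ : Submodule K V) := by
      rw [Submodule.mem_bot]; rintro rfl; exact hjS h0
    set S' := insert j S with hS'
    have hsub : (S : Set V) ⊆ (S' : Set V) := by simp [hS']
    have hcard : (S'ᶜ).card = n := by
      rw [hS', Finset.compl_insert, Finset.card_erase_of_mem hj, hS]; rfl
    have hspan' : Submodule.span K (S' : Set V) = ⊤ := by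
      rw [eq_top_iff, ← hspan]; exact Submodule.span_mono hsub
    have hx' : x ∈ supOn (SF K (S' : Set V) k) :=
      supOn_mono (T := SF K (S : Set V) k) (T' := SF K (S' : Set V) k)
        (fun F hF => ⟨hF.1, SFl_mono hsub hF.2⟩) hx
    have hxA : x ∈ supOn (AF (⊥ : Submodule K V) (k+1)) :=
      supOn_mono ((SF_sub_Hm _ k).trans (Hm_sub _ k)) hx
    have hz' : y j x ∈ supOn (SF K (S' : Set V) (k+1)) := y_SF hx' (by simp [hS'])
    obtain ⟨δ, hδ, hδc⟩ := ih S' hcard (by simp [hS', h0]) hspan' k x hx' hne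
    have hadm : ∀ c, Adm (S : Set V) c → Adm (S' : Set V) (Function.update c j 1) := by
      intro c hc
      refine ⟨fun i hi => ?_, fun i => ?_⟩
      · by_cases hij : i = j
        · subst hij; simp
        · have : i ∈ S := by simpa [hS', hij] using hi
          simp [hij, hc.1 i this]
      · by_cases hij : i = j
        · subst hij; simp
        · simp [hij, hc.2 i]
    by_cases hz : y j x = 0
    · refine ⟨δ, hδ, fun c hc => (hδc _ (hadm c hc)).trans ?_⟩
      have := mono_zero (fun i => (hc.2 i).1) hj0 hxA hz (Set.mem_Ioi.2 (hc.2 j).1)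
        (Set.mem_Ioi.2 one_pos) (hc.2 j).2
      simpa using this
    · obtain ⟨δ', hδ', hδc'⟩ := ih S' hcard (by simp [hS', h0]) hspan' (k+1) _ hz' hz
      obtain ⟨C1, hC1, hC1'⟩ := N_comm (S : Set V) x hx
      obtain ⟨C2, hC2, hC2'⟩ := N_y_one_bdd K (S : Set V) hspan
      refine ⟨δ * δ' / (C1 * C2 + 1), by positivity, fun c hc => ?_⟩
      have hc0 : ∀ i, 0 < c i := fun i => (hc.2 i).1
      have h1 := mono_prod hc0 hj0 hxA (Set.mem_Ioi.2 (hc.2 j).1)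
        (Set.mem_Ioi.2 one_pos) (hc.2 j).2
      simp only [Function.update_eq_self] at h1
      have h2 := mul_le_mul (hδc _ (hadm c hc)) (hδc' _ (hadm c hc)) hδ'.le
        (Qn_nonneg (upd_pos hc0 j one_pos) _ _ _)
      have h3 : Qn c ⊥ (k+1) (y j x) ≤ C1 * C2 + 1 := by
        have h4 := hC1' c hc (y j) (fun s u => y_comm j s u)
        have h5 := mul_le_mul_of_nonneg_left (hC2' c hc j) hC1
        have h6 := Qn_le_Nn hc0 ⊥ (k+1) (y j x)
        linarith
      rw [div_le_iff₀ (by positivity)]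
      have := mul_le_mul_of_nonneg_left h3 (Qn_nonneg hc0 ⊥ k x)
      linarith

theorem Xop_bd (K V : Type) [Field K] [Fintype K] [AddCommGroup V] [Module K V] [Fintype V] :
    ∃ D : ℝ, 1 ≤ D ∧ ∀ c : V → ℝ, (∀ i, 0 < c i) → ∀ (l : List V) (u : Submodule K V → ℝ),
      Nn c ⊥ (Xop c l u) ≤ D ^ l.length * Nn c ⊥ u := by
  obtain ⟨C, hC0, hC⟩ := T1 K V
  refine ⟨2 + 2 * C, by linarith, fun c hc l => ?_⟩
  induction l with
  | nil => intro u; simp [Xop]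
  | cons i l ih =>
    intro u
    rw [Xop_cons]
    refine (ih _).trans ?_
    have h1 := Nn_add hc ⊥ u ((- c i) • y i u)
    rw [Nn_smul, neg_smul, ← sub_eq_add_neg, neg_sq] at h1
    have h2 := hC c hc ⊥ i u (mem_up_bot _)
    rw [List.length_cons, pow_succ, mul_assoc]
    exact mul_le_mul_of_nonneg_left (by linarith) (by positivity)

noncomputable def ceps (S : Set V) (ε : ℝ) : V → ℝ := fun i => if i ∈ S then 1 else ε

theorem ceps_adm (S : Set V) {ε : ℝ} (h : 0 < ε) (h1 : ε ≤ 1) : Adm S (ceps S ε) := by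
  refine ⟨fun i hi => by simp [ceps, hi], fun i => ?_⟩
  unfold ceps
  split_ifs
  · exact ⟨one_pos, le_rfl⟩
  · exact ⟨h, h1⟩

theorem Xop_small (K : Type) {V : Type} [Field K] [Fintype K] [AddCommGroup V] [Module K V]
    [Fintype V] (S : Set V) (hS : Submodule.span K S = ⊤) (l : List V) (hl : ∀ i ∈ l, i ∉ S) :
    ∃ G : ℝ, 0 ≤ G ∧ ∀ ε : ℝ, 0 < ε → ε ≤ 1 →
      Nn (ceps S ε) ⊥ (one1 K V - Xop (ceps S ε) l (one1 K V)) ≤ G * ε ^ 2 := by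
  obtain ⟨D, hD, hD'⟩ := Xop_bd K V
  obtain ⟨C, hC, hC'⟩ := N_y_one_bdd K S hS
  induction l with
  | nil => exact ⟨0, le_rfl, fun ε _ _ => by simp [Xop, Nn]⟩
  | cons i l ih =>
    obtain ⟨G, hG, hG'⟩ := ih fun i hi => hl i (List.mem_cons_of_mem _ hi)
    refine ⟨2 * G + 2 * (D ^ l.length * C), by positivity, fun ε h0 h1 => ?_⟩
    have hadm := ceps_adm S h0 h1
    have hc0 : ∀ i, 0 < ceps S ε i := fun i => (hadm.2 i).1
    have hci : ceps S ε i = ε := by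
      have := hl i List.mem_cons_self
      simp [ceps, this]
    have e : one1 K V - Xop (ceps S ε) (i :: l) (one1 K V) =
        (one1 K V - Xop (ceps S ε) l (one1 K V)) +
          ε • Xop (ceps S ε) l (y i (one1 K V)) := by
      rw [Xop_cons, hci, map_sub, map_smul]; abel
    rw [e]
    have h2 := Nn_add hc0 ⊥ (one1 K V - Xop (ceps S ε) l (one1 K V))
      (ε • Xop (ceps S ε) l (y i (one1 K V)))
    rw [Nn_smul] at h2
    have h3 := hG' ε h0 h1
    have h4 : Nn (ceps S ε) ⊥ (Xop (ceps S ε) l (y i (one1 K V))) ≤ D ^ l.length * C :=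
      (hD' _ hc0 l _).trans (mul_le_mul_of_nonneg_left (hC' _ hadm i) (by positivity))
    have h5 := mul_le_mul_of_nonneg_left h4 (sq_nonneg ε)
    linarith

theorem HL0 (S : Finset V) (h0 : (0:V) ∈ S) (hspan : Submodule.span K (S : Set V) = ⊤) {k : ℕ}
    {x : Submodule K V → ℝ} (hx : x ∈ supOn (SF K (S : Set V) k))
    (ho : ∀ v ∈ supOn (AF (⊥ : Submodule K V) (k+1)), Bm (ind (S : Set V)) ⊥ x v = 0) : x = 0 := by
  by_contra hne
  obtain ⟨δ, hδ, hδc⟩ := Pur _ S rfl h0 hspan k x hx hne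
  obtain ⟨G, hG, hG'⟩ := Xop_small K (S : Set V) hspan (Sᶜ).toList (by simp)
  obtain ⟨C, hC, hC'⟩ := N_comm (S : Set V) x hx
  have key : ∀ ε : ℝ, 0 < ε → ε ≤ 1 → δ ≤ C * G * ε ^ 2 := by
    intro ε h0 h1
    have hadm := ceps_adm (S : Set V) h0 h1
    have hc0 : ∀ i, 0 < ceps (S : Set V) ε i := fun i => (hadm.2 i).1
    set c := ceps (S : Set V) ε with hcd
    have hδ1 := hδc c hadm
    set l := (Sᶜ).toList with hld
    have hu := PP_mem hc0 ⊥ k x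
    have hz : zeroed c l = ind (S : Set V) := by
      funext i
      by_cases hi : i ∈ S
      · simp [zeroed, hld, hi, ind, hcd, ceps]
      · simp [zeroed, hld, hi, ind]
    have h2 : Bm c ⊥ (Xop c l x) (PP c ⊥ k x) = 0 := by
      rw [Xop_B c l (Finset.nodup_toList _) (mem_up_bot _) (mem_up_bot _), hz]
      exact ho _ hu.1
    have h3 : Qn c ⊥ k x = (-1) ^ k * Bm c ⊥ (x - Xop c l x) (PP c ⊥ k x) := by
      rw [map_sub, LinearMap.sub_apply, h2, sub_zero, Qn, B_PP hc0 x hu]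
    have h4 := cs_N hc0 (x - Xop c l x) hu
    rw [Qn_PP hc0] at h4
    have h5 : Qn c ⊥ k x ^ 2 ≤ Nn c ⊥ (x - Xop c l x) * Qn c ⊥ k x := by
      conv_lhs => rw [h3]
      rw [mul_pow, ← pow_mul, mul_comm k 2, pow_mul, neg_one_sq, one_pow, one_mul]
      exact h4
    have h6 : Qn c ⊥ k x ≤ Nn c ⊥ (x - Xop c l x) := by
      rw [sq] at h5
      exact le_of_mul_le_mul_right h5 (by linarith)
    have h7 := hC' c hadm (LinearMap.id - Xop c l) (fun s u => by
      simp only [LinearMap.sub_apply, LinearMap.id_apply, Xop_y, map_sub])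
    have h8 := mul_le_mul_of_nonneg_left (hG' ε h0 h1) hC
    simp only [LinearMap.sub_apply, LinearMap.id_apply] at h7
    linarith
  have hpos : 0 < C * G + δ := by positivity
  have h1 : δ / (C * G + δ) / 2 ≤ 1 := by
    have : δ / (C * G + δ) ≤ 1 := by rw [div_le_one hpos]; nlinarith
    linarith
  have h2 := key (δ / (C * G + δ) / 2) (by positivity) h1
  set e := δ / (C * G + δ) / 2 with he
  have he0 : 0 < e := by positivity
  have h3 : (C * G + δ) * e = δ / 2 := by rw [he]; field_simp
  have h4 : C * G * e ^ 2 ≤ (C * G + δ) * e := by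
    have : e ^ 2 ≤ e := by nlinarith
    have h5 := mul_le_mul_of_nonneg_left this (mul_nonneg hC hG)
    nlinarith
  linarith

theorem euler_iter (c : V → ℝ) (p : ℕ) : ∀ (k : ℕ) (x : Submodule K V → ℝ),
    x ∈ supOn (Hm (⊥ : Submodule K V) k) → ((ee K c) ^ p) x = 0 → ∀ G : Submodule K V,
    k + p + rk G ≤ Module.finrank K V → Bm c ⊥ x (Pi.single G 1) = 0 := by
  induction p with
  | zero => intro k x _ h G _; rw [pow_zero] at h; simp at h; simp [h]
  | succ p ih =>
    intro k x hx h G hG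
    have h1 := ih (k+1) (ee K c x) (ee_mem_Hm c hx) (by rw [pow_succ] at h; exact h) G (by omega)
    rw [euler c (mem_up_bot _) (mem_up_bot _), NN_Hm hx, NN_single, rk_bot] at h1
    simp only [map_smul, LinearMap.smul_apply, smul_eq_mul, Nat.cast_zero, sub_zero] at h1
    have h2 : ((Module.finrank K V : ℝ) - k - rk G) * Bm c ⊥ x (Pi.single G 1) = 0 := by
      linear_combination h1
    rcases mul_eq_zero.1 h2 with h3 | h3
    · exfalso
      have : ((k + (p+1) + rk G : ℕ) : ℝ) ≤ Module.finrank K V := by exact_mod_cast hG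
      push_cast at this
      have : (0:ℝ) ≤ p := Nat.cast_nonneg p
      linarith
    · exact h3

theorem HL (S : Finset V) (h0 : (0:V) ∈ S) (hspan : Submodule.span K (S : Set V) = ⊤) {k p : ℕ}
    (hp : k + p + k ≤ Module.finrank K V)
    {x : Submodule K V → ℝ} (hx : x ∈ supOn (SF K (S : Set V) k))
    (h : ((ee K (ind (S : Set V))) ^ p) x = 0) : x = 0 := by
  refine HL0 S h0 hspan hx fun v hv => ?_
  refine lin_ext (f := Bm (ind (S : Set V)) ⊥ x) (g := 0) (fun G hG => ?_) hv
  rw [euler_iter _ p k x (supOn_mono (SF_sub_Hm _ k) hx) h G]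
  · simp
  · have := hG.2; rw [rk_bot] at this; omega

theorem ee_SF (S : Set V) {k : ℕ} {x : Submodule K V → ℝ} (hx : x ∈ supOn (SF K S k)) :
    ee K (ind S) x ∈ supOn (SF K S (k+1)) := by
  rw [ee_apply]
  refine Submodule.sum_mem _ fun i _ => ?_
  by_cases hi : i ∈ S
  · exact Submodule.smul_mem _ _ (y_SF hx hi)
  · simp [ind, hi]

theorem ee_pow_SF (S : Set V) (p : ℕ) : ∀ {k : ℕ} {x : Submodule K V → ℝ}, x ∈ supOn (SF K S k) →
    ((ee K (ind S)) ^ p) x ∈ supOn (SF K S (k+p)) := by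
  induction p with
  | zero => intro k x hx; simpa using hx
  | succ p ih =>
    intro k x hx
    rw [pow_succ]
    have := ih (ee_SF S hx)
    rwa [show k + 1 + p = k + (p + 1) by ring] at this

theorem finrank_supOn {ι : Type} [Fintype ι] (T : Set ι) :
    Module.finrank ℝ (supOn T) = Nat.card T := by
  let e : supOn T ≃ₗ[ℝ] (T → ℝ) :=
    { toFun := fun u t => u.1 t.1
      map_add' := fun _ _ => rfl
      map_smul' := fun _ _ => rfl
      invFun := fun f => ⟨fun i => if h : i ∈ T then f ⟨i, h⟩ else 0, fun i hi => by simp [hi]⟩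
      left_inv := fun u => by
        ext i
        by_cases h : i ∈ T
        · simp [h]
        · simp [h, u.2 i h]
      right_inv := fun f => by
        funext t; simp }
  rw [e.finrank_eq, Module.finrank_fintype_fun_eq_card, Nat.card_eq_fintype_card]

theorem count0 (S : Finset V) (h0 : (0:V) ∈ S) (hspan : Submodule.span K (S : Set V) = ⊤) {k p : ℕ}
    (hp : k + p + k ≤ Module.finrank K V) :
    Nat.card (SF K (S : Set V) k) ≤ Nat.card (SF K (S : Set V) (k+p)) := by
  rw [← finrank_supOn, ← finrank_supOn]
  let f : supOn (SF K (S : Set V) k) →ₗ[ℝ] supOn (SF K (S : Set V) (k+p)) :=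
    LinearMap.restrict ((ee K (ind (S : Set V))) ^ p) (fun x hx => ee_pow_SF _ p hx)
  refine LinearMap.finrank_le_finrank_of_injective (f := f) ?_
  rw [← LinearMap.ker_eq_bot, LinearMap.ker_eq_bot']
  intro u hu
  have h1 : ((ee K (ind (S : Set V))) ^ p) u.1 = 0 := congrArg Subtype.val hu
  exact Subtype.ext (HL S h0 hspan hp u.2 h1)

theorem count1 (S : Set V) (hspan : Submodule.span K S = ⊤) {k k' : ℕ} (hk : k ≤ k')
    (hp : k + k' ≤ Module.finrank K V) :
    Nat.card (SF K S k) ≤ Nat.card (SF K S k') := by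
  set S' : Finset V := insert 0 S.toFinset with hS'
  have hS'' : (S' : Set V) = insert 0 S := by simp [hS']
  have e : ∀ F : Submodule K V, SFl K (S' : Set V) F ↔ SFl K S F := by
    intro F
    have : Submodule.span K ((S' : Set V) ∩ F) = Submodule.span K (S ∩ F) := by
      rw [hS'', Set.insert_inter_of_mem (by simp), Submodule.span_insert_zero]
    rw [SFl, SFl, this]
  have e2 : ∀ k, SF K (S' : Set V) k = SF K S k := by
    intro k; ext F; exact and_congr_right fun _ => e F
  have := count0 S' (by simp [hS']) (K := K) (k := k) (p := k' - k)
    (by rw [hS'', Submodule.span_insert_zero]; exact hspan) (by omega)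
  rwa [e2, e2, show k + (k' - k) = k' by omega] at this

end pursec

set_option linter.unusedSectionVars false
set_option linter.unusedSimpArgs false
set_option linter.deprecated false

section RedFinite

theorem finite_field_of_int_finite (K : Type) [Field K] [Module.Finite ℤ K] : Finite K := by
  obtain ⟨p, hp⟩ := CharP.exists K
  rcases Nat.eq_zero_or_pos p with h0 | h0
  · subst h0
    have : CharZero K := CharP.charP_to_charZero K
    exfalso
    have h_int : Algebra.IsIntegral ℤ K := Algebra.IsIntegral.of_finite ℤ K
    have := isField_of_isIntegral_of_isField (R := ℤ) (S := K)
      (FaithfulSMul.algebraMap_injective ℤ K) (Field.toIsField K)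
    exact Int.not_isField this
  · have : NeZero p := ⟨h0.ne'⟩
    let : Algebra (ZMod p) K := ZMod.algebra K p
    have : IsScalarTower ℤ (ZMod p) K := IsScalarTower.of_algebraMap_eq' (RingHom.ext_int _ _)
    have : Module.Finite (ZMod p) K := Module.Finite.of_restrictScalars_finite ℤ (ZMod p) K
    exact Module.finite_of_finite (ZMod p)

theorem int_isJacobsonRing : IsJacobsonRing ℤ := by
  rw [isJacobsonRing_iff_prime_eq]
  intro P hP
  by_cases h0 : P = ⊥
  · subst h0
    refine le_antisymm ?_ Ideal.le_jacobson
    intro x hx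
    have hu := Ideal.mem_jacobson_bot.1 hx x
    rw [Ideal.mem_bot]
    rcases Int.isUnit_iff.1 hu with h | h <;> nlinarith [mul_self_nonneg x, sq_nonneg x]
  · have := hP.isMaximal h0
    exact Ideal.jacobson_eq_self_of_isMaximal

theorem exists_finite_reduction {n m : ℕ} (v : Fin n → Fin m → ℝ) :
    ∃ (K : Type) (_ : Field K) (_ : Finite K) (w : Fin n → Fin m → K),
      ∀ f : Fin m → Fin n, (Matrix.of (fun a => v (f a))).det = 0 ↔
        (Matrix.of (fun a => w (f a))).det = 0 := by
  classical
  let E : Set ℝ := Set.range (fun x : Fin n × Fin m => v x.1 x.2)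
  let R : Subalgebra ℤ ℝ := Algebra.adjoin ℤ E
  have hEf : E.Finite := Set.finite_range _
  have : Algebra.FiniteType ℤ R := by
    rw [← Subalgebra.fg_iff_finiteType]
    exact ⟨hEf.toFinset, by simp [R]⟩
  have := int_isJacobsonRing
  have : IsJacobsonRing R := isJacobsonRing_of_finiteType (A := ℤ)
  let v' : Fin n → Fin m → R := fun i j => ⟨v i j, Algebra.subset_adjoin ⟨(i, j), rfl⟩⟩
  let D : (Fin m → Fin n) → R := fun f => (Matrix.of (fun a => v' (f a))).det
  have hD : ∀ f, ((D f : R) : ℝ) = (Matrix.of (fun a => v (f a))).det := by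
    intro f
    have := RingHom.map_det (R.val : R →+* ℝ) (Matrix.of (fun a => v' (f a)))
    exact this
  let Δ : R := ∏ f ∈ Finset.univ.filter (fun f => D f ≠ 0), D f
  have hΔ : Δ ≠ 0 := Finset.prod_ne_zero_iff.2 (fun f hf => (Finset.mem_filter.1 hf).2)
  have hJ : (⊥ : Ideal R).jacobson = ⊥ :=
    IsJacobsonRing.out ‹_› (Ideal.IsPrime.isRadical Ideal.isPrime_bot)
  have hnot : Δ ∉ (⊥ : Ideal R).jacobson := by
    rw [hJ]; simpa using hΔ
  have : ∃ M : Ideal R, M.IsMaximal ∧ Δ ∉ M := by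
    by_contra! hc
    exact hnot (Ideal.mem_sInf.2 (fun {M} hM => hc M hM.2))
  obtain ⟨M, hM, hΔM⟩ := this
  let : Field (R ⧸ M) := Ideal.Quotient.field M
  have : Algebra.FiniteType ℤ (R ⧸ M) :=
    Algebra.FiniteType.of_surjective (Ideal.Quotient.mkₐ ℤ M) (Ideal.Quotient.mkₐ_surjective ℤ M)
  have : Module.Finite ℤ (R ⧸ M) := finite_of_finite_type_of_isJacobsonRing ℤ (R ⧸ M)
  refine ⟨R ⧸ M, inferInstance, finite_field_of_int_finite _,
    fun i j => Ideal.Quotient.mk M (v' i j), fun f => ?_⟩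
  have e : (Matrix.of (fun a => (fun j => Ideal.Quotient.mk M (v' (f a) j)))).det
      = Ideal.Quotient.mk M (D f) :=
    (RingHom.map_det (Ideal.Quotient.mk M) (Matrix.of (fun a => v' (f a)))).symm
  rw [e, ← hD]
  constructor
  · intro h
    have : D f = 0 := by exact_mod_cast h
    rw [this, map_zero]
  · intro h
    by_contra hne
    have hne' : D f ≠ 0 := fun h0 => hne (by rw [h0]; rfl)
    apply hΔM
    have hdvd : D f ∣ Δ := Finset.dvd_prod_of_mem D (Finset.mem_filter.2 ⟨Finset.mem_univ _, hne'⟩)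
    exact Ideal.mem_of_dvd M hdvd (Ideal.Quotient.eq_zero_iff_mem.1 h)



theorem rank_le_of_bases {F K : Type} [Field F] [Field K] {n m : ℕ}
    (v : Fin n → Fin m → F) (w : Fin n → Fin m → K)
    (hv : Submodule.span F (Set.range v) = ⊤)
    (h : ∀ f : Fin m → Fin n, LinearIndependent F (v ∘ f) → LinearIndependent K (w ∘ f))
    (I : Set (Fin n)) :
    Module.finrank F (Submodule.span F (v '' I)) ≤ Module.finrank K (Submodule.span K (w '' I)) := by
  classical
  obtain ⟨J, hJI, -, hJs, hJl⟩ := exists_linearIndepOn_extension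
    (linearIndepOn_empty F v) (Set.empty_subset I)
  obtain ⟨B, -, hJB, hBs, hBl⟩ := exists_linearIndepOn_extension hJl (Set.subset_univ J)
  have hBtop : Submodule.span F (v '' B) = ⊤ := by
    rw [eq_top_iff, ← hv, Submodule.span_le, ← Set.image_univ]; exact hBs
  have hcard : Fintype.card B = m := by
    have := finrank_span_eq_card hBl
    rw [← Set.image_eq_range, hBtop, finrank_top, Module.finrank_fin_fun] at this
    exact this.symm
  let e : Fin m ≃ B := (Fintype.equivFinOfCardEq hcard).symm
  have h1 : LinearIndependent F (v ∘ (fun a => (e a : Fin n))) :=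
    LinearIndependent.comp hBl e e.injective
  have h2 := h _ h1
  have h3 : LinearIndepOn K w B := by
    have := LinearIndependent.comp h2 e.symm e.symm.injective
    have hc : (w ∘ fun a => (e a : Fin n)) ∘ e.symm = fun x : B => w x := by
      funext x; simp
    rw [hc] at this
    exact this
  have h4 : LinearIndepOn K w J := h3.mono hJB
  have e1 : Submodule.span F (v '' I) = Submodule.span F (v '' J) :=
    le_antisymm (Submodule.span_le.2 hJs) (Submodule.span_mono (Set.image_mono hJI))
  have e2 := finrank_span_eq_card hJl
  have e3 := finrank_span_eq_card h4
  rw [← Set.image_eq_range] at e2 e3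
  rw [e1, e2, ← e3]
  exact Submodule.finrank_mono (Submodule.span_mono (Set.image_mono hJI))

theorem span_of_bases {F K : Type} [Field F] [Field K] {n m : ℕ}
    (v : Fin n → Fin m → F) (w : Fin n → Fin m → K)
    (hv : Submodule.span F (Set.range v) = ⊤)
    (h : ∀ f : Fin m → Fin n, LinearIndependent F (v ∘ f) → LinearIndependent K (w ∘ f)) :
    Submodule.span K (Set.range w) = ⊤ := by
  have := rank_le_of_bases v w hv h Set.univ
  rw [Set.image_univ, Set.image_univ, hv, finrank_top, Module.finrank_fin_fun] at this
  apply Submodule.eq_top_of_finrank_eq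
  refine le_antisymm (Submodule.finrank_le _) ?_
  rw [Module.finrank_fin_fun]; exact this

/-- index sets that are closed of rank `r` -/
def CF {F M : Type} [Field F] [AddCommGroup M] [Module F M] {n : ℕ} (v : Fin n → M) (r : ℕ) :
    Set (Set (Fin n)) :=
  {I | Module.finrank F (Submodule.span F (v '' I)) = r ∧
    ∀ i, v i ∈ Submodule.span F (v '' I) → i ∈ I}

theorem mem_span_iff_rank {F M : Type} [Field F] [AddCommGroup M] [Module F M]
    [FiniteDimensional F M] {n : ℕ} (v : Fin n → M) (I : Set (Fin n)) (i : Fin n) :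
    v i ∈ Submodule.span F (v '' I) ↔
      Module.finrank F (Submodule.span F (v '' (insert i I))) =
        Module.finrank F (Submodule.span F (v '' I)) := by
  have hle : Submodule.span F (v '' I) ≤ Submodule.span F (v '' (insert i I)) :=
    Submodule.span_mono (Set.image_mono (Set.subset_insert i I))
  constructor
  · intro h
    have hh : Submodule.span F (v '' (insert i I)) = Submodule.span F (v '' I) := by
      refine le_antisymm ?_ hle
      rw [Set.image_insert_eq, Submodule.span_le]
      exact Set.insert_subset h Submodule.subset_span
    rw [hh]
  · intro h
    rw [Submodule.eq_of_le_of_finrank_eq hle h.symm]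
    exact Submodule.subset_span ⟨i, Set.mem_insert i I, rfl⟩

theorem CF_eq {F K M N : Type} [Field F] [Field K] [AddCommGroup M] [Module F M]
    [FiniteDimensional F M] [AddCommGroup N] [Module K N] [FiniteDimensional K N] {n : ℕ}
    (v : Fin n → M) (w : Fin n → N)
    (h : ∀ I : Set (Fin n), Module.finrank F (Submodule.span F (v '' I)) =
      Module.finrank K (Submodule.span K (w '' I))) (r : ℕ) :
    CF (F := F) v r = CF (F := K) w r := by
  ext I
  unfold CF
  simp only [Set.mem_ofPred_eq, mem_span_iff_rank, h]

theorem card_CF {K M : Type} [Field K] [AddCommGroup M] [Module K M] {n : ℕ}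
    (w : Fin n → M) (r : ℕ) :
    Nat.card (CF (F := K) w r) = Nat.card (SF K (Set.range w) r) := by
  have key : ∀ I : Set (Fin n), (∀ i, w i ∈ Submodule.span K (w '' I) → i ∈ I) →
      {i | w i ∈ Submodule.span K (w '' I)} = I := fun I hI =>
    Set.Subset.antisymm (fun i hi => hI i hi) (fun i hi => Submodule.subset_span ⟨i, hi, rfl⟩)
  have key2 : ∀ G : Submodule K M, Set.range w ∩ (G : Set M) = w '' {i | w i ∈ G} := by
    intro G; ext x; constructor
    · rintro ⟨⟨i, rfl⟩, hi⟩; exact ⟨i, hi, rfl⟩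
    · rintro ⟨i, hi, rfl⟩; exact ⟨⟨i, rfl⟩, hi⟩
  refine Nat.card_congr
    { toFun := fun I => ⟨Submodule.span K (w '' I.1), I.2.1, ?_⟩
      invFun := fun G => ⟨{i | w i ∈ G.1}, ?_, ?_⟩
      left_inv := ?_
      right_inv := ?_ }
  · unfold SFl
    rw [key2, key I.1 I.2.2]
  · have := G.2.2
    unfold SFl at this
    rw [key2] at this
    rw [this]; exact G.2.1
  · have := G.2.2
    unfold SFl at this
    rw [key2] at this
    rw [this]; exact fun i hi => hi
  · intro I; exact Subtype.ext (key I.1 I.2.2)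
  · intro G
    have := G.2.2
    unfold SFl at this
    rw [key2] at this
    exact Subtype.ext this

theorem count_real {n m : ℕ} (v : Fin n → Fin m → ℝ)
    (hv : Submodule.span ℝ (Set.range v) = ⊤) {k k' : ℕ} (hk : k ≤ k') (hp : k + k' ≤ m) :
    Nat.card (CF (F := ℝ) v k) ≤ Nat.card (CF (F := ℝ) v k') := by
  classical
  obtain ⟨K, _, _, w, hw⟩ := exists_finite_reduction v
  have := Fintype.ofFinite K
  have hli : ∀ f : Fin m → Fin n, LinearIndependent ℝ (v ∘ f) ↔ LinearIndependent K (w ∘ f) := by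
    intro f
    have a1 := Matrix.linearIndependent_rows_iff_isUnit (A := Matrix.of (fun a => v (f a)))
    have a2 := Matrix.linearIndependent_rows_iff_isUnit (A := Matrix.of (fun a => w (f a)))
    rw [Matrix.isUnit_iff_isUnit_det, isUnit_iff_ne_zero] at a1 a2
    exact a1.trans ((not_congr (hw f)).trans a2.symm)
  have hws := span_of_bases v w hv (fun f => (hli f).1)
  have hr : ∀ I : Set (Fin n), Module.finrank ℝ (Submodule.span ℝ (v '' I)) =
      Module.finrank K (Submodule.span K (w '' I)) := fun I =>
    le_antisymm (rank_le_of_bases v w hv (fun f => (hli f).1) I)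
      (rank_le_of_bases w v hws (fun f => (hli f).2) I)
  rw [CF_eq v w hr, CF_eq v w hr, card_CF, card_CF]
  exact count1 _ hws hk (by rw [Module.finrank_fin_fun]; exact hp)

end RedFinite


section Affine

/-- homogenization -/
def hlift {d : ℕ} (x : Fin d → ℝ) : Fin (d + 1) → ℝ := Fin.cons 1 x

/-- inclusion as the hyperplane at infinity -/
def hinf (d : ℕ) : (Fin d → ℝ) →ₗ[ℝ] (Fin (d + 1) → ℝ) where
  toFun x := Fin.cons 0 x
  map_add' x y := by
    funext i; refine Fin.cases ?_ (fun j => ?_) i <;> simp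
  map_smul' c x := by
    funext i; refine Fin.cases ?_ (fun j => ?_) i <;> simp

theorem hinf_zero {d : ℕ} (x : Fin d → ℝ) : hinf d x 0 = 0 := rfl

theorem hinf_succ {d : ℕ} (x : Fin d → ℝ) (j : Fin d) : hinf d x j.succ = x j := rfl

theorem hlift_zero {d : ℕ} (x : Fin d → ℝ) : hlift x 0 = 1 := rfl

theorem hlift_succ {d : ℕ} (x : Fin d → ℝ) (j : Fin d) : hlift x j.succ = x j := rfl

theorem hinf_sub {d : ℕ} (x y : Fin d → ℝ) : hinf d (x - y) = hlift x - hlift y := by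
  funext i
  refine Fin.cases ?_ (fun j => ?_) i
  · simp [hinf_zero, hlift_zero]
  · simp [hinf_succ, hlift_succ]

theorem hinf_injective (d : ℕ) : Function.Injective (hinf d) := by
  intro x y h
  funext j
  have := congrFun h j.succ
  rwa [hinf_succ, hinf_succ] at this

theorem span_hlift {d : ℕ} (S : Set (Fin d → ℝ)) {s : Fin d → ℝ} (hs : s ∈ S) :
    Submodule.span ℝ (hlift '' S) =
      Submodule.span ℝ {hlift s} ⊔ (vectorSpan ℝ S).map (hinf d) := by
  apply le_antisymm
  · rw [Submodule.span_le]
    rintro _ ⟨x, hx, rfl⟩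
    refine Submodule.mem_sup.2 ⟨hlift s, Submodule.mem_span_singleton_self _, hinf d (x - s),
      Submodule.mem_map_of_mem (vsub_mem_vectorSpan ℝ hx hs), ?_⟩
    rw [hinf_sub]; abel
  · refine sup_le ?_ ?_
    · rw [Submodule.span_le, Set.singleton_subset_iff]
      exact Submodule.subset_span ⟨s, hs, rfl⟩
    · rw [vectorSpan_def, Submodule.map_span_le]
      rintro _ ⟨a, ha, b, hb, rfl⟩
      show hinf d (a - b) ∈ _
      rw [hinf_sub]
      exact Submodule.sub_mem _ (Submodule.subset_span ⟨a, ha, rfl⟩)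
        (Submodule.subset_span ⟨b, hb, rfl⟩)

theorem finrank_span_hlift {d : ℕ} (S : Set (Fin d → ℝ)) (hS : S.Nonempty) :
    Module.finrank ℝ (Submodule.span ℝ (hlift '' S)) =
      Module.finrank ℝ (vectorSpan ℝ S) + 1 := by
  obtain ⟨s, hs⟩ := hS
  rw [span_hlift S hs]
  have h0 : hlift s ≠ 0 := fun h => by
    have := congrFun h 0
    rw [hlift_zero] at this
    exact one_ne_zero this
  have hdis : Submodule.span ℝ {hlift s} ⊓ (vectorSpan ℝ S).map (hinf d) = ⊥ := by
    rw [eq_bot_iff]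
    rintro y ⟨h1, h2⟩
    obtain ⟨c, rfl⟩ := Submodule.mem_span_singleton.1 h1
    obtain ⟨u, -, hu⟩ := h2
    have := congrFun hu 0
    rw [hinf_zero, Pi.smul_apply, hlift_zero, smul_eq_mul, mul_one] at this
    rw [← this]; simp
  have := Submodule.finrank_sup_add_finrank_inf_eq (Submodule.span ℝ {hlift s})
    ((vectorSpan ℝ S).map (hinf d))
  rw [hdis, finrank_bot, add_zero, finrank_span_singleton h0,
    (Submodule.equivMapOfInjective (hinf d) (hinf_injective d) (vectorSpan ℝ S)).symm.finrank_eq] at this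
  rw [this, add_comm]

theorem mem_span_hlift {d : ℕ} (S : Set (Fin d → ℝ)) (hS : S.Nonempty) (x : Fin d → ℝ) :
    hlift x ∈ Submodule.span ℝ (hlift '' S) ↔ x ∈ affineSpan ℝ S := by
  obtain ⟨s, hs⟩ := hS
  rw [span_hlift S hs, ← AffineSubspace.vsub_right_mem_direction_iff_mem
    (subset_affineSpan ℝ S hs), direction_affineSpan]
  show _ ↔ x - s ∈ _
  constructor
  · intro h
    obtain ⟨y, hy, z, ⟨u, hu, rfl⟩, e⟩ := Submodule.mem_sup.1 h
    obtain ⟨c, rfl⟩ := Submodule.mem_span_singleton.1 hy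
    have hc := congrFun e 0
    rw [Pi.add_apply, hinf_zero, Pi.smul_apply, hlift_zero, hlift_zero, smul_eq_mul, mul_one,
      add_zero] at hc
    subst hc
    have : x - s = u := hinf_injective d (by rw [hinf_sub, ← e, one_smul]; abel)
    rw [this]; exact hu
  · intro h
    refine Submodule.mem_sup.2 ⟨hlift s, Submodule.mem_span_singleton_self _, hinf d (x - s),
      Submodule.mem_map_of_mem h, ?_⟩
    rw [hinf_sub]; abel

theorem card_flats {n d : ℕ} (P : Fin n → (Fin d → ℝ)) (r : ℕ) (hr : 1 ≤ r) :
    Nat.card {W : AffineSubspace ℝ (Fin d → ℝ) // IsFlatOf P W ∧ flatRank W = r} =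
      Nat.card (CF (F := ℝ) (fun i => hlift (P i)) r) := by
  have him : ∀ I : Set (Fin n), (fun i => hlift (P i)) '' I = hlift '' (P '' I) := fun I =>
    (Set.image_image _ _ _).symm
  have key2 : ∀ G : AffineSubspace ℝ (Fin d → ℝ),
      Set.range P ∩ (G : Set (Fin d → ℝ)) = P '' {i | P i ∈ G} := by
    intro G; ext x; constructor
    · rintro ⟨⟨i, rfl⟩, hi⟩; exact ⟨i, hi, rfl⟩
    · rintro ⟨i, hi, rfl⟩; exact ⟨⟨i, rfl⟩, hi⟩
  have hW : ∀ W, IsFlatOf P W → affineSpan ℝ (P '' {i | P i ∈ W}) = W ∧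
      (P '' {i | P i ∈ W}).Nonempty := by
    intro W h
    have h2 : affineSpan ℝ (P '' {i | P i ∈ W}) = W := by
      rw [← key2]; exact h.2.symm
    refine ⟨h2, ?_⟩
    have := h.1
    rw [← h2, affineSpan_nonempty] at this
    exact this
  have hI : ∀ I ∈ CF (F := ℝ) (fun i => hlift (P i)) r, (P '' I).Nonempty ∧
      {i | P i ∈ affineSpan ℝ (P '' I)} = I := by
    intro I hI
    have hne : (P '' I).Nonempty := by
      rw [Set.nonempty_iff_ne_empty]
      intro h0
      have := hI.1
      rw [him, h0, Set.image_empty, Submodule.span_empty, finrank_bot] at this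
      omega
    refine ⟨hne, Set.Subset.antisymm (fun i hi => hI.2 i ?_)
      (fun i hi => subset_affineSpan ℝ _ ⟨i, hi, rfl⟩)⟩
    rw [him]
    exact (mem_span_hlift _ hne _).2 hi
  refine Nat.card_congr
    { toFun := fun W => ⟨{i | P i ∈ W.1}, ?_, ?_⟩
      invFun := fun I => ⟨affineSpan ℝ (P '' I.1), ⟨?_, ?_⟩, ?_⟩
      left_inv := ?_
      right_inv := ?_ }
  · obtain ⟨h1, h2⟩ := hW W.1 W.2.1
    rw [him, finrank_span_hlift _ h2, ← direction_affineSpan, h1]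
    exact W.2.2
  · obtain ⟨h1, h2⟩ := hW W.1 W.2.1
    intro i hi
    rw [him] at hi
    have := (mem_span_hlift _ h2 _).1 hi
    rw [h1] at this
    exact this
  · rw [affineSpan_nonempty]; exact (hI I.1 I.2).1
  · rw [key2, (hI I.1 I.2).2]
  · unfold flatRank
    rw [direction_affineSpan, ← finrank_span_hlift _ (hI I.1 I.2).1, ← him]
    exact I.2.1
  · intro W
    exact Subtype.ext (hW W.1 W.2.1).1
  · intro I
    exact Subtype.ext (hI I.1 I.2).2

theorem span_hlift_top {n d : ℕ} (P : Fin n → (Fin d → ℝ))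
    (hspan : affineSpan ℝ (Set.range P) = ⊤) :
    Submodule.span ℝ (Set.range (fun i => hlift (P i))) = ⊤ := by
  have hne : (Set.range P).Nonempty := by
    rw [← affineSpan_nonempty ℝ, hspan]
    exact ⟨0, trivial⟩
  have : Set.range (fun i => hlift (P i)) = hlift '' (Set.range P) := Set.range_comp hlift P
  rw [this]
  apply Submodule.eq_top_of_finrank_eq
  rw [finrank_span_hlift _ hne, ← direction_affineSpan, hspan, AffineSubspace.direction_top,
    finrank_top, Module.finrank_fin_fun, Module.finrank_fin_fun]

end Affine

theorem top_heavy_counting_points {n d : ℕ} (hd : 1 ≤ d) (P : Fin n → (Fin d → ℝ))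
    (hspan : affineSpan ℝ (Set.range P) = ⊤)
    (r r' : ℕ) (hr : 1 ≤ r) (hrr' : r ≤ r') (hsum : r + r' ≤ d + 1) :
    Nat.card {W : AffineSubspace ℝ (Fin d → ℝ) // IsFlatOf P W ∧ flatRank W = r} ≤
      Nat.card {W : AffineSubspace ℝ (Fin d → ℝ) // IsFlatOf P W ∧ flatRank W = r'} := by
  rw [card_flats P r hr, card_flats P r' (hr.trans hrr')]
  exact count_real (fun i => hlift (P i)) (span_hlift_top P hspan) hrr' hsum
end

section
/- (Hard Lefschetz for 𝔸_ε, surjectivity) Let N ≥ 1, m : Fin N → ℕ, let I be the ideal of ℚ[x₁,…,x_N] generated by x₁^{m₁+1},…,x_N^{m_N+1}, let ω = x₁ + ⋯ + x_N and D = ∑ᵢ m i. For every integer k with 2k ≤ D and every homogeneous polynomial q of degree D − k, there exists a homogeneous polynomial p of degree k with q − ω^{D−2k} · p ∈ I. Equivalently, multiplication by ω^{D−2k} is surjective from the degree-k graded piece of ℚ[x₁,…,x_N]/I onto the degree-(D−k) piece. -/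
open MvPolynomial

namespace HL

variable {N : ℕ}

/-- The lowering operator. -/
noncomputable def F (m : Fin N → ℕ) (p : MvPolynomial (Fin N) ℚ) : MvPolynomial (Fin N) ℚ :=
  ∑ i, ((m i : MvPolynomial (Fin N) ℚ) * pderiv i p - X i * pderiv i (pderiv i p))

/-- The ideal. -/
noncomputable def J (m : Fin N → ℕ) : Ideal (MvPolynomial (Fin N) ℚ) :=
  Ideal.span (Set.range fun i : Fin N => (X i : MvPolynomial (Fin N) ℚ) ^ (m i + 1))

/-- The Lefschetz element. -/
noncomputable def om (N : ℕ) : MvPolynomial (Fin N) ℚ := ∑ i, X i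

lemma F_add (m : Fin N → ℕ) (p q) : F m (p + q) = F m p + F m q := by
  simp only [F, map_add, ← Finset.sum_add_distrib]
  exact Finset.sum_congr rfl fun i _ => by ring

lemma F_zero (m : Fin N → ℕ) : F m 0 = 0 := by simp [F]

lemma F_C_mul (m : Fin N → ℕ) (c : ℚ) (p) : F m (C c * p) = C c * F m p := by
  simp only [F, Finset.mul_sum]
  refine Finset.sum_congr rfl fun i _ => ?_
  simp only [Derivation.leibniz, pderiv_C, smul_eq_mul, mul_zero, add_zero]
  ring

lemma F_sub (m : Fin N → ℕ) (p q) : F m (p - q) = F m p - F m q := by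
  simp only [F, map_sub, ← Finset.sum_sub_distrib]
  exact Finset.sum_congr rfl fun i _ => by ring

lemma pderiv_om (i : Fin N) : pderiv i (om N) = 1 := by
  simp [om, pderiv_X, Pi.single_apply]

lemma om_hom : (om N).IsHomogeneous 1 :=
  IsHomogeneous.sum _ _ _ fun i _ => isHomogeneous_X _ _

lemma F_om (m : Fin N → ℕ) (p : MvPolynomial (Fin N) ℚ) (d : ℕ) (hp : p.IsHomogeneous d) :
    F m (om N * p) = om N * F m p + C ((∑ i, m i : ℕ) - 2 * d : ℚ) * p := by
  have h := hp.sum_X_mul_pderiv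
  have e : C ((∑ i, m i : ℕ) - 2 * d : ℚ) * p
      = ∑ i, ((m i : MvPolynomial (Fin N) ℚ) * p - 2 * (X i * pderiv i p)) := by
    rw [Finset.sum_sub_distrib, ← Finset.mul_sum, h, ← Finset.sum_mul]
    have h2 : (C 2 : MvPolynomial (Fin N) ℚ) = 2 := map_ofNat C 2
    simp [h2]
    ring
  rw [e, F, F, Finset.mul_sum, ← Finset.sum_add_distrib]
  refine Finset.sum_congr rfl fun i _ => ?_
  simp only [Derivation.leibniz, pderiv_om, smul_eq_mul, map_add, pderiv_one, mul_one]
  ring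

lemma F_hom (m : Fin N → ℕ) (p : MvPolynomial (Fin N) ℚ) (d : ℕ) (hp : p.IsHomogeneous (d + 1)) :
    (F m p).IsHomogeneous d := by
  refine IsHomogeneous.sum _ _ _ fun i _ => ?_
  have h1 : (pderiv i p).IsHomogeneous d := by simpa using hp.pderiv (i := i)
  refine IsHomogeneous.sub ?_ ?_
  · have := (isHomogeneous_C (Fin N) (m i : ℚ)).mul h1
    simpa using this
  · cases d with
    | zero =>
      rw [← totalDegree_zero_iff_isHomogeneous, totalDegree_eq_zero_iff_eq_C] at h1
      rw [h1, pderiv_C, mul_zero]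
      exact isHomogeneous_zero _ _ _
    | succ d =>
      have h2 : (pderiv i (pderiv i p)).IsHomogeneous d := by simpa using h1.pderiv (i := i)
      rw [add_comm d 1]
      exact (isHomogeneous_X _ _).mul h2

lemma F_gen (m : Fin N → ℕ) (r : MvPolynomial (Fin N) ℚ) (i : Fin N) :
    F m (r * X i ^ (m i + 1)) ∈ J m := by
  have hg : (X i : MvPolynomial (Fin N) ℚ) ^ (m i + 1) ∈ J m :=
    Ideal.subset_span ⟨i, rfl⟩
  refine Ideal.sum_mem _ fun j _ => ?_
  by_cases hj : j = i
  · subst hj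
    obtain ⟨s, hs⟩ : ∃ s : MvPolynomial (Fin N) ℚ,
      (m j : MvPolynomial (Fin N) ℚ) * pderiv j (r * X j ^ (m j + 1))
        - X j * pderiv j (pderiv j (r * X j ^ (m j + 1))) = s * X j ^ (m j + 1) := by
      refine ⟨(m j : MvPolynomial (Fin N) ℚ) * pderiv j r - X j * pderiv j (pderiv j r)
        - 2 * ((m j : MvPolynomial (Fin N) ℚ) + 1) * pderiv j r, ?_⟩
      simp only [Derivation.leibniz, Derivation.leibniz_pow, smul_eq_mul, map_add, pderiv_X_self,
        nsmul_eq_mul, mul_one, Nat.add_sub_cancel, Derivation.map_natCast]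
      rcases Nat.eq_zero_or_pos (m j) with h | h
      · simp [h]; ring
      · obtain ⟨t, ht⟩ := Nat.exists_eq_succ_of_ne_zero h.ne'
        simp [ht]; ring
    rw [hs]
    exact Ideal.mul_mem_left _ _ hg
  · have h0 : pderiv j (X i : MvPolynomial (Fin N) ℚ) = 0 := pderiv_X_of_ne (Ne.symm hj)
    simp only [Derivation.leibniz, Derivation.leibniz_pow, smul_eq_mul, map_add, h0,
      smul_zero, mul_zero, zero_add, add_zero]
    rw [show ∀ a b c d : MvPolynomial (Fin N) ℚ, a * (b * c) - d * (b * pderiv j (pderiv j r))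
      = (a * c - d * pderiv j (pderiv j r)) * b by intros; ring]
    exact Ideal.mul_mem_left _ _ hg

lemma F_mem (m : Fin N → ℕ) (p : MvPolynomial (Fin N) ℚ) (hp : p ∈ J m) : F m p ∈ J m := by
  suffices h : ∀ r, F m (r * p) ∈ J m by simpa using h 1
  refine Submodule.span_induction (p := fun p _ => ∀ r, F m (r * p) ∈ J m) ?_ ?_ ?_ ?_ hp
  · rintro _ ⟨i, rfl⟩ r
    exact F_gen m r i
  · intro r; simpa [F_zero] using (J m).zero_mem
  · intro x y _ _ hx hy r
    rw [mul_add, F_add]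
    exact (J m).add_mem (hx r) (hy r)
  · intro a x _ hx r
    rw [smul_eq_mul, ← mul_assoc]
    exact hx _

lemma big_mem (m : Fin N → ℕ) (p : MvPolynomial (Fin N) ℚ) (d : ℕ) (hp : p.IsHomogeneous d)
    (hd : ∑ i, m i < d) : p ∈ J m := by
  rw [p.as_sum]
  refine Ideal.sum_mem _ fun a ha => ?_
  have hdeg : ∑ i, a i = d := by
    have := hp (mem_support_iff.1 ha)
    rw [← this, Finsupp.weight_apply, Finsupp.sum_fintype] <;> simp
  obtain ⟨i, -, hi⟩ : ∃ i ∈ Finset.univ, m i < a i := by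
    apply Finset.exists_lt_of_sum_lt
    rwa [hdeg]
  have hg : (X i : MvPolynomial (Fin N) ℚ) ^ (m i + 1) ∈ J m :=
    Ideal.subset_span ⟨i, rfl⟩
  refine Ideal.mem_of_dvd _ ?_ hg
  rw [X_pow_eq_monomial, monomial_dvd_monomial]
  refine ⟨Or.inr ?_, one_dvd _⟩
  rw [Finsupp.single_le_iff]
  exact hi

lemma iter_hom (m : Fin N → ℕ) (w : MvPolynomial (Fin N) ℚ) (d j : ℕ)
    (hw : w.IsHomogeneous (d + j)) : ((F m)^[j] w).IsHomogeneous d := by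
  induction j generalizing d with
  | zero => simpa using hw
  | succ j ih =>
    rw [Function.iterate_succ_apply']
    exact F_hom _ _ _ (ih (d + 1) (by rwa [show d + 1 + j = d + (j + 1) by ring]))

/-- `E F^{j+1} w ≡ (j+1)(n-j) F^j w` -/
lemma EF (m : Fin N → ℕ) (w : MvPolynomial (Fin N) ℚ) (d j : ℕ)
    (hw : w.IsHomogeneous (d + j)) (hE : om N * w ∈ J m) :
    om N * (F m)^[j+1] w - C ((j + 1) * (2 * (d + j) - (∑ i, m i : ℕ) - j) : ℚ) * (F m)^[j] w
      ∈ J m := by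
  induction j generalizing d with
  | zero =>
    have h := F_om m w d (by simpa using hw)
    have h2 := F_mem m _ hE
    rw [h] at h2
    convert h2 using 1
    simp
    ring
  | succ j ih =>
    have h0 := ih (d + 1) (by rwa [show d + 1 + j = d + (j + 1) by ring])
    have h1 := iter_hom m w d (j + 1) hw
    have h := F_om m _ d h1
    have h2 := F_mem m _ h0
    rw [F_sub, h, F_C_mul] at h2
    simp only [← Function.iterate_succ_apply'] at h2
    convert h2 using 1
    have h2 : (C 2 : MvPolynomial (Fin N) ℚ) = 2 := map_ofNat C 2
    simp [h2]
    ring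

lemma EnFn (m : Fin N → ℕ) (w : MvPolynomial (Fin N) ℚ) (k n j : ℕ) (hn : 2 * k + n = ∑ i, m i)
    (hj : j ≤ n)
    (hw : w.IsHomogeneous (k + n)) (hE : om N * w ∈ J m) :
    ∃ c : ℚ, c ≠ 0 ∧ om N ^ j * (F m)^[j] w - C c * w ∈ J m := by
  induction j with
  | zero => exact ⟨1, one_ne_zero, by simp⟩
  | succ j ih =>
    obtain ⟨c, hc, h⟩ := ih (by omega)
    have h1 := EF m w (k + n - j) j (by rwa [show k + n - j + j = k + n by omega]) hE
    rw [← hn] at h1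
    refine ⟨(j + 1) * (n - j) * c, ?_, ?_⟩
    · have : (j : ℚ) + 1 ≤ n := by exact_mod_cast hj
      have h3 : (n : ℚ) - j ≠ 0 := by linarith
      positivity
    · have e : ((j + 1) * (2 * ((k + n - j : ℕ) + j) - (2 * k + n : ℕ) - j) : ℚ)
          = (j + 1) * (n - j) := by
        rw [Nat.cast_sub (by omega)]; push_cast; ring
      rw [e] at h1
      convert (J m).add_mem ((J m).mul_mem_left (om N ^ j) h1)
        ((J m).mul_mem_left (C ((j + 1) * (n - j) : ℚ)) h) using 1
      rw [C_mul (a := ((j + 1) * (n - j) : ℚ)) (a' := c)]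
      ring

lemma main_step (m : Fin N → ℕ) (k n : ℕ) (hn : 2 * k + n = ∑ i, m i)
    (q : MvPolynomial (Fin N) ℚ) (hq : q.IsHomogeneous (k + n))
    (key : ∃ p : MvPolynomial (Fin N) ℚ, p.IsHomogeneous k ∧
      om N * (q - om N ^ n * p) ∈ J m) :
    ∃ p : MvPolynomial (Fin N) ℚ, p.IsHomogeneous k ∧ q - om N ^ n * p ∈ J m := by
  obtain ⟨p, hp, h⟩ := key
  have hw : (q - om N ^ n * p).IsHomogeneous (k + n) := by
    refine hq.sub ?_
    have := (om_hom (N := N)).pow n |>.mul hp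
    rwa [one_mul, add_comm] at this
  obtain ⟨c, hc, h2⟩ := EnFn m _ k n n hn le_rfl hw h
  refine ⟨p + C c⁻¹ * (F m)^[n] (q - om N ^ n * p), hp.add ?_, ?_⟩
  · have := (isHomogeneous_C (Fin N) c⁻¹).mul (iter_hom m _ k n hw)
    rwa [zero_add] at this
  · have e : (C c⁻¹ * C c : MvPolynomial (Fin N) ℚ) = 1 := by
      rw [← C_mul, inv_mul_cancel₀ hc, C_1]
    convert (J m).mul_mem_left (-C c⁻¹) h2 using 1
    linear_combination (-(q - om N ^ n * p)) * e

lemma main (m : Fin N → ℕ) (k n : ℕ) (hn : 2 * k + n = ∑ i, m i)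
    (q : MvPolynomial (Fin N) ℚ) (hq : q.IsHomogeneous (k + n)) :
    ∃ p : MvPolynomial (Fin N) ℚ, p.IsHomogeneous k ∧ q - om N ^ n * p ∈ J m := by
  induction k generalizing n q with
  | zero =>
    refine main_step m 0 n hn q hq ⟨0, isHomogeneous_zero _ _ _, ?_⟩
    rw [mul_zero, sub_zero]
    exact big_mem m _ _ (om_hom.mul hq) (by omega)
  | succ k ih =>
    refine main_step m (k + 1) n hn q hq ?_
    have h1 : (om N * q).IsHomogeneous (k + (n + 2)) := by
      have := (om_hom (N := N)).mul hq
      rwa [show 1 + (k + 1 + n) = k + (n + 2) by ring] at this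
    obtain ⟨u, hu, h⟩ := ih (n + 2) (by omega) _ h1
    refine ⟨om N * u, ?_, ?_⟩
    · rw [add_comm k 1]
      exact om_hom.mul hu
    · convert h using 1
      ring

end HL

theorem hard_lefschetz_surjective (N : ℕ) (hN : 1 ≤ N) (m : Fin N → ℕ)
    (I : Ideal (MvPolynomial (Fin N) ℚ))
    (hI : I = Ideal.span (Set.range fun i : Fin N => (X i : MvPolynomial (Fin N) ℚ) ^ (m i + 1)))
    (k : ℕ) (hk : 2 * k ≤ ∑ i, m i)
    (q : MvPolynomial (Fin N) ℚ) (hq : q.IsHomogeneous ((∑ i, m i) - k)) :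
    ∃ p : MvPolynomial (Fin N) ℚ, p.IsHomogeneous k ∧
      q - (∑ i, X i : MvPolynomial (Fin N) ℚ) ^ ((∑ i, m i) - 2 * k) * p ∈ I := by
  subst hI
  exact HL.main m k ((∑ i, m i) - 2 * k) (by omega) q
    (by rwa [show k + ((∑ i, m i) - 2 * k) = (∑ i, m i) - k by omega])
end
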